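/- Let G=(V,E) be a finite simple graph and let u,v ∈ V be a non-adjacent pair of vertices. If {u,v} is globally linked in G in ℝ², then there is an ℛ₂-component H of G with u,v ∈ V(H) and κ_H(u,v) ≥ 3. -/

import Mathlib

open scoped BigOperators

noncomputable section

namespace Rigidity

variable {V : Type*}

/-- Euclidean distance between two points of `ℝ^d` (given as coordinate functions). -/
def eDist {d : ℕ} (x y : Fin d → ℝ) : ℝ := Real.sqrt (∑ i, (x i - y i) ^ 2)

/-- Two frameworks `(G,p)` and `(G,q)` are equivalent if corresponding edge lengths agree. -/
def Equivalent {d : ℕ} (G : SimpleGraph V) (p q : V → Fin d → ℝ) : Prop :=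
  ∀ u v : V, G.Adj u v → eDist (p u) (p v) = eDist (q u) (q v)

/-- Two placements are congruent if all pairwise distances agree. -/
def Congruent {d : ℕ} (p q : V → Fin d → ℝ) : Prop :=
  ∀ u v : V, eDist (p u) (p v) = eDist (q u) (q v)

/-- A placement is generic if the multiset of its coordinates is algebraically
independent over `ℚ`. -/
def Generic {d : ℕ} (p : V → Fin d → ℝ) : Prop :=
  AlgebraicIndependent ℚ (fun vi : V × Fin d => p vi.1 vi.2)

/-- `{u,v}` is globally linked in the framework `(G,p)`. -/
def GloballyLinkedIn {d : ℕ} (G : SimpleGraph V) (p : V → Fin d → ℝ) (u v : V) : Prop :=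
  ∀ q : V → Fin d → ℝ, Equivalent G p q → eDist (q u) (q v) = eDist (p u) (p v)

/-- `{u,v}` is globally `d`-linked in `G`. -/
def GloballyLinked (d : ℕ) (G : SimpleGraph V) (u v : V) : Prop :=
  ∀ p : V → Fin d → ℝ, Generic p → GloballyLinkedIn G p u v

/-- The framework `(G,p)` is rigid. -/
def RigidFramework {d : ℕ} (G : SimpleGraph V) (p : V → Fin d → ℝ) : Prop :=
  ∃ ε > (0:ℝ), ∀ q : V → Fin d → ℝ, Equivalent G p q →
    (∀ v, eDist (p v) (q v) < ε) → Congruent p q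

/-- `G` is `d`-rigid: every generic framework of `G` in `ℝ^d` is rigid. -/
def IsRigidGraph (d : ℕ) (G : SimpleGraph V) : Prop :=
  ∀ p : V → Fin d → ℝ, Generic p → RigidFramework G p

/-- The framework `(G,p)` is globally rigid. -/
def GloballyRigidFramework {d : ℕ} (G : SimpleGraph V) (p : V → Fin d → ℝ) : Prop :=
  ∀ q : V → Fin d → ℝ, Equivalent G p q → Congruent p q

/-- The row of the rigidity matrix corresponding to the (ordered) edge `(u,v)`. -/
def edgeVec [DecidableEq V] {d : ℕ} (p : V → Fin d → ℝ) (u v : V) : V × Fin d → ℝ :=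
  fun wi => if wi.1 = u then p u wi.2 - p v wi.2
            else if wi.1 = v then p v wi.2 - p u wi.2 else 0

/-- The rank of the set of rows of the rigidity matrix of `(·,p)` indexed by `F`. -/
def rankAt [DecidableEq V] (d : ℕ) (p : V → Fin d → ℝ) (F : Set (Sym2 V)) : ℕ :=
  Module.finrank ℝ (Submodule.span ℝ
    {x : V × Fin d → ℝ | ∃ u v : V, s(u, v) ∈ F ∧ x = edgeVec p u v})

/-- `r_d(F)`: the rank of the set of rows indexed by `F` of the rigidity matrix of a
generic framework, equivalently the maximum of this rank over all placements. -/
def rd [DecidableEq V] (d : ℕ) (F : Set (Sym2 V)) : ℕ :=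
  sSup {n : ℕ | ∃ p : V → Fin d → ℝ, n = rankAt d p F}

/-- An edge set is `ℛ_d`-independent if its rank equals its cardinality. -/
def RdIndep [DecidableEq V] (d : ℕ) (F : Set (Sym2 V)) : Prop := rd d F = F.ncard

/-- An `ℛ_d`-circuit: not independent, but every proper subset is independent. -/
def RdCircuit [DecidableEq V] (d : ℕ) (C : Set (Sym2 V)) : Prop :=
  ¬ RdIndep d C ∧ ∀ C' : Set (Sym2 V), C' ⊂ C → RdIndep d C'

/-- An `ℛ_d`-circuit of the graph `G`. -/
def RdCircuitOf [DecidableEq V] (d : ℕ) (G : SimpleGraph V) (C : Set (Sym2 V)) : Prop :=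
  C ⊆ G.edgeSet ∧ RdCircuit d C

/-- `F` is (the edge set of) an `ℛ_d`-component of `G`: an equivalence class of the
relation "`e = f` or some `ℛ_d`-circuit of `G` contains both `e` and `f`". -/
def IsRdComponent [DecidableEq V] (d : ℕ) (G : SimpleGraph V) (F : Set (Sym2 V)) : Prop :=
  ∃ e ∈ G.edgeSet, F = {f | f ∈ G.edgeSet ∧
    (e = f ∨ ∃ C, RdCircuitOf d G C ∧ e ∈ C ∧ f ∈ C)}

/-- The set of vertices covered by an edge set. -/
def vertexSpan (F : Set (Sym2 V)) : Set V := {v | ∃ e ∈ F, v ∈ e}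

/-- A nonempty edge set is `ℛ_d`-connected if any two of its edges lie on a common
`ℛ_d`-circuit contained in it (or are equal). -/
def RdConnectedSet [DecidableEq V] (d : ℕ) (F : Set (Sym2 V)) : Prop :=
  F.Nonempty ∧ ∀ e ∈ F, ∀ f ∈ F, e = f ∨ ∃ C, C ⊆ F ∧ RdCircuit d C ∧ e ∈ C ∧ f ∈ C

/-- A graph (with at least one edge) is `ℛ_d`-connected. -/
def RdConnected [DecidableEq V] (d : ℕ) (H : SimpleGraph V) : Prop :=
  RdConnectedSet d H.edgeSet

/-- `e` is an `ℛ_d`-bridge of `G`: `r_d(E ∖ {e}) = r_d(E) − 1`. -/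
def IsRdBridge [DecidableEq V] (d : ℕ) (G : SimpleGraph V) (e : Sym2 V) : Prop :=
  e ∈ G.edgeSet ∧ rd d (G.edgeSet \ {e}) + 1 = rd d G.edgeSet

/-- `G + uv`. -/
def addEdge (G : SimpleGraph V) (u v : V) : SimpleGraph V :=
  G ⊔ SimpleGraph.fromEdgeSet {s(u, v)}

/-- `{u,v}` is `d`-linked in `G` if `r_d(G+uv) = r_d(G)`. -/
def IsLinked [DecidableEq V] (d : ℕ) (G : SimpleGraph V) (u v : V) : Prop :=
  rd d (addEdge G u v).edgeSet = rd d G.edgeSet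

/-- There exist `k` pairwise internally vertex-disjoint `u`–`v` paths in `H`
(i.e. `κ_H(u,v) ≥ k`). -/
def InternallyDisjointPaths (H : SimpleGraph V) (u v : V) (k : ℕ) : Prop :=
  ∃ P : Fin k → H.Walk u v, (∀ i, (P i).IsPath) ∧
    ∀ i j, i ≠ j → ∀ w, w ∈ (P i).support → w ∈ (P j).support → w = u ∨ w = v

/-- An unordered pair forming a 2-separator: two distinct vertices whose deletion
disconnects the graph. -/
def TwoSepPair (H : SimpleGraph V) (e : Sym2 V) : Prop :=
  ¬ e.IsDiag ∧ ¬ (H.induce {v | v ∉ e}).Connected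

/-- The augmented graph `Ĥ`: add an edge for every 2-separator. -/
def aug (H : SimpleGraph V) : SimpleGraph V :=
  H ⊔ SimpleGraph.fromEdgeSet {e | TwoSepPair H e}

/-- A subgraph is 3-connected: at least 4 vertices, and deleting fewer than 3
vertices leaves it connected. -/
def IsThreeConnectedSubgraph {G : SimpleGraph V} (J : G.Subgraph) : Prop :=
  4 ≤ J.verts.ncard ∧ ∀ S : Set V, S.ncard < 3 → (J.deleteVerts S).coe.Connected

/-- A 3-block of `H`: a maximal 3-connected subgraph of the augmented graph `Ĥ`. -/
def IsThreeBlock (H : SimpleGraph V) (J : (aug H).Subgraph) : Prop :=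
  IsThreeConnectedSubgraph J ∧
    ∀ J' : (aug H).Subgraph, IsThreeConnectedSubgraph J' → J ≤ J' → J = J'

/-- `h_H(e)`: the number of 3-blocks of `H` containing both vertices of `e`. -/
def numBlocksOn (H : SimpleGraph V) (e : Sym2 V) : ℕ :=
  {J : (aug H).Subgraph | IsThreeBlock H J ∧ ∀ v ∈ e, v ∈ J.verts}.ncard

open Classical in
/-- `k(H) = Σ (h_H(ab) − 1)` over all 2-separators `{a,b}` of `H`. -/
def kGraph [Fintype V] [DecidableEq V] (H : SimpleGraph V) : ℕ :=
  ∑ e : Sym2 V, if TwoSepPair H e then numBlocksOn H e - 1 else 0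

/-- The graph of an `ℛ₂`-component, on its own vertex set. -/
def componentGraph [DecidableEq V] (F : Set (Sym2 V)) :
    SimpleGraph (vertexSpan F) :=
  (SimpleGraph.fromEdgeSet F).induce (vertexSpan F)

/-- `X` is the vertex set of an `ℛ_d`-block of `G`: a 3-block of a non-trivial
`ℛ_d`-component of `G`. -/
def IsRdBlockVerts [DecidableEq V] (d : ℕ) (G : SimpleGraph V) (X : Set V) : Prop :=
  ∃ F : Set (Sym2 V), IsRdComponent d G F ∧ 2 ≤ F.ncard ∧
    ∃ J : (aug (componentGraph F)).Subgraph,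
      IsThreeBlock (componentGraph F) J ∧ X = Subtype.val '' J.verts

/-- The globally linked closure of `G` in `ℝ^d`. -/
def glc (d : ℕ) (G : SimpleGraph V) : SimpleGraph V :=
  G ⊔ SimpleGraph.fromEdgeSet {e | ∃ u v : V, e = s(u, v) ∧ GloballyLinked d G u v}

/-- A globally `d`-linked cluster: the vertex set of a maximal complete subgraph of
`glc_d(G)`. -/
def IsCluster (d : ℕ) (G : SimpleGraph V) (X : Set V) : Prop :=
  (∀ a ∈ X, ∀ b ∈ X, a ≠ b → (glc d G).Adj a b) ∧
    ∀ Y : Set V, X ⊆ Y → (∀ a ∈ Y, ∀ b ∈ Y, a ≠ b → (glc d G).Adj a b) → Y = X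

/-- Equilibrium stress of a framework, encoded as a symmetric function vanishing on
non-edges. -/
def IsEqStress [Fintype V] {d : ℕ} (G : SimpleGraph V) (p : V → Fin d → ℝ)
    (ω : V → V → ℝ) : Prop :=
  (∀ u v, ω u v = ω v u) ∧ (∀ u v, ¬ G.Adj u v → ω u v = 0) ∧
    ∀ u, ∑ v, ω u v • (p u - p v) = 0

/-- `{u,v}` is `d`-stress-linked in `G`. -/
def StressLinked [Fintype V] (d : ℕ) (G : SimpleGraph V) (u v : V) : Prop :=
  ∀ p : V → Fin d → ℝ, Generic p → ∀ q : V → Fin d → ℝ,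
    (∀ ω, IsEqStress G p ω → IsEqStress G q ω) →
    ∀ ω, IsEqStress (addEdge G u v) p ω → IsEqStress (addEdge G u v) q ω

/-- Equivalence of complex frameworks. -/
def CEquivalent {d : ℕ} (G : SimpleGraph V) (p q : V → Fin d → ℂ) : Prop :=
  ∀ u v : V, G.Adj u v →
    ∑ i, (p u i - p v i) ^ 2 = ∑ i, (q u i - q v i) ^ 2

/-- Generic complex placement. -/
def CGeneric {d : ℕ} (p : V → Fin d → ℂ) : Prop :=
  AlgebraicIndependent ℚ (fun vi : V × Fin d => p vi.1 vi.2)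

/-- `{u,v}` is globally linked in `G` in `ℂ^d`. -/
def CGloballyLinked (d : ℕ) (G : SimpleGraph V) (u v : V) : Prop :=
  ∀ p : V → Fin d → ℂ, CGeneric p → ∀ q : V → Fin d → ℂ, CEquivalent G p q →
    ∑ i, (q u i - q v i) ^ 2 = ∑ i, (p u i - p v i) ^ 2

/-- A flexing of the framework `(G,q)`. -/
def IsFlexing {d : ℕ} (G : SimpleGraph V) (q : V → Fin d → ℝ)
    (φ : Set.Icc (0:ℝ) 1 → V → Fin d → ℝ) : Prop :=
  Continuous φ ∧ φ ⟨0, Set.left_mem_Icc.mpr zero_le_one⟩ = q ∧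
    (∀ t, Equivalent G q (φ t)) ∧
    ∀ t : Set.Icc (0:ℝ) 1, 0 < (t : ℝ) → ¬ Congruent q (φ t)

/-- A finite loopless multigraph on vertex type `V` with edge type `E`. -/
structure Multigraph (V : Type*) (E : Type*) where
  ends : E → Sym2 V
  loopless : ∀ e, ¬ (ends e).IsDiag

/-- The data `(B, bar)` exhibits `G` as a body-bar graph induced by `H`. -/
def IsBodyBar {V E W : Type*} (H : Multigraph V E) (G : SimpleGraph W)
    (B : V → Set W) (bar : E → W × W) : Prop :=
  (∀ w : W, ∃! v : V, w ∈ B v) ∧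
  (∀ v : V, (B v).ncard = {e : E | v ∈ H.ends e}.ncard) ∧
  (∀ e : E, ∃ w z : V, H.ends e = s(w, z) ∧ (bar e).1 ∈ B w ∧ (bar e).2 ∈ B z) ∧
  (∀ e : E, (bar e).1 ≠ (bar e).2) ∧
  (∀ e e' : E, e ≠ e' →
    ({(bar e).1, (bar e).2} ∩ {(bar e').1, (bar e').2} : Set W) = ∅) ∧
  (∀ a b : W, G.Adj a b ↔ a ≠ b ∧
    ((∃ v : V, a ∈ B v ∧ b ∈ B v) ∨ ∃ e : E, s(a, b) = s((bar e).1, (bar e).2)))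

/-- `P` is a partition of the set `X`. -/
def IsPartitionOf {V : Type*} (X : Set V) (P : Set (Set V)) : Prop :=
  (∀ p ∈ P, p.Nonempty ∧ p ⊆ X) ∧ ∀ v ∈ X, ∃! p, p ∈ P ∧ v ∈ p

/-- The subgraph `(X,F)` of the multigraph `H` is `k`-tree-connected. -/
def SubTreeConnected {V E : Type*} (k : ℕ) (H : Multigraph V E)
    (X : Set V) (F : Set E) : Prop :=
  X.Nonempty ∧ (∀ e ∈ F, ∀ v ∈ H.ends e, v ∈ X) ∧
    ∀ P : Set (Set V), IsPartitionOf X P →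
      k * (P.ncard - 1) ≤ {e | e ∈ F ∧ ¬ ∃ p ∈ P, ∀ v ∈ H.ends e, v ∈ p}.ncard

/-- `(X,F)` is a `k`-superbrick of `H`: a maximal `k`-tree-connected subgraph. -/
def IsSuperbrick {V E : Type*} (k : ℕ) (H : Multigraph V E)
    (X : Set V) (F : Set E) : Prop :=
  SubTreeConnected k H X F ∧
    ∀ X' F', SubTreeConnected k H X' F' → X ⊆ X' → F ⊆ F' → X = X' ∧ F = F'

section Helpers

set_option linter.unusedSectionVars false

/-- A real function of a placement that is a polynomial with rational coefficients. -/
def RatPoly (f : (V → Fin 2 → ℝ) → ℝ) : Prop :=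
  ∃ P : MvPolynomial (V × Fin 2) ℚ, ∀ p, f p = MvPolynomial.aeval (fun vi => p vi.1 vi.2) P

namespace RatPoly

theorem coord (a : V) (i : Fin 2) : RatPoly (fun p : V → Fin 2 → ℝ => p a i) :=
  ⟨MvPolynomial.X (a, i), fun p => by simp⟩

theorem intCast (n : ℤ) : RatPoly (fun _ : V → Fin 2 → ℝ => (n : ℝ)) :=
  ⟨(n : MvPolynomial (V × Fin 2) ℚ), fun p => by simp⟩

theorem zero : RatPoly (fun _ : V → Fin 2 → ℝ => (0 : ℝ)) := by simpa using intCast (V := V) 0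

theorem one : RatPoly (fun _ : V → Fin 2 → ℝ => (1 : ℝ)) := by simpa using intCast (V := V) 1

theorem mul {f g : (V → Fin 2 → ℝ) → ℝ} (hf : RatPoly f) (hg : RatPoly g) :
    RatPoly (fun p => f p * g p) := by
  obtain ⟨P, hP⟩ := hf
  obtain ⟨Q, hQ⟩ := hg
  exact ⟨P * Q, fun p => by simp only [hP, hQ, map_mul]⟩

theorem sub {f g : (V → Fin 2 → ℝ) → ℝ} (hf : RatPoly f) (hg : RatPoly g) :
    RatPoly (fun p => f p - g p) := by
  obtain ⟨P, hP⟩ := hf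
  obtain ⟨Q, hQ⟩ := hg
  exact ⟨P - Q, fun p => by simp only [hP, hQ, map_sub]⟩

theorem sum {ι : Type*} (s : Finset ι) {f : ι → (V → Fin 2 → ℝ) → ℝ}
    (h : ∀ i, RatPoly (f i)) : RatPoly (fun p => ∑ i ∈ s, f i p) := by
  choose P hP using h
  exact ⟨∑ i ∈ s, P i, fun p => by rw [map_sum]; exact Finset.sum_congr rfl fun i _ => hP i p⟩

theorem prod {ι : Type*} (s : Finset ι) {f : ι → (V → Fin 2 → ℝ) → ℝ}
    (h : ∀ i, RatPoly (f i)) : RatPoly (fun p => ∏ i ∈ s, f i p) := by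
  choose P hP using h
  exact ⟨∏ i ∈ s, P i, fun p => by rw [map_prod]; exact Finset.prod_congr rfl fun i _ => hP i p⟩

theorem ite {c : Prop} [Decidable c] {f g : (V → Fin 2 → ℝ) → ℝ} (hf : RatPoly f)
    (hg : RatPoly g) : RatPoly (fun p => if c then f p else g p) := by
  split_ifs
  · exact hf
  · exact hg

theorem det {ι : Type*} [Fintype ι] [DecidableEq ι] {f : ι → ι → (V → Fin 2 → ℝ) → ℝ}
    (h : ∀ i j, RatPoly (f i j)) :
    RatPoly (fun p => (Matrix.of fun i j => f i j p).det) := by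
  simp only [Matrix.det_apply', Matrix.of_apply]
  exact sum _ fun σ => mul (intCast _) (prod _ fun i => h _ _)

/-- A rational polynomial which is somewhere nonzero is nonzero at generic placements. -/
theorem ne_zero {f : (V → Fin 2 → ℝ) → ℝ} (hf : RatPoly f) {p : V → Fin 2 → ℝ}
    (hp : Generic p) (h : ∃ p₀, f p₀ ≠ 0) : f p ≠ 0 := by
  obtain ⟨P, hP⟩ := hf
  obtain ⟨p₀, h₀⟩ := h
  rw [hP] at h₀ ⊢
  intro h1
  have := (injective_iff_map_eq_zero _).1 hp P h1
  simp [this] at h₀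

end RatPoly

/-- Linear independence of finitely many real vectors, through the Gram determinant. -/
theorem linearIndependent_iff_gram {ι κ : Type*} [Fintype ι] [Fintype κ] [DecidableEq ι]
    (f : ι → κ → ℝ) : LinearIndependent ℝ f ↔
      (Matrix.of fun i j => ∑ k, f i k * f j k).det ≠ 0 := by
  have hA : (Matrix.of fun i j => ∑ k, f i k * f j k) =
      (Matrix.of f) * (Matrix.of f).transpose := by
    ext i j
    simp [Matrix.mul_apply]
  rw [hA, ← isUnit_iff_ne_zero, ← Matrix.isUnit_iff_isUnit_det,
    ← Matrix.linearIndependent_rows_iff_isUnit,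
    linearIndependent_iff_card_eq_finrank_span, linearIndependent_iff_card_eq_finrank_span]
  have h := Matrix.rank_self_mul_transpose (Matrix.of f)
  rw [Matrix.rank_eq_finrank_span_row, Matrix.rank_eq_finrank_span_row] at h
  unfold Set.finrank
  rw [h]
  rfl

/-- Independence of polynomial rows at one placement implies it at generic placements. -/
theorem Generic.linearIndepOn {ι κ : Type*} [Finite ι] [Fintype κ]
    {f : (V → Fin 2 → ℝ) → ι → κ → ℝ} (hf : ∀ i k, RatPoly (fun p => f p i k))
    {p p₀ : V → Fin 2 → ℝ} (hp : Generic p) {s : Set ι} (h : LinearIndepOn ℝ (f p₀) s) :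
    LinearIndepOn ℝ (f p) s := by
  classical
  have := Fintype.ofFinite ι
  unfold LinearIndepOn at h ⊢
  rw [linearIndependent_iff_gram] at h ⊢
  exact RatPoly.ne_zero (f := fun p => (Matrix.of fun i j : s => ∑ k, f p i k * f p j k).det)
    (RatPoly.det fun i j => RatPoly.sum _ fun k => (hf _ _).mul (hf _ _)) hp ⟨p₀, h⟩

theorem exists_rat_affine (x : ℝ) (hx : Transcendental ℚ x) (a b : ℝ) (hab : a < b) :
    ∃ q r : ℚ, r ≠ 0 ∧ a < q + r * x ∧ q + r * x < b := by
  have hx0 : x ≠ 0 := by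
    rintro rfl
    exact hx isAlgebraic_zero
  obtain ⟨r, hr1, hr2⟩ := exists_rat_btwn (show (0:ℝ) < (b - a) / (4 * |x|) by
    apply div_pos (by linarith) (by positivity))
  have hr3 : |(r:ℝ) * x| < (b - a) / 4 := by
    rw [abs_mul, abs_of_pos hr1]
    calc (r:ℝ) * |x| < (b - a) / (4 * |x|) * |x| := by
          apply mul_lt_mul_of_pos_right hr2 (by positivity)
      _ = (b - a) / 4 := by field_simp
  obtain ⟨q, hq1, hq2⟩ := exists_rat_btwn (show (3 * a + b) / 4 < (a + 3 * b) / 4 by linarith)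
  have := abs_lt.1 hr3
  refine ⟨q, r, ?_, by linarith, by linarith⟩
  rintro rfl
  simp at hr1

theorem algebraicIndependent_affine {ι : Type*} {x : ι → ℝ} (hx : AlgebraicIndependent ℚ x)
    (q r : ι → ℚ) (hr : ∀ i, r i ≠ 0) :
    AlgebraicIndependent ℚ (fun i => (q i : ℝ) + r i * x i) := by
  let φ : MvPolynomial ι ℚ →ₐ[ℚ] MvPolynomial ι ℚ :=
    MvPolynomial.aeval fun i => MvPolynomial.C (q i) + MvPolynomial.C (r i) * MvPolynomial.X i
  let ψ : MvPolynomial ι ℚ →ₐ[ℚ] MvPolynomial ι ℚ :=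
    MvPolynomial.aeval fun i => MvPolynomial.C (r i)⁻¹ * (MvPolynomial.X i - MvPolynomial.C (q i))
  have hψφ : ψ.comp φ = AlgHom.id ℚ _ := by
    ext1 i
    have h1 : (MvPolynomial.C (r i) : MvPolynomial ι ℚ) * MvPolynomial.C (r i)⁻¹ = 1 := by
      rw [← map_mul, mul_inv_cancel₀ (hr i), map_one]
    simp only [φ, ψ, AlgHom.comp_apply, MvPolynomial.aeval_X, map_add, map_mul,
      MvPolynomial.algHom_C, MvPolynomial.algebraMap_eq, AlgHom.id_apply]
    rw [← mul_assoc, h1]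
    ring
  have hinj : Function.Injective φ :=
    Function.LeftInverse.injective (g := ψ) fun P => DFunLike.congr_fun hψφ P
  have hcomp : (MvPolynomial.aeval fun i => (q i : ℝ) + r i * x i) =
      (MvPolynomial.aeval (R := ℚ) x).comp φ := by
    ext1 i
    simp [φ]
  unfold AlgebraicIndependent
  rw [hcomp]
  exact Function.Injective.comp (g := MvPolynomial.aeval (R := ℚ) x) hx hinj

theorem exists_algebraicIndependent (ι : Type*) [Finite ι] :
    ∃ x : ι → ℝ, AlgebraicIndependent ℚ x := by
  obtain ⟨s, hs⟩ := exists_isTranscendenceBasis ℚ ℝ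
  have hinf : Infinite s := by
    by_contra hfin
    rw [not_infinite_iff_finite] at hfin
    rcases isEmpty_or_nonempty s with he | he
    · have halg : Algebra.IsAlgebraic ℚ ℝ := hs.isEmpty_iff_isAlgebraic.1 he
      have h1 := Algebra.IsAlgebraic.cardinalMk_le_max ℚ ℝ
      rw [Cardinal.mk_real, Cardinal.mkRat, max_self] at h1
      exact absurd h1 (not_le.2 Cardinal.aleph0_lt_continuum)
    · have h1 := hs.lift_cardinalMk_eq_max_lift
      simp only [Cardinal.lift_id, Cardinal.mk_real, Cardinal.mkRat] at h1
      have h2 : Cardinal.mk s ≤ Cardinal.aleph0 := (Cardinal.lt_aleph0_of_finite s).le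
      rw [max_eq_left h2, max_self] at h1
      exact absurd h1 (ne_of_gt Cardinal.aleph0_lt_continuum)
  obtain ⟨g⟩ : Nonempty (ι ↪ s) := by
    have := Fintype.ofFinite ι
    exact ⟨(Fintype.equivFin ι).toEmbedding.trans
      (Fin.valEmbedding.trans (Infinite.natEmbedding s))⟩
  exact ⟨_, hs.1.comp g g.injective⟩

/-- Generic placements are dense. -/
theorem dense_generic [Finite V] : Dense {p : V → Fin 2 → ℝ | Generic p} := by
  have := Fintype.ofFinite V
  obtain ⟨x, hx⟩ := exists_algebraicIndependent (V × Fin 2)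
  rw [Metric.dense_iff]
  intro p ε hε
  have h (w : V × Fin 2) : ∃ q r : ℚ, r ≠ 0 ∧ p w.1 w.2 - ε < q + r * x w ∧
      q + r * x w < p w.1 w.2 + ε :=
    exists_rat_affine _ (hx.transcendental w) _ _ (by linarith)
  choose q r hr h1 h2 using h
  refine ⟨fun v i => q (v, i) + r (v, i) * x (v, i), ?_, algebraicIndependent_affine hx q r hr⟩
  rw [Metric.mem_ball, dist_pi_lt_iff hε]
  intro v
  rw [dist_pi_lt_iff hε]
  intro i
  rw [Real.dist_eq, abs_lt]
  have := h1 (v, i)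
  have := h2 (v, i)
  constructor <;> dsimp at * <;> linarith

/-- A linear map detecting the independence of `B` and killing `A` gives independence of the
union. -/
theorem linearIndepOn_union_of_map {ι M M' : Type*} [AddCommGroup M] [AddCommGroup M']
    [Module ℝ M] [Module ℝ M'] {f : ι → M} {A B : Set ι} (L : M →ₗ[ℝ] M')
    (hA : LinearIndepOn ℝ f A) (h0 : ∀ a ∈ A, L (f a) = 0) (hB : LinearIndepOn ℝ (L ∘ f) B) :
    LinearIndepOn ℝ f (A ∪ B) := by
  have hB' : LinearIndependent ℝ (L ∘ fun b : B => f b) := hB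
  refine LinearIndepOn.union hA (LinearIndependent.of_comp L hB') ?_
  have h1 := Submodule.range_ker_disjoint hB'
  have h2 : Submodule.span ℝ (f '' A) ≤ LinearMap.ker L := by
    rw [Submodule.span_le]
    rintro _ ⟨a, ha, rfl⟩
    exact h0 a ha
  have h3 : Set.range (fun b : B => f b) = f '' B := by
    ext x
    simp
  rw [h3] at h1
  exact (h1.mono_right h2).symm

/-- Exchange of one element in an independent family. -/
theorem linearIndepOn_exchange {ι M : Type*} [AddCommGroup M] [Module ℝ M] {f : ι → M}
    {A : Set ι} {e e' : ι} (heA : e ∉ A) (h : LinearIndepOn ℝ f (insert e A)) {c : ℝ} (hc : c ≠ 0)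
    {x : M} (hx : x ∈ Submodule.span ℝ (f '' A)) (hee : f e' = c • f e + x) :
    LinearIndepOn ℝ f (insert e' A) := by
  rw [linearIndepOn_insert heA] at h
  refine LinearIndepOn.insert h.1 fun h' => h.2 ?_
  have : f e = c⁻¹ • (f e' - x) := by
    rw [hee, add_sub_cancel_right, smul_smul, inv_mul_cancel₀ hc, one_smul]
  rw [this]
  exact Submodule.smul_mem _ _ (Submodule.sub_mem _ h' hx)

section Rows

variable [DecidableEq V]

theorem edgeVec_eq (p : V → Fin 2 → ℝ) (a b : V) (w : V × Fin 2) :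
    edgeVec p a b w = (p a w.2 - p b w.2) *
      ((if w.1 = a then 1 else 0) - (if w.1 = b then 1 else 0)) := by
  unfold edgeVec
  by_cases h1 : w.1 = a <;> by_cases h2 : w.1 = b
  · have : a = b := h1.symm.trans h2
    subst this
    simp
  · have : a ≠ b := fun h => h2 (h1.trans h)
    simp [h1, this]
  · have : b ≠ a := fun h => h1 (h2.trans h)
    simp [h2, this]
  · simp [h1, h2]

/-- The rigidity matrix row of an unordered pair. -/
def row (p : V → Fin 2 → ℝ) : Sym2 V → (V × Fin 2 → ℝ) :=
  Sym2.lift ⟨fun a b => edgeVec p a b, fun a b => by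
    ext w
    simp only [edgeVec_eq]
    ring⟩

theorem row_apply (p : V → Fin 2 → ℝ) (a b : V) (w : V × Fin 2) :
    row p s(a, b) w = (p a w.2 - p b w.2) *
      ((if w.1 = a then 1 else 0) - (if w.1 = b then 1 else 0)) :=
  edgeVec_eq p a b w

theorem row_apply_of_notMem (p : V → Fin 2 → ℝ) {e : Sym2 V} {z : V} (hz : z ∉ e) (i : Fin 2) :
    row p e (z, i) = 0 := by
  induction e with
  | _ a b =>
    rw [Sym2.mem_iff, not_or] at hz
    simp [row_apply, hz.1, hz.2]

theorem row_diag (p : V → Fin 2 → ℝ) (a : V) : row p s(a, a) = 0 := by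
  ext w
  simp [row_apply]

/-- Twice the signed area of a triangle. -/
def area (q : V → Fin 2 → ℝ) (a b c : V) : ℝ :=
  (q a 0 - q c 0) * (q b 1 - q c 1) - (q a 1 - q c 1) * (q b 0 - q c 0)

/-- The placement with the points of `S` projected to the first axis. -/
def flat (S : Set V) (p : V → Fin 2 → ℝ) : V → Fin 2 → ℝ :=
  open Classical in fun v i => if v ∈ S ∧ i = 1 then 0 else p v i

theorem flat_zero (S : Set V) (p : V → Fin 2 → ℝ) (v : V) : flat S p v 0 = p v 0 := by
  simp [flat]

theorem flat_of_mem {S : Set V} (p : V → Fin 2 → ℝ) {v : V} (hv : v ∈ S) : flat S p v 1 = 0 := by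
  simp [flat, hv]

theorem flat_of_notMem {S : Set V} (p : V → Fin 2 → ℝ) {v : V} (hv : v ∉ S) :
    flat S p v = p v := by
  ext i
  simp [flat, hv]

theorem flat_empty (p : V → Fin 2 → ℝ) : flat ∅ p = p := by
  ext v i
  simp [flat]

theorem ratPoly_flat (S : Set V) (v : V) (i : Fin 2) : RatPoly (fun p => flat S p v i) := by
  classical
  simp only [flat]
  exact RatPoly.ite RatPoly.zero (RatPoly.coord v i)

theorem Generic.flat_x_ne {p : V → Fin 2 → ℝ} (hp : Generic p) (S : Set V) {a b : V}
    (hab : a ≠ b) : flat S p a 0 - flat S p b 0 ≠ 0 := by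
  refine RatPoly.ne_zero (f := fun p => flat S p a 0 - flat S p b 0)
    ((ratPoly_flat S a 0).sub (ratPoly_flat S b 0)) hp ⟨fun v _ => if v = a then 1 else 0, ?_⟩
  simp [flat_zero, hab.symm]

theorem Generic.y_ne {p : V → Fin 2 → ℝ} (hp : Generic p) (a : V) : p a 1 ≠ 0 :=
  RatPoly.ne_zero (f := fun p => p a 1) (RatPoly.coord a 1) hp ⟨fun _ _ => 1, one_ne_zero⟩

theorem Generic.flat_area_ne {p : V → Fin 2 → ℝ} (hp : Generic p) {S : Set V} {a b c : V}
    (hab : a ≠ b) (hac : a ≠ c) (hbc : b ≠ c) (hS : ¬ (a ∈ S ∧ b ∈ S ∧ c ∈ S)) :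
    area (flat S p) a b c ≠ 0 := by
  refine RatPoly.ne_zero (f := fun p => area (flat S p) a b c)
    (((ratPoly_flat S _ _).sub (ratPoly_flat S _ _)).mul
      ((ratPoly_flat S _ _).sub (ratPoly_flat S _ _)) |>.sub
    (((ratPoly_flat S _ _).sub (ratPoly_flat S _ _)).mul
      ((ratPoly_flat S _ _).sub (ratPoly_flat S _ _)))) hp ?_
  by_cases ha : a ∈ S
  · by_cases hb : b ∈ S
    · have hc : c ∉ S := fun hc => hS ⟨ha, hb, hc⟩
      refine ⟨fun v i => if i = 0 then (if v = b then 1 else 0) else if v = c then 1 else 0, ?_⟩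
      simp [area, flat, hab, hac, hbc, hc, hbc.symm]
    · refine ⟨fun v i => if i = 0 then (if v = a then 1 else 0) else if v = b then 1 else 0, ?_⟩
      simp [area, flat, hab, hb, hab.symm, hac.symm, hbc.symm]
  · refine ⟨fun v i => if i = 0 then (if v = b then 1 else 0) else if v = a then 1 else 0, ?_⟩
    simp [area, flat, hab, ha, hab.symm, hac.symm, hbc.symm]

theorem Generic.area_ne {p : V → Fin 2 → ℝ} (hp : Generic p) {a b c : V}
    (hab : a ≠ b) (hac : a ≠ c) (hbc : b ≠ c) : area p a b c ≠ 0 := by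
  have := hp.flat_area_ne (S := ∅) hab hac hbc (by simp)
  rwa [flat_empty] at this

/-- `g` groups the vertices of `S`, choosing a representative in each group. -/
structure Grouping (S : Set V) (g : V → V) : Prop where
  idem : ∀ a, g (g a) = g a
  off : ∀ a, a ∉ S → g a = a
  maps : ∀ a, a ∈ S → g a ∈ S

theorem Grouping.eq_iff {S : Set V} {g : V → V} (hg : Grouping S g) {z : V} (hz : z ∉ S) (a : V) :
    g a = z ↔ a = z := by
  constructor
  · intro h
    by_cases ha : a ∈ S
    · exact absurd (h ▸ hg.maps a ha) hz
    · rw [← h, hg.off a ha]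
  · rintro rfl
    exact hg.off _ hz

theorem Grouping.empty : Grouping (∅ : Set V) id :=
  ⟨fun _ => rfl, fun _ _ => rfl, fun _ h => h⟩

variable [Fintype V]

/-- Restriction of rows to the velocities which, on `S`, are horizontal and constant on the
groups of `g`. -/
def contr (S : Set V) (g : V → V) : (V × Fin 2 → ℝ) →ₗ[ℝ] (V × Fin 2 → ℝ) :=
  open Classical in
  { toFun := fun r w => if w.2 = 0 then ∑ a, (if g a = w.1 then 1 else 0) * r (a, 0)
      else if w.1 ∈ S then 0 else r (w.1, 1)
    map_add' := fun r r' => by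
      ext w
      simp only [Pi.add_apply, mul_add, Finset.sum_add_distrib]
      split_ifs <;> simp
    map_smul' := fun c r => by
      ext w
      simp only [Pi.smul_apply, smul_eq_mul, RingHom.id_apply, mul_ite, Finset.mul_sum, mul_zero]
      split_ifs
      · exact Finset.sum_congr rfl fun _ _ => by ring
      · rfl
      · rfl }

theorem contr_zero (S : Set V) (g : V → V) (r : V × Fin 2 → ℝ) (w : V) :
    contr S g r (w, 0) = ∑ a, (if g a = w then 1 else 0) * r (a, 0) := by
  classical
  simp only [contr, LinearMap.coe_mk, AddHom.coe_mk, if_true]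

theorem contr_one_of_mem {S : Set V} (g : V → V) (r : V × Fin 2 → ℝ) {w : V} (hw : w ∈ S) :
    contr S g r (w, 1) = 0 := by
  simp [contr, hw]

theorem contr_one_of_notMem {S : Set V} (g : V → V) (r : V × Fin 2 → ℝ) {w : V} (hw : w ∉ S) :
    contr S g r (w, 1) = r (w, 1) := by
  simp [contr, hw]

theorem contr_of_notMem {S : Set V} {g : V → V} (hg : Grouping S g) (r : V × Fin 2 → ℝ) {w : V}
    (hw : w ∉ S) (i : Fin 2) : contr S g r (w, i) = r (w, i) := by
  fin_cases i
  · simp [contr_zero, hg.eq_iff hw]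
  · exact contr_one_of_notMem g r hw

theorem contr_row_zero (S : Set V) (g : V → V) (p : V → Fin 2 → ℝ) (a b w : V) :
    contr S g (row p s(a, b)) (w, 0) = (p a 0 - p b 0) *
      ((if w = g a then 1 else 0) - (if w = g b then 1 else 0)) := by
  rw [contr_zero]
  have h (x : V) : (if g x = w then (1:ℝ) else 0) * row p s(a, b) (x, 0) =
      (if x = a then (p a 0 - p b 0) * (if w = g x then 1 else 0) else 0) -
      (if x = b then (p a 0 - p b 0) * (if w = g x then 1 else 0) else 0) := by
    simp only [row_apply, eq_comm (a := g x)]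
    split_ifs <;> ring
  rw [Finset.sum_congr rfl fun x _ => h x, Finset.sum_sub_distrib]
  simp [mul_sub]

theorem contr_empty : contr (∅ : Set V) id = LinearMap.id := by
  ext1
  ext1
  ext w
  obtain ⟨w, i⟩ := w
  exact contr_of_notMem Grouping.empty _ (Set.notMem_empty w) i

/-- The contracted rows at a flattened placement. -/
def crow (S : Set V) (g : V → V) (q : V → Fin 2 → ℝ) : Sym2 V → (V × Fin 2 → ℝ) :=
  fun e => contr S g (row q e)

theorem crow_empty (q : V → Fin 2 → ℝ) : crow ∅ id q = row q := by
  ext1 e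
  simp [crow, contr_empty]

theorem ratPoly_row (S : Set V) (e : Sym2 V) (w : V × Fin 2) :
    RatPoly (fun p => row (flat S p) e w) := by
  induction e with
  | _ a b =>
    simp only [row_apply]
    exact ((ratPoly_flat _ _ _).sub (ratPoly_flat _ _ _)).mul
      ((RatPoly.one.ite RatPoly.zero).sub (RatPoly.one.ite RatPoly.zero))

theorem ratPoly_crow (S : Set V) (g : V → V) (e : Sym2 V) (w : V × Fin 2) :
    RatPoly (fun p => crow S g (flat S p) e w) := by
  classical
  obtain ⟨w, i⟩ := w
  fin_cases i
  · simp only [crow, Fin.zero_eta, contr_zero]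
    exact RatPoly.sum _ fun a => (RatPoly.one.ite RatPoly.zero).mul (ratPoly_row _ _ _)
  · by_cases hw : w ∈ S
    · simp only [crow, Fin.mk_one, contr_one_of_mem g _ hw]
      exact RatPoly.zero
    · simp only [crow, Fin.mk_one, contr_one_of_notMem g _ hw]
      exact ratPoly_row _ _ _

/-- Specialization for contracted rows. -/
theorem Generic.crow_indep {p : V → Fin 2 → ℝ} (hp : Generic p) {S : Set V} {g : V → V}
    {p₀ : V → Fin 2 → ℝ} {N : Set (Sym2 V)} (h : LinearIndepOn ℝ (crow S g (flat S p₀)) N) :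
    LinearIndepOn ℝ (crow S g (flat S p)) N :=
  hp.linearIndepOn (f := fun p => crow S g (flat S p)) (ratPoly_crow S g) h

/-- Specialization for rigidity rows. -/
theorem Generic.row_indep {p : V → Fin 2 → ℝ} (hp : Generic p) {p₀ : V → Fin 2 → ℝ}
    {N : Set (Sym2 V)} (h : LinearIndepOn ℝ (row p₀) N) : LinearIndepOn ℝ (row p) N := by
  have := hp.crow_indep (S := ∅) (g := id) (p₀ := p₀) (N := N)
  simp only [flat_empty, crow_empty] at this
  exact this h

/-- If `B` has full rank in `E` generically and is independent at `q`, then it spans `E`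
at `q`. -/
theorem Generic.row_mem_span {p : V → Fin 2 → ℝ} (hp : Generic p) {q : V → Fin 2 → ℝ}
    {B : Set (Sym2 V)} (hB : LinearIndepOn ℝ (row q) B) {e : Sym2 V}
    (he : row p e ∈ Submodule.span ℝ (row p '' B)) :
    row q e ∈ Submodule.span ℝ (row q '' B) := by
  by_contra h
  have heB : e ∉ B := fun h' => h (Submodule.subset_span ⟨e, h', rfl⟩)
  have h1 := hp.row_indep (hB.insert h)
  rw [linearIndepOn_insert heB] at h1
  exact h1.2 he

end Rows

section Extension

variable [DecidableEq V]

theorem row_congr {q q' : V → Fin 2 → ℝ} {e : Sym2 V} (h : ∀ v ∈ e, q v = q' v) :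
    row q e = row q' e := by
  induction e with
  | _ a b =>
    ext w
    rw [row_apply, row_apply, h a (by simp), h b (by simp)]

/-- The equilibrium relation of `K₄`. -/
theorem row_affine_identity {q : V → Fin 2 → ℝ} {z a b c : V} {α β γ : ℝ} (hs : α + β + γ = 1)
    (hz : ∀ i, q z i = α * q a i + β * q b i + γ * q c i) :
    α • row q s(z, a) + β • row q s(z, b) + γ • row q s(z, c) =
      (α * β) • row q s(a, b) + (α * γ) • row q s(a, c) + (β * γ) • row q s(b, c) := by
  ext w
  simp only [Pi.add_apply, Pi.smul_apply, smul_eq_mul, row_apply, hz]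
  obtain rfl : γ = 1 - α - β := by linarith
  ring

theorem exists_affine {q : V → Fin 2 → ℝ} {a b c : V} (h : area q a b c ≠ 0) (z : V) :
    ∃ α β γ : ℝ, α * area q a b c = area q z b c ∧ α + β + γ = 1 ∧
      ∀ i, q z i = α * q a i + β * q b i + γ * q c i := by
  refine ⟨area q z b c / area q a b c, area q a z c / area q a b c,
    area q a b z / area q a b c, ?_, ?_, ?_⟩
  · field_simp
  · field_simp
    unfold area
    ring
  · intro i
    field_simp
    unfold area
    fin_cases i <;> dsimp <;> ring

/-- Generically, in a `K₄` every edge is spanned by the five others. -/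
theorem Generic.row_mem {p : V → Fin 2 → ℝ} (hp : Generic p) (W : Submodule ℝ (V × Fin 2 → ℝ))
    {a b : V} (hab : a ≠ b) (h : row p s(a, b) ∈ W) (x y : V) (hxa : row p s(x, a) ∈ W)
    (hxb : row p s(x, b) ∈ W) (hya : row p s(y, a) ∈ W) (hyb : row p s(y, b) ∈ W) :
    row p s(x, y) ∈ W := by
  by_cases h1 : x = a
  · subst h1; rwa [Sym2.eq_swap]
  by_cases h2 : x = b
  · subst h2; rwa [Sym2.eq_swap]
  by_cases h3 : y = a
  · subst h3; exact hxa
  by_cases h4 : y = b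
  · subst h4; exact hxb
  obtain ⟨α, β, γ, h5, h6, h7⟩ := exists_affine (hp.area_ne h3 h4 hab) x
  have hα : α ≠ 0 := by
    rintro rfl
    rw [zero_mul] at h5
    exact hp.area_ne h1 h2 hab h5.symm
  have h8 := row_affine_identity h6 h7
  have h9 : row p s(x, y) = α⁻¹ • ((α * β) • row p s(y, a) + (α * γ) • row p s(y, b) +
      (β * γ) • row p s(a, b) - β • row p s(x, a) - γ • row p s(x, b)) := by
    rw [← h8]
    rw [show α • row p s(x, y) + β • row p s(x, a) + γ • row p s(x, b) - β • row p s(x, a) -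
      γ • row p s(x, b) = α • row p s(x, y) by abel, smul_smul, inv_mul_cancel₀ hα, one_smul]
  rw [h9]
  exact W.smul_mem _ (W.sub_mem (W.sub_mem (W.add_mem (W.add_mem (W.smul_mem _ hya)
    (W.smul_mem _ hyb)) (W.smul_mem _ h)) (W.smul_mem _ hxa)) (W.smul_mem _ hxb))

theorem Generic.row_ne_zero {p : V → Fin 2 → ℝ} (hp : Generic p) {a b : V} (hab : a ≠ b) :
    row p s(a, b) ≠ 0 := by
  intro h
  have h1 := congrFun h (a, 0)
  have h2 := hp.flat_x_ne ∅ hab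
  rw [flat_empty] at h2
  simp only [row_apply, Pi.zero_apply, if_true, if_neg hab, sub_zero, mul_one] at h1
  exact h2 h1

/-- If a vertex of degree three is independent over `N` modulo `D`, then some pair of its
neighbours can be added to `N`. -/
theorem exists_pair_notMem_span {p : V → Fin 2 → ℝ} (D : Submodule ℝ (V × Fin 2 → ℝ))
    {N : Set (Sym2 V)} {z a b c : V} (hab : a ≠ b) (hac : a ≠ c) (hbc : b ≠ c)
    (harea : area p a b c ≠ 0)
    (h : LinearIndepOn ℝ (D.mkQ ∘ row p) (N ∪ {s(z, a), s(z, b), s(z, c)}))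
    (ha : s(z, a) ∉ N) (hb : s(z, b) ∉ N) (hc : s(z, c) ∉ N) :
    D.mkQ (row p s(a, b)) ∉ Submodule.span ℝ (D.mkQ ∘ row p '' N) ∨
    D.mkQ (row p s(a, c)) ∉ Submodule.span ℝ (D.mkQ ∘ row p '' N) ∨
    D.mkQ (row p s(b, c)) ∉ Submodule.span ℝ (D.mkQ ∘ row p '' N) := by
  by_contra! hcon
  obtain ⟨h1, h2, h3⟩ := hcon
  obtain ⟨α, β, γ, -, hs, hz⟩ := exists_affine harea z
  have hid := congrArg D.mkQ (row_affine_identity hs hz)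
  simp only [map_add, map_smul] at hid
  set f := D.mkQ ∘ row p with hf
  have hfe (e) : D.mkQ (row p e) = f e := rfl
  simp only [hfe] at hid h1 h2 h3
  have hdisj : Disjoint N {s(z, a), s(z, b), s(z, c)} := by
    rw [Set.disjoint_right]
    rintro e (rfl | rfl | rfl) <;> assumption
  rw [linearIndepOn_union_iff hdisj] at h
  obtain ⟨-, hB, hd⟩ := h
  have hmem1 : α • f s(z, a) + β • f s(z, b) + γ • f s(z, c) ∈ Submodule.span ℝ (f '' N) := by
    rw [hid]
    exact Submodule.add_mem _ (Submodule.add_mem _ (Submodule.smul_mem _ _ h1)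
      (Submodule.smul_mem _ _ h2)) (Submodule.smul_mem _ _ h3)
  have hmem2 : α • f s(z, a) + β • f s(z, b) + γ • f s(z, c) ∈
      Submodule.span ℝ (f '' {s(z, a), s(z, b), s(z, c)}) := by
    refine Submodule.add_mem _ (Submodule.add_mem _ ?_ ?_) ?_ <;>
    · apply Submodule.smul_mem
      apply Submodule.subset_span
      exact ⟨_, by simp, rfl⟩
  have h0 := Submodule.disjoint_def.1 hd _ hmem1 hmem2
  have hne1 : s(z, a) ≠ s(z, b) := mt Sym2.congr_right.1 hab
  have hne2 : s(z, a) ≠ s(z, c) := mt Sym2.congr_right.1 hac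
  have hne3 : s(z, b) ≠ s(z, c) := mt Sym2.congr_right.1 hbc
  have hB' : LinearIndepOn ℝ f ((({s(z, a), s(z, b), s(z, c)} : Finset (Sym2 V))) : Set (Sym2 V)) :=
    by simpa using hB
  rw [linearIndepOn_finset_iff] at hB'
  have h4 := hB' (fun e => if e = s(z, a) then α else if e = s(z, b) then β else γ) (by
    rw [Finset.sum_insert (by simp [hne1, hne2]),
      Finset.sum_insert (by simp [hne3]),
      Finset.sum_singleton, if_pos rfl, if_neg hne1.symm, if_pos rfl, if_neg hne2.symm,
      if_neg hne3.symm, ← add_assoc]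
    exact h0)
  have h5 := h4 s(z, a) (by simp)
  have h6 := h4 s(z, b) (by simp)
  have h7 := h4 s(z, c) (by simp)
  rw [if_pos rfl] at h5
  rw [if_neg hne1.symm, if_pos rfl] at h6
  rw [if_neg hne2.symm, if_neg hne3.symm] at h7
  rw [h5, h6, h7] at hs
  norm_num at hs

variable [Fintype V] {S : Set V} {g : V → V}

theorem crow_apply_of_notMem (hg : Grouping S g) (q : V → Fin 2 → ℝ) {z : V} (hz : z ∉ S)
    (e : Sym2 V) (i : Fin 2) : crow S g q e (z, i) = row q e (z, i) :=
  contr_of_notMem hg _ hz i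

/-- Adding a vertex of degree two. -/
theorem crow_indep_union_pair (hg : Grouping S g) {q : V → Fin 2 → ℝ} {z a b : V} (hz : z ∉ S)
    {N : Set (Sym2 V)} (hN : ∀ e ∈ N, z ∉ e) (hza : z ≠ a) (hzb : z ≠ b)
    (harea : area q z a b ≠ 0) (h : LinearIndepOn ℝ (crow S g q) N) :
    LinearIndepOn ℝ (crow S g q) (N ∪ {s(z, a), s(z, b)}) := by
  refine linearIndepOn_union_of_map (LinearMap.funLeft ℝ ℝ fun i : Fin 2 => (z, i)) h ?_ ?_
  · intro e he
    ext i
    rw [LinearMap.funLeft_apply, crow_apply_of_notMem hg q hz, row_apply_of_notMem q (hN e he)]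
    rfl
  · have hab : a ≠ b := by
      rintro rfl
      apply harea
      unfold area
      ring
    rw [LinearIndepOn.pair_iff _ (mt Sym2.congr_right.1 hab)]
    intro c d hcd
    have h0 := congrFun hcd 0
    have h1 := congrFun hcd 1
    simp only [Function.comp, Pi.add_apply, Pi.smul_apply, LinearMap.funLeft_apply, smul_eq_mul,
      crow_apply_of_notMem hg q hz, row_apply, if_true, if_neg hza, if_neg hzb, sub_zero, mul_one,
      Pi.zero_apply] at h0 h1
    have hA : area q z a b = (q z 1 - q b 1) * (q z 0 - q a 0) -
        (q z 0 - q b 0) * (q z 1 - q a 1) := by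
      unfold area
      ring
    rw [hA] at harea
    constructor
    · exact (mul_eq_zero.1 (show c * ((q z 1 - q b 1) * (q z 0 - q a 0) -
        (q z 0 - q b 0) * (q z 1 - q a 1)) = 0 by
          linear_combination (q z 1 - q b 1) * h0 - (q z 0 - q b 0) * h1)).resolve_right harea
    · exact (mul_eq_zero.1 (show d * ((q z 1 - q b 1) * (q z 0 - q a 0) -
        (q z 0 - q b 0) * (q z 1 - q a 1)) = 0 by
          linear_combination (q z 0 - q a 0) * h1 - (q z 1 - q a 1) * h0)).resolve_right harea

/-- Adding a vertex of degree one. -/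
theorem crow_indep_insert (hg : Grouping S g) {q : V → Fin 2 → ℝ} {z a : V} (hz : z ∉ S)
    {N : Set (Sym2 V)} (hN : ∀ e ∈ N, z ∉ e) (hza : q z ≠ q a)
    (h : LinearIndepOn ℝ (crow S g q) N) :
    LinearIndepOn ℝ (crow S g q) (insert s(z, a) N) := by
  rw [← Set.union_singleton]
  refine linearIndepOn_union_of_map (LinearMap.funLeft ℝ ℝ fun i : Fin 2 => (z, i)) h ?_ ?_
  · intro e he
    ext i
    rw [LinearMap.funLeft_apply, crow_apply_of_notMem hg q hz, row_apply_of_notMem q (hN e he)]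
    rfl
  · rw [linearIndepOn_singleton_iff]
    intro h0
    apply hza
    ext i
    have h1 := congrFun h0 i
    have h2 : z ≠ a := fun h => hza (h ▸ rfl)
    simp only [Function.comp, LinearMap.funLeft_apply, crow_apply_of_notMem hg q hz, row_apply,
      if_true, if_neg h2, sub_zero, mul_one, Pi.zero_apply] at h1
    linarith

/-- Adding a group of degree one. -/
theorem crow_indep_leaf {q : V → Fin 2 → ℝ} {t a : V}
    {N : Set (Sym2 V)} (hN : ∀ e ∈ N, ∀ v ∈ e, g v ≠ g t) (hta : q t 0 - q a 0 ≠ 0)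
    (hgta : g a ≠ g t) (h : LinearIndepOn ℝ (crow S g q) N) :
    LinearIndepOn ℝ (crow S g q) (insert s(t, a) N) := by
  rw [← Set.union_singleton]
  refine linearIndepOn_union_of_map (LinearMap.proj (g t, (0 : Fin 2))) h ?_ ?_
  · intro e he
    have h1 := hN e he
    induction e with
    | _ x y =>
      simp only [Sym2.mem_iff, forall_eq_or_imp, forall_eq] at h1
      simp [crow, contr_row_zero, h1.1.symm, h1.2.symm]
  · rw [linearIndepOn_singleton_iff]
    simp only [Function.comp, LinearMap.proj_apply, crow, contr_row_zero, if_true,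
      if_neg hgta.symm, sub_zero, mul_one]
    exact hta

/-- Adding a vertex of degree three in place of an edge between two of its neighbours. -/
theorem Generic.crow_indep_union_triple {p : V → Fin 2 → ℝ} (hp : Generic p) (hg : Grouping S g)
    {z a b c : V} (hz : z ∉ S) {N : Set (Sym2 V)} (hN : ∀ e ∈ N, z ∉ e) (hza : z ≠ a) (hzb : z ≠ b)
    (hzc : z ≠ c) (hab : a ≠ b) (hac : a ≠ c) (hbc : b ≠ c) (habN : s(a, b) ∉ N)
    (h : LinearIndepOn ℝ (crow S g (flat S p)) (insert s(a, b) N)) :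
    LinearIndepOn ℝ (crow S g (flat S p)) (N ∪ {s(z, a), s(z, b), s(z, c)}) := by
  have hzab : z ∉ s(a, b) := by simp [hza, hzb]
  have hflat (y : Fin 2 → ℝ) :
      flat S (Function.update p z y) = Function.update (flat S p) z y := by
    ext v i
    by_cases hv : v = z
    · subst hv
      rw [flat_of_notMem _ hz]
      simp
    · simp [flat, hv]
  have key (y : Fin 2 → ℝ) (hA : area (Function.update (flat S p) z y) z a c ≠ 0) (k : ℝ)
      (hk : k ≠ 0) (m n : ℝ)
      (hzb : crow S g (Function.update (flat S p) z y) s(z, b) =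
        k • crow S g (Function.update (flat S p) z y) s(a, b) +
        (m • crow S g (Function.update (flat S p) z y) s(z, a) +
          n • crow S g (Function.update (flat S p) z y) s(z, c))) :
      LinearIndepOn ℝ (crow S g (flat S p)) (N ∪ {s(z, a), s(z, b), s(z, c)}) := by
    apply hp.crow_indep (p₀ := Function.update p z y)
    rw [hflat]
    have h1 : LinearIndepOn ℝ (crow S g (Function.update (flat S p) z y)) (insert s(a, b) N) := by
      refine (linearIndepOn_congr fun e he => ?_).1 h
      unfold crow
      rw [row_congr]
      intro v hv
      rw [Function.update_of_ne]
      rintro rfl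
      rcases he with rfl | he
      · exact hzab hv
      · exact hN e he hv
    have h2 := crow_indep_union_pair hg hz (N := insert s(a, b) N)
      (by rintro e (rfl | he); exacts [hzab, hN e he]) hza hzc hA h1
    rw [Set.insert_union] at h2
    have h3 := linearIndepOn_exchange (e' := s(z, b)) (by
      rintro (h | h | h)
      · exact habN h
      · exact hzab (h ▸ by simp)
      · rw [Set.mem_singleton_iff] at h
        exact hzab (h ▸ by simp)) h2 hk (Submodule.add_mem _
          (Submodule.smul_mem _ m (Submodule.subset_span ⟨s(z, a), by simp, rfl⟩))
          (Submodule.smul_mem _ n (Submodule.subset_span ⟨s(z, c), by simp, rfl⟩))) hzb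
    refine h3.mono ?_
    rintro e (he | rfl | rfl | rfl) <;> simp [*]
  by_cases hS : a ∈ S ∧ b ∈ S ∧ c ∈ S
  · obtain ⟨ha, hb, hc⟩ := hS
    have hAB := hp.flat_x_ne S hab
    have hAC := hp.flat_x_ne S hac.symm
    have hCB := hp.flat_x_ne S hbc.symm
    have ha1 := flat_of_mem p ha
    have hb1 := flat_of_mem p hb
    have hc1 := flat_of_mem p hc
    generalize hq : flat S p = q at *
    refine key ![q c 0, 1] ?_ ((q c 0 - q b 0) / (q a 0 - q b 0)) (div_ne_zero hCB hAB)
      ((q c 0 - q b 0) / (q c 0 - q a 0)) (1 - (q c 0 - q b 0) / (q c 0 - q a 0)) ?_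
    · simp only [area, Function.update_self, Function.update_of_ne hza.symm,
        Function.update_of_ne hzc.symm, ha1, hc1]
      simpa using fun h => hAC (by linarith)
    · ext ⟨w, i⟩
      fin_cases i
      · simp only [Fin.zero_eta, crow, contr_row_zero, Pi.add_apply, Pi.smul_apply, smul_eq_mul,
          Function.update_self, Function.update_of_ne hza.symm, Function.update_of_ne hzb.symm,
          Function.update_of_ne hzc.symm, Matrix.cons_val_zero]
        field_simp
        ring
      · by_cases hw : w ∈ S
        · simp [crow, contr_one_of_mem g _ hw]
        · have hwa : w ≠ a := fun h => hw (h ▸ ha)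
          have hwb : w ≠ b := fun h => hw (h ▸ hb)
          have hwc : w ≠ c := fun h => hw (h ▸ hc)
          simp only [Fin.mk_one, crow, contr_one_of_notMem g _ hw, row_apply, Pi.add_apply,
            Pi.smul_apply, smul_eq_mul, Function.update_self, Function.update_of_ne hza.symm,
            Function.update_of_ne hzb.symm, Function.update_of_ne hzc.symm, ha1, hb1, hc1,
            if_neg hwa, if_neg hwb, if_neg hwc]
          split_ifs <;> simp
  · have hA := hp.flat_area_ne hab hac hbc hS
    generalize flat S p = q at *
    refine key (fun i => (q a i + q b i) / 2) ?_ (1 / 2) (by norm_num) (-1) 0 ?_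
    · intro h0
      apply hA
      simp only [area, Function.update_self, Function.update_of_ne hza.symm,
        Function.update_of_ne hzc.symm] at h0 ⊢
      linarith
    · have hid := row_affine_identity (q := Function.update q z fun i => (q a i + q b i) / 2)
        (z := z) (a := a) (b := b) (c := c) (α := 1 / 2) (β := 1 / 2) (γ := 0) (by norm_num) (by
          intro i
          simp only [Function.update_self, Function.update_of_ne hza.symm,
            Function.update_of_ne hzb.symm]
          ring)
      have h2 : row (Function.update q z fun i => (q a i + q b i) / 2) s(z, b) =
          (1 / 2 : ℝ) • row (Function.update q z fun i => (q a i + q b i) / 2) s(a, b) +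
          (-1 : ℝ) • row (Function.update q z fun i => (q a i + q b i) / 2) s(z, a) := by
        ext w
        have := congrFun hid w
        simp only [Pi.add_apply, Pi.smul_apply, smul_eq_mul] at this ⊢
        linarith
      unfold crow
      rw [h2]
      simp

end Extension

theorem card_le_card_of_mem_span {ι M : Type*} [AddCommGroup M] [Module ℝ M] [DecidableEq ι]
    {f : ι → M} {A B : Finset ι} (hA : LinearIndepOn ℝ f (A : Set ι))
    (h : ∀ a ∈ A, f a ∈ Submodule.span ℝ (f '' B)) : A.card ≤ B.card := by
  classical
  have h1 := finrank_span_eq_card (R := ℝ) (b := fun a : (A : Set ι) => f a) hA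
  have : Set.range (fun a : (A : Set ι) => f a) = f '' A := by
    ext
    simp
  rw [this] at h1
  have h2 : Submodule.span ℝ (f '' A) ≤ Submodule.span ℝ ((B.image f : Finset M) : Set M) := by
    rw [Submodule.span_le, Finset.coe_image]
    rintro _ ⟨a, ha, rfl⟩
    exact h a ha
  have h3 := Submodule.finrank_mono h2
  have h4 := finrank_span_finset_le_card (R := ℝ) (B.image f)
  unfold Set.finrank at h4
  have h5 := Finset.card_image_le (s := B) (f := f)
  simp at h1
  omega

/-- The handshake lemma for a set of pairs. -/
theorem sum_degree [DecidableEq V] [Fintype V] {N : Finset (Sym2 V)} (hN : ∀ e ∈ N, ¬ e.IsDiag) :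
    ∑ v : V, (N.filter fun e => v ∈ e).card = 2 * N.card := by
  simp only [Finset.card_filter]
  rw [Finset.sum_comm, Finset.card_eq_sum_ones, Finset.mul_sum]
  refine Finset.sum_congr rfl fun e he => ?_
  have h := hN e he
  rw [← Finset.card_filter]
  induction e with
  | _ a b =>
    rw [Sym2.mk_isDiag_iff] at h
    have : Finset.univ.filter (fun v => v ∈ s(a, b)) = {a, b} := by
      ext
      simp
    rw [this, Finset.card_pair h, mul_one]

theorem filter_mem_eq_image [DecidableEq V] [Fintype V] (N : Finset (Sym2 V)) (z : V) :
    N.filter (fun e => z ∈ e) =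
      (Finset.univ.filter fun a => s(z, a) ∈ N).image fun a => s(z, a) := by
  ext e
  simp only [Finset.mem_filter, Finset.mem_image, Finset.mem_univ, true_and]
  constructor
  · rintro ⟨he, a, rfl⟩
    exact ⟨a, he, rfl⟩
  · rintro ⟨a, ha, rfl⟩
    exact ⟨ha, by simp⟩

theorem card_nbr [DecidableEq V] [Fintype V] (N : Finset (Sym2 V)) (z : V) :
    (Finset.univ.filter fun a => s(z, a) ∈ N).card = (N.filter fun e => z ∈ e).card := by
  rw [filter_mem_eq_image, Finset.card_image_of_injective _ fun a b h => Sym2.congr_right.1 h]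

section

variable [DecidableEq V] [Fintype V]

/-- The generic rank of a set of pairs on `Y` is at most `2|Y| - 3`. -/
theorem Generic.card_add_three_le {p : V → Fin 2 → ℝ} (hp : Generic p) {N : Finset (Sym2 V)}
    (hN : LinearIndepOn ℝ (row p) (N : Set (Sym2 V))) {Y : Finset V} (hY : 2 ≤ Y.card)
    (h : ∀ e ∈ N, ∀ v ∈ e, v ∈ Y) : N.card + 3 ≤ 2 * Y.card := by
  obtain ⟨a, ha, b, hb, hab⟩ := Finset.one_lt_card.1 hY
  set Z := (Y.erase a).erase b with hZ
  have hZc : Z.card + 2 = Y.card := by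
    have h1 : Z.card + 1 = (Y.erase a).card :=
      Finset.card_erase_add_one (Finset.mem_erase.2 ⟨hab.symm, hb⟩)
    have h2 := Finset.card_erase_add_one ha
    omega
  let B : Finset (Sym2 V) :=
    insert s(a, b) (Z.image (fun y => s(y, a)) ∪ Z.image (fun y => s(y, b)))
  have hB : B.card ≤ 2 * Z.card + 1 := by
    refine (Finset.card_insert_le _ _).trans ?_
    have h1 := Finset.card_union_le (Z.image (fun y => s(y, a))) (Z.image (fun y => s(y, b)))
    have h2 := Finset.card_image_le (s := Z) (f := fun y => s(y, a))
    have h3 := Finset.card_image_le (s := Z) (f := fun y => s(y, b))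
    omega
  set W := Submodule.span ℝ (row p '' B) with hW
  have hsub {e : Sym2 V} (he : e ∈ B) : row p e ∈ W := Submodule.subset_span ⟨e, he, rfl⟩
  have hbase : row p s(a, b) ∈ W := hsub (by simp [B])
  have hxa (x : V) (hx : x ∈ Y) : row p s(x, a) ∈ W := by
    by_cases h1 : x = a
    · rw [h1, row_diag]
      exact W.zero_mem
    by_cases h2 : x = b
    · rw [h2, Sym2.eq_swap]
      exact hbase
    · exact hsub (Finset.mem_insert_of_mem (Finset.mem_union_left _
        (Finset.mem_image_of_mem (fun y => s(y, a)) (by simp [hZ, h1, h2, hx]))))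
  have hxb (x : V) (hx : x ∈ Y) : row p s(x, b) ∈ W := by
    by_cases h1 : x = b
    · rw [h1, row_diag]
      exact W.zero_mem
    by_cases h2 : x = a
    · rw [h2]
      exact hbase
    · exact hsub (Finset.mem_insert_of_mem (Finset.mem_union_right _
        (Finset.mem_image_of_mem (fun y => s(y, b)) (by simp [hZ, h1, h2, hx]))))
  have := card_le_card_of_mem_span (B := B) hN (by
    intro e he
    have h1 := h e he
    induction e with
    | _ x y =>
      have hx := h1 x (by simp)
      have hy := h1 y (by simp)
      exact hp.row_mem W hab hbase x y (hxa x hx) (hxb x hx) (hxa y hy) (hxb y hy))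
  omega

/-- The star at `u` on `S` together with stars joining each group to its representative. -/
def fan (S : Set V) (g : V → V) (u : V) : Set (Sym2 V) :=
  {e | ∃ t ∈ S, e = s(u, t)} ∪ {e | ∃ t ∈ S, g t ≠ t ∧ e = s(t, g t)}

theorem fan_indep {S : Set V} {g : V → V} (hidem : ∀ a, g (g a) = g a)
    {u : V} (hu : u ∉ S) {q : V → Fin 2 → ℝ} (h1 : ∀ t ∈ S, q t ≠ q u)
    (h2 : ∀ t ∈ S, g t ≠ t → area q t u (g t) ≠ 0) : LinearIndepOn ℝ (row q) (fan S g u) := by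
  classical
  rw [← crow_empty]
  have hstar (T : Finset V) (hT : ∀ t ∈ T, t ∈ S) :
      LinearIndepOn ℝ (crow ∅ id q) {e | ∃ t ∈ T, e = s(u, t)} := by
    induction T using Finset.induction_on with
    | empty => simp
    | insert t T ht ih =>
      have := crow_indep_insert Grouping.empty (Set.notMem_empty t) (a := u) (by
        rintro _ ⟨t', ht', rfl⟩ h
        rw [Sym2.mem_iff] at h
        rcases h with rfl | rfl
        · exact hu (hT _ (by simp))
        · exact ht ht') (h1 t (hT t (by simp))) (ih fun x hx => hT x (by simp [hx]))
      refine this.mono ?_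
      rintro _ ⟨t', ht', rfl⟩
      rcases Finset.mem_insert.1 ht' with rfl | ht'
      · exact Or.inl Sym2.eq_swap
      · exact Or.inr ⟨t', ht', rfl⟩
  have hfan (T : Finset V) (hT : ∀ t ∈ T, t ∈ S ∧ g t ≠ t) :
      LinearIndepOn ℝ (crow ∅ id q) ({e | ∃ t ∈ Finset.univ.filter (fun t => t ∈ S ∧ g t = t),
        e = s(u, t)} ∪ {e | ∃ t ∈ T, e = s(t, u) ∨ e = s(t, g t)}) := by
    induction T using Finset.induction_on with
    | empty =>
      refine (hstar (Finset.univ.filter (fun t => t ∈ S ∧ g t = t)) (by simp +contextual)).mono ?_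
      rintro e (h | ⟨t, ht, -⟩)
      · exact h
      · simp at ht
    | insert t T ht ih =>
      obtain ⟨htS, hgt⟩ := hT t (by simp)
      have htu : t ≠ u := fun h => hu (h ▸ htS)
      have := crow_indep_union_pair Grouping.empty (Set.notMem_empty t) (a := u) (b := g t) (by
        rintro _ (⟨t', ht', rfl⟩ | ⟨t', ht', rfl | rfl⟩) h <;> rw [Sym2.mem_iff] at h
        · rcases h with rfl | rfl
          · exact htu rfl
          · simp [hgt] at ht'
        · rcases h with rfl | rfl
          · exact ht ht'
          · exact htu rfl
        · rcases h with rfl | rfl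
          · exact ht ht'
          · exact hgt (hidem _)) htu hgt.symm (h2 t htS hgt)
        (ih fun x hx => hT x (by simp [hx]))
      refine this.mono ?_
      rintro _ (h | ⟨t', ht', h⟩)
      · exact Or.inl (Or.inl h)
      · rcases Finset.mem_insert.1 ht' with rfl | ht'
        · exact Or.inr h
        · exact Or.inl (Or.inr ⟨t', ht', h⟩)
  refine (hfan (Finset.univ.filter fun t => t ∈ S ∧ g t ≠ t) (by simp)).mono ?_
  rintro _ (⟨t, ht, rfl⟩ | ⟨t, ht, hgt, rfl⟩)
  · by_cases hgt : g t = t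
    · exact Or.inl ⟨t, by simp [ht, hgt], rfl⟩
    · exact Or.inr ⟨t, by simp [ht, hgt], Or.inl Sym2.eq_swap⟩
  · exact Or.inr ⟨t, by simp [ht, hgt], Or.inr rfl⟩

theorem Generic.fan_indep {p : V → Fin 2 → ℝ} (hp : Generic p) {S : Set V} {g : V → V}
    (hidem : ∀ a, g (g a) = g a) (hm : ∀ a ∈ S, g a ∈ S) {u : V} (hu : u ∉ S) :
    LinearIndepOn ℝ (row p) (fan S g u) := by
  refine Rigidity.fan_indep hidem hu ?_ ?_
  · intro t ht h
    have h1 := hp.flat_x_ne ∅ (show t ≠ u from fun h => hu (h ▸ ht))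
    rw [flat_empty, h] at h1
    exact h1 (sub_self _)
  · intro t ht hgt
    exact hp.area_ne (fun h => hu (h ▸ ht)) hgt.symm fun h => hu (h ▸ hm t ht)

/-- All pairs inside the groups of `S` and from `u` to `S`. -/
def groupPairs (S : Set V) (g : V → V) (u : V) : Set (Sym2 V) :=
  {e | ∃ t ∈ S, e = s(u, t)} ∪ {e | ∃ t ∈ S, ∃ t' ∈ S, g t = g t' ∧ e = s(t, t')}

theorem fan_subset_groupPairs {S : Set V} {g : V → V} (hg : Grouping S g) (u : V) :
    fan S g u ⊆ groupPairs S g u := by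
  rintro e (h | ⟨t, ht, -, rfl⟩)
  · exact Or.inl h
  · exact Or.inr ⟨t, ht, g t, hg.maps t ht, (hg.idem t).symm, rfl⟩

theorem Generic.groupPairs_mem_span {p : V → Fin 2 → ℝ} (hp : Generic p) {S : Set V} {g : V → V}
    (hg : Grouping S g) {u : V} (hu : u ∉ S) {e : Sym2 V} (he : e ∈ groupPairs S g u) :
    row p e ∈ Submodule.span ℝ (row p '' fan S g u) := by
  set W := Submodule.span ℝ (row p '' fan S g u)
  have hsub {e : Sym2 V} (he : e ∈ fan S g u) : row p e ∈ W := Submodule.subset_span ⟨e, he, rfl⟩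
  have hut (t : V) (ht : t ∈ S) : row p s(u, t) ∈ W := hsub (Or.inl ⟨t, ht, rfl⟩)
  have htu (t : V) (ht : t ∈ S) : row p s(t, u) ∈ W := Sym2.eq_swap (a := u) ▸ hut t ht
  have htg (t : V) (ht : t ∈ S) : row p s(t, g t) ∈ W := by
    by_cases h : g t = t
    · rw [h, row_diag]
      exact W.zero_mem
    · exact hsub (Or.inr ⟨t, ht, h, rfl⟩)
  rcases he with ⟨t, ht, rfl⟩ | ⟨t, ht, t', ht', h, rfl⟩
  · exact hut t ht
  · have hgS := hg.maps t ht
    refine hp.row_mem W (a := u) (b := g t) (fun h => hu (h ▸ hgS)) (hut _ hgS) t t' (htu t ht)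
      (htg t ht) (htu t' ht') ?_
    rw [h]
    exact htg t' ht'

end

section

variable [DecidableEq V] [Fintype V]

theorem row_notMem_of_indep_mod {p : V → Fin 2 → ℝ} {D : Submodule ℝ (V × Fin 2 → ℝ)}
    {N : Set (Sym2 V)} (h : LinearIndepOn ℝ (D.mkQ ∘ row p) N) {e : Sym2 V} (he : e ∈ N) :
    row p e ∉ D := by
  intro h1
  exact h.ne_zero he ((Submodule.Quotient.mk_eq_zero D).2 h1)

/-- A set of rows independent modulo the groups has a vertex of small degree or a group of
degree one. -/
theorem Generic.exists_low_degree {p : V → Fin 2 → ℝ} (hp : Generic p) {S : Set V} {g : V → V}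
    (hg : Grouping S g) {u : V} (hu : u ∉ S) {N : Finset (Sym2 V)} (hN : N.Nonempty)
    (hNu : ∀ e ∈ N, u ∉ e)
    (h : LinearIndepOn ℝ ((Submodule.span ℝ (row p '' groupPairs S g u)).mkQ ∘ row p)
      (N : Set (Sym2 V))) :
    (∃ z, z ∉ S ∧ 1 ≤ (N.filter fun e => z ∈ e).card ∧ (N.filter fun e => z ∈ e).card ≤ 3) ∨
    ∃ t ∈ S, ∃ e ∈ N, t ∈ e ∧ ∀ e' ∈ N, e' ≠ e → ∀ v ∈ e', g v ≠ g t := by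
  classical
  set D := Submodule.span ℝ (row p '' groupPairs S g u) with hD
  by_contra! hcon
  obtain ⟨hA, hB⟩ := hcon
  have hdiag : ∀ e ∈ N, ¬ e.IsDiag := by
    intro e he hd
    refine row_notMem_of_indep_mod h he ?_
    induction e with
    | _ a b =>
      rw [Sym2.mk_isDiag_iff] at hd
      rw [hd, row_diag]
      exact D.zero_mem
  set deg : V → ℕ := fun v => (N.filter fun e => v ∈ e).card with hdeg
  have hdegpos (v : V) : 1 ≤ deg v ↔ ∃ e ∈ N, v ∈ e := by
    simp only [hdeg, Nat.one_le_iff_ne_zero, ne_eq, Finset.card_eq_zero,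
      Finset.filter_eq_empty_iff]
    push Not
    rfl
  set X := Finset.univ.filter fun v => v ∉ S ∧ 1 ≤ deg v with hX
  set T := Finset.univ.filter fun v => v ∈ S ∧ 1 ≤ deg v with hT
  set M := T.image g with hM
  set A := Finset.univ.filter fun v => v ∈ S ∧ g v ∈ M with hAdef
  have hMS : ∀ m ∈ M, m ∈ S ∧ g m = m := by
    intro m hm
    obtain ⟨t, ht, rfl⟩ := Finset.mem_image.1 hm
    exact ⟨hg.maps t (by simp [hT] at ht; exact ht.1), hg.idem t⟩
  -- degree count
  have hgroup : ∀ m ∈ M, 2 ≤ ∑ t ∈ T with g t = m, deg t := by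
    intro m hm
    obtain ⟨t, ht, rfl⟩ := Finset.mem_image.1 hm
    have ht' := ht
    simp only [hT, Finset.mem_filter, Finset.mem_univ, true_and] at ht'
    obtain ⟨e, he, hte⟩ := (hdegpos t).1 ht'.2
    obtain ⟨e', he', hee', v, hv, hgv⟩ := hB t ht'.1 e he hte
    have hvS : v ∈ S := by
      by_contra hvS
      rw [hg.off v hvS] at hgv
      exact hvS (hgv ▸ hg.maps t ht'.1)
    have hvT : v ∈ T := by
      simp only [hT, Finset.mem_filter, Finset.mem_univ, true_and]
      exact ⟨hvS, (hdegpos v).2 ⟨e', he', hv⟩⟩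
    by_cases hvt : v = t
    · subst hvt
      have : 1 < deg v := Finset.one_lt_card.2 ⟨e, by simp [he, hte], e', by simp [he', hv],
        hee'.symm⟩
      refine le_trans this ?_
      exact Finset.single_le_sum (f := deg) (fun _ _ => Nat.zero_le _) (by simp [hvT])
    · have h1 : ({v, t} : Finset V) ⊆ T.filter fun x => g x = g t := by
        intro x hx
        simp only [Finset.mem_insert, Finset.mem_singleton] at hx
        rcases hx with rfl | rfl
        · simp [hvT, hgv]
        · simp [ht]
      have h2 := Finset.sum_le_sum_of_subset (f := deg) h1
      rw [Finset.sum_pair hvt] at h2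
      have h3 := (hdegpos v).2 ⟨e', he', hv⟩
      have h4 := ht'.2
      omega
  have hsumT : 2 * M.card ≤ ∑ t ∈ T, deg t := by
    rw [← Finset.sum_fiberwise_of_maps_to (g := g) (t := M)
      (fun t ht => Finset.mem_image_of_mem g ht)]
    rw [mul_comm, ← smul_eq_mul]
    exact Finset.card_nsmul_le_sum _ _ _ hgroup
  have hsumX : 4 * X.card ≤ ∑ t ∈ X, deg t := by
    rw [mul_comm, ← smul_eq_mul]
    refine Finset.card_nsmul_le_sum _ _ _ fun z hz => ?_
    simp only [hX, Finset.mem_filter, Finset.mem_univ, true_and] at hz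
    exact hA z hz.1 hz.2
  have hXT : Disjoint X T := by
    rw [Finset.disjoint_left]
    intro z hz hz'
    simp only [hX, hT, Finset.mem_filter, Finset.mem_univ, true_and] at hz hz'
    exact hz.1 hz'.1
  have hsum : 4 * X.card + 2 * M.card ≤ 2 * N.card := by
    rw [← sum_degree hdiag]
    have := Finset.sum_le_sum_of_subset (f := deg) (Finset.subset_univ (X ∪ T))
    rw [Finset.sum_union hXT] at this
    exact (add_le_add hsumX hsumT).trans this
  -- rank count
  have hAS : ∀ t ∈ A, t ∈ S ∧ g t ∈ M := by simp [hAdef]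
  set F₁ := A.image fun t => s(u, t) with hF₁
  set F₂ := (A.filter fun t => g t ≠ t).image fun t => s(t, g t) with hF₂
  have hF₁c : F₁.card = A.card :=
    Finset.card_image_of_injective _ fun a b hab => Sym2.congr_right.1 hab
  have hF₂c : F₂.card + M.card = A.card := by
    have h1 : (A.filter fun t => ¬ g t ≠ t) = M := by
      ext t
      simp only [Finset.mem_filter, hAdef, Finset.mem_univ, true_and, not_not]
      constructor
      · rintro ⟨⟨h1, h2⟩, h3⟩
        rwa [h3] at h2
      · intro h1
        obtain ⟨h2, h3⟩ := hMS t h1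
        exact ⟨⟨h2, h3.symm ▸ h1⟩, h3⟩
    rw [← Finset.card_filter_add_card_filter_not (s := A) (fun t => g t ≠ t), h1, hF₂,
      Finset.card_image_of_injOn]
    intro t ht t' ht' htt
    simp only [Finset.coe_filter, Set.mem_ofPred_eq] at ht ht'
    rcases Sym2.eq_iff.1 htt with ⟨h2, -⟩ | ⟨h2, h3⟩
    · exact h2
    · exact absurd (by rw [h2, hg.idem]) ht.2
  have hFu : Disjoint F₁ F₂ := by
    rw [Finset.disjoint_left]
    rintro e he he'
    obtain ⟨t, ht, rfl⟩ := Finset.mem_image.1 he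
    obtain ⟨t', ht', h1⟩ := Finset.mem_image.1 he'
    have h2 := (hAS t' (Finset.mem_filter.1 ht').1).1
    have h3 : u ∈ s(t', g t') := by rw [h1]; simp
    rcases Sym2.mem_iff.1 h3 with rfl | rfl
    · exact hu h2
    · exact hu (hg.maps t' h2)
  have hFfan : ((F₁ ∪ F₂ : Finset (Sym2 V)) : Set (Sym2 V)) ⊆ fan S g u := by
    intro e he
    rcases Finset.mem_union.1 he with he | he
    · obtain ⟨t, ht, rfl⟩ := Finset.mem_image.1 he
      exact Or.inl ⟨t, (hAS t ht).1, rfl⟩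
    · obtain ⟨t, ht, rfl⟩ := Finset.mem_image.1 he
      exact Or.inr ⟨t, (hAS t (Finset.mem_filter.1 ht).1).1, (Finset.mem_filter.1 ht).2, rfl⟩
  have hFD : ∀ e ∈ F₁ ∪ F₂, row p e ∈ D := fun e he =>
    Submodule.subset_span ⟨e, fan_subset_groupPairs hg u (hFfan he), rfl⟩
  have hFN : Disjoint (F₁ ∪ F₂) N := by
    rw [Finset.disjoint_left]
    intro e he he'
    exact row_notMem_of_indep_mod h he' (hFD e he)
  have hind : LinearIndepOn ℝ (row p) (((F₁ ∪ F₂) ∪ N : Finset (Sym2 V)) : Set (Sym2 V)) := by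
    rw [Finset.coe_union]
    refine linearIndepOn_union_of_map D.mkQ ((hp.fan_indep hg.idem hg.maps hu).mono hFfan) ?_ h
    intro e he
    exact (Submodule.Quotient.mk_eq_zero D).2 (hFD e he)
  set Y := insert u (X ∪ A) with hY
  have hNY : ∀ e ∈ N, ∀ v ∈ e, v ∈ X ∪ A := by
    intro e he v hv
    have h1 := (hdegpos v).2 ⟨e, he, hv⟩
    by_cases hvS : v ∈ S
    · refine Finset.mem_union_right _ ?_
      simp only [hAdef, Finset.mem_filter, Finset.mem_univ, true_and]
      exact ⟨hvS, Finset.mem_image_of_mem g (by simp [hT, hvS, h1])⟩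
    · exact Finset.mem_union_left _ (by simp [hX, hvS, h1])
  have huXA : u ∉ X ∪ A := by
    intro h1
    rcases Finset.mem_union.1 h1 with h1 | h1
    · simp only [hX, Finset.mem_filter, Finset.mem_univ, true_and] at h1
      obtain ⟨e, he, h2⟩ := (hdegpos u).1 h1.2
      exact hNu e he h2
    · exact hu (hAS u h1).1
  have hXA : Disjoint X A := by
    rw [Finset.disjoint_left]
    intro z hz hz'
    simp only [hX, Finset.mem_filter, Finset.mem_univ, true_and] at hz
    exact hz.1 (hAS z hz').1
  have hYc : Y.card = X.card + A.card + 1 := by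
    rw [hY, Finset.card_insert_of_notMem huXA, Finset.card_union_of_disjoint hXA]
  have hne : 1 ≤ (X ∪ A).card := by
    obtain ⟨e, he⟩ := hN
    refine Finset.card_pos.2 ⟨e.out.1, hNY e he _ (Sym2.out_fst_mem e)⟩
  rw [Finset.card_union_of_disjoint hXA] at hne
  have hfinal := hp.card_add_three_le hind (Y := Y) (by omega) (by
    intro e he v hv
    rcases Finset.mem_union.1 he with he | he
    · rcases Finset.mem_union.1 he with he | he
      · obtain ⟨t, ht, rfl⟩ := Finset.mem_image.1 he
        rcases Sym2.mem_iff.1 hv with rfl | rfl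
        · simp [hY]
        · simp [hY, ht]
      · obtain ⟨t, ht, rfl⟩ := Finset.mem_image.1 he
        have ht := (Finset.mem_filter.1 ht).1
        have h1 : g t ∈ A := by
          simp only [hAdef, Finset.mem_filter, Finset.mem_univ, true_and]
          exact ⟨hg.maps t (hAS t ht).1, (hg.idem t).symm ▸ (hAS t ht).2⟩
        rcases Sym2.mem_iff.1 hv with rfl | rfl
        · simp [hY, ht]
        · simp [hY, h1]
    · exact Finset.mem_insert_of_mem (hNY e he v hv))
  rw [Finset.card_union_of_disjoint hFN, Finset.card_union_of_disjoint hFu] at hfinal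
  omega

theorem Generic.crow_indep_of_indep_mod {p : V → Fin 2 → ℝ} (hp : Generic p) {S : Set V}
    {g : V → V} (hg : Grouping S g) {u : V} (hu : u ∉ S) {N : Finset (Sym2 V)}
    (hNu : ∀ e ∈ N, u ∉ e)
    (h : LinearIndepOn ℝ ((Submodule.span ℝ (row p '' groupPairs S g u)).mkQ ∘ row p)
      (N : Set (Sym2 V))) :
    LinearIndepOn ℝ (crow S g (flat S p)) (N : Set (Sym2 V)) := by
  classical
  induction hn : N.card using Nat.strong_induction_on generalizing N with
  | _ n ih =>
  set D := Submodule.span ℝ (row p '' groupPairs S g u) with hD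
  rcases N.eq_empty_or_nonempty with rfl | hne
  · simp
  have hdiag {a : V} (ha : s(a, a) ∈ N) : False :=
    row_notMem_of_indep_mod h ha (by rw [row_diag]; exact D.zero_mem)
  rcases hp.exists_low_degree hg hu hne hNu h with ⟨z, hzS, hz1, hz3⟩ | ⟨t, htS, e, he, hte, hle⟩
  · set N' := N.filter fun e => z ∉ e with hN'
    set T := Finset.univ.filter fun a => s(z, a) ∈ N with hT
    have hmemT {a : V} : a ∈ T ↔ s(z, a) ∈ N := by simp [hT]
    have hN'z : ∀ e ∈ (N' : Set (Sym2 V)), z ∉ e := fun e he => (Finset.mem_filter.1 he).2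
    have hN'N : N' ⊆ N := Finset.filter_subset _ _
    have hcov : ∀ e ∈ N, e ∈ N' ∨ ∃ a ∈ T, e = s(z, a) := by
      intro e he
      by_cases hze : z ∈ e
      · obtain ⟨a, rfl⟩ := hze
        exact Or.inr ⟨a, hmemT.2 he, rfl⟩
      · exact Or.inl (Finset.mem_filter.2 ⟨he, hze⟩)
    have hzT : ∀ a ∈ T, z ≠ a := by
      rintro a ha rfl
      exact hdiag (hmemT.1 ha)
    have huT : ∀ a ∈ T, u ≠ a := by
      rintro a ha rfl
      exact hNu _ (hmemT.1 ha) (by simp)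
    have hcard : (N.filter fun e => z ∈ e).card + N'.card = N.card := by
      convert Finset.card_filter_add_card_filter_not (s := N) (fun e => z ∈ e)
    have hTc : T.card = (N.filter fun e => z ∈ e).card := card_nbr N z
    have hN'i : LinearIndepOn ℝ (crow S g (flat S p)) (N' : Set (Sym2 V)) :=
      ih N'.card (by omega) (fun e he => hNu e (hN'N he)) (h.mono (by exact_mod_cast hN'N)) rfl
    have hcases : T.card = 1 ∨ T.card = 2 ∨ T.card = 3 := by omega
    rcases hcases with hc | hc | hc
    · obtain ⟨a, ha⟩ := Finset.card_eq_one.1 hc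
      have haT : a ∈ T := by simp [ha]
      refine (crow_indep_insert hg hzS hN'z (a := a) (fun h1 => ?_) hN'i).mono ?_
      · exact hp.flat_x_ne S (hzT a haT) (by rw [h1, sub_self])
      · intro e he
        rcases hcov e he with h1 | ⟨b, hb, rfl⟩
        · exact Or.inr h1
        · rw [ha, Finset.mem_singleton] at hb
          exact Or.inl (by rw [hb])
    · obtain ⟨a, b, hab, ha⟩ := Finset.card_eq_two.1 hc
      have haT : a ∈ T := by simp [ha]
      have hbT : b ∈ T := by simp [ha]
      refine (crow_indep_union_pair hg hzS hN'z (hzT a haT) (hzT b hbT)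
        (hp.flat_area_ne (hzT a haT) (hzT b hbT) hab fun h1 => hzS h1.1) hN'i).mono ?_
      intro e he
      rcases hcov e he with h1 | ⟨c, hc, rfl⟩
      · exact Or.inl h1
      · rw [ha, Finset.mem_insert, Finset.mem_singleton] at hc
        rcases hc with rfl | rfl <;> simp
    · obtain ⟨a, b, c, hab, hac, hbc, ha⟩ := Finset.card_eq_three.1 hc
      have haT : a ∈ T := by simp [ha]
      have hbT : b ∈ T := by simp [ha]
      have hcT : c ∈ T := by simp [ha]
      have hNsub : ((N' : Set (Sym2 V)) ∪ {s(z, a), s(z, b), s(z, c)}) ⊆ N := by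
        rintro e (h1 | rfl | rfl | rfl)
        · exact hN'N h1
        · exact hmemT.1 haT
        · exact hmemT.1 hbT
        · exact hmemT.1 hcT
      have hNsub' : (N : Set (Sym2 V)) ⊆ (N' : Set (Sym2 V)) ∪ {s(z, a), s(z, b), s(z, c)} := by
        intro e he
        rcases hcov e he with h1 | ⟨d, hd, rfl⟩
        · exact Or.inl h1
        · simp only [ha, Finset.mem_insert, Finset.mem_singleton] at hd
          rcases hd with rfl | rfl | rfl <;> simp
      have hz' (x : V) : s(z, x) ∉ (N' : Set (Sym2 V)) := fun h1 => hN'z _ h1 (by simp)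
      have key {x y w : V} (hx : x ∈ T) (hy : y ∈ T) (hw : w ∈ T) (hxy : x ≠ y) (hxw : x ≠ w)
          (hyw : y ≠ w)
          (hspan : D.mkQ (row p s(x, y)) ∉ Submodule.span ℝ (D.mkQ ∘ row p '' N')) :
          LinearIndepOn ℝ (crow S g (flat S p)) (N' ∪ {s(z, x), s(z, y), s(z, w)}) := by
        have hxyN : s(x, y) ∉ N' := fun h1 => hspan (Submodule.subset_span ⟨_, h1, rfl⟩)
        refine hp.crow_indep_union_triple hg hzS hN'z (hzT x hx) (hzT y hy) (hzT w hw) hxy hxw hyw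
          hxyN ?_
        rw [← Finset.coe_insert]
        refine ih (insert s(x, y) N').card ?_ ?_ ?_ rfl
        · rw [Finset.card_insert_of_notMem hxyN]
          omega
        · intro e he
          rcases Finset.mem_insert.1 he with rfl | he
          · simp [huT x hx, huT y hy]
          · exact hNu e (hN'N he)
        · rw [Finset.coe_insert]
          exact (h.mono (by exact_mod_cast hN'N)).insert hspan
      have harea := hp.area_ne hab hac hbc
      rcases exists_pair_notMem_span D hab hac hbc harea (h.mono hNsub) (hz' a) (hz' b) (hz' c)
        with h1 | h1 | h1
      · exact (key haT hbT hcT hab hac hbc h1).mono hNsub'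
      · refine (key haT hcT hbT hac hab hbc.symm h1).mono (hNsub'.trans ?_)
        rintro e (h2 | rfl | rfl | rfl) <;> simp_all
      · refine (key hbT hcT haT hbc hab.symm hac.symm h1).mono (hNsub'.trans ?_)
        rintro e (h2 | rfl | rfl | rfl) <;> simp_all
  · obtain ⟨a, rfl⟩ := hte
    have hta : t ≠ a := fun h1 => hdiag (a := t) (by rw [← h1] at he; exact he)
    have hga : g a ≠ g t := by
      intro h1
      by_cases haS : a ∈ S
      · exact row_notMem_of_indep_mod h he
          (Submodule.subset_span ⟨_, Or.inr ⟨t, htS, a, haS, h1.symm, rfl⟩, rfl⟩)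
      · rw [hg.off a haS] at h1
        exact haS (h1 ▸ hg.maps t htS)
    rw [← Finset.insert_erase he, Finset.coe_insert]
    refine crow_indep_leaf (fun e' he' => ?_) (hp.flat_x_ne S hta) hga ?_
    · exact hle e' (Finset.mem_erase.1 he').2 (Finset.mem_erase.1 he').1
    · exact ih (N.erase s(t, a)).card (by rw [← hn]; exact Finset.card_erase_lt_of_mem he)
        (fun e' he' => hNu e' (Finset.mem_erase.1 he').2)
        (h.mono (by exact_mod_cast Finset.erase_subset _ _)) rfl

end

section VecMatroid

variable {ι M : Type*} [AddCommGroup M] [Module ℝ M] [Finite ι]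

/-- The linear matroid of a finite family of vectors. -/
def vecMatroid (f : ι → M) : Matroid ι :=
  (IndepMatroid.ofFinite Set.finite_univ (LinearIndepOn ℝ f) (by simp)
    (fun _ _ hJ h => hJ.mono h)
    (by
      classical
      intro I J hI hJ h
      by_contra! hcon
      have := Fintype.ofFinite ι
      rw [Set.ncard_eq_toFinset_card', Set.ncard_eq_toFinset_card'] at h
      have := card_le_card_of_mem_span (A := J.toFinset) (B := I.toFinset) (f := f)
        (by simpa using hJ) (by
          intro a ha
          rw [Set.coe_toFinset]
          exact hI.mem_span_iff.2 fun h1 => by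
            by_contra h2
            exact hcon a (by simpa using ha) h2 h1)
      omega)
    (fun _ _ => Set.subset_univ _)).matroid

@[simp] theorem vecMatroid_indep (f : ι → M) (I : Set ι) :
    (vecMatroid f).Indep I ↔ LinearIndepOn ℝ f I := Iff.rfl

theorem mem_closure_vecMatroid (f : ι → M) (X : Set ι) (e : ι) :
    e ∈ (vecMatroid f).closure X ↔ f e ∈ Submodule.span ℝ (f '' X) := by
  have hE (a : ι) : a ∈ (vecMatroid f).E := Set.mem_univ a
  have hI {I : Set ι} (hI : LinearIndepOn ℝ f I) (e : ι) :
      e ∈ (vecMatroid f).closure I ↔ f e ∈ Submodule.span ℝ (f '' I) := by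
    have h1 : (vecMatroid f).Indep I := hI
    rw [h1.mem_closure_iff', hI.mem_span_iff]
    exact and_iff_right (hE e)
  obtain ⟨b, hbX, -, hsp, hb⟩ := exists_linearIndepOn_extension (linearIndepOn_empty ℝ f)
    (Set.empty_subset X)
  have h2 : Submodule.span ℝ (f '' X) = Submodule.span ℝ (f '' b) :=
    le_antisymm (Submodule.span_le.2 hsp) (Submodule.span_mono (Set.image_mono hbX))
  have h3 : (vecMatroid f).closure X = (vecMatroid f).closure b := by
    refine subset_antisymm ?_ ((vecMatroid f).closure_subset_closure hbX)
    exact (vecMatroid f).closure_subset_closure_of_subset_closure fun x hx =>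
      (hI hb x).2 (hsp ⟨x, hx, rfl⟩)
  rw [h2, h3, hI hb]

theorem disjoint_span_of_circuits (f : ι → M) {D R : Set ι} (hDR : Disjoint D R)
    (h : ∀ C, C ⊆ D ∪ R → (vecMatroid f).IsCircuit C → (C ∩ D).Nonempty → C ⊆ D) :
    Disjoint (Submodule.span ℝ (f '' D)) (Submodule.span ℝ (f '' R)) := by
  obtain ⟨b, hbD, -, hb, hbi⟩ := exists_linearIndepOn_extension (linearIndepOn_empty ℝ f)
    (Set.empty_subset D)
  obtain ⟨c, hcR, -, hc, hci⟩ := exists_linearIndepOn_extension (linearIndepOn_empty ℝ f)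
    (Set.empty_subset R)
  have hind : LinearIndepOn ℝ f (b ∪ c) := by
    by_contra hdep
    have h1 : (vecMatroid f).Dep (b ∪ c) := ⟨hdep, Set.subset_univ _⟩
    obtain ⟨C, hCs, hC⟩ := h1.exists_isCircuit_subset
    by_cases hCD : (C ∩ D).Nonempty
    · have h2 := h C (hCs.trans (Set.union_subset_union hbD hcR)) hC hCD
      refine hC.not_indep (hbi.mono fun x hx => ?_)
      rcases hCs hx with h3 | h3
      · exact h3
      · exact absurd (hcR h3) (Set.disjoint_left.1 hDR (h2 hx))
    · refine hC.not_indep (hci.mono fun x hx => ?_)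
      rcases hCs hx with h3 | h3
      · exact absurd ⟨x, hx, hbD h3⟩ hCD
      · exact h3
  refine Disjoint.mono (Submodule.span_le.2 hb) (Submodule.span_le.2 hc) ?_
  have hbc : Disjoint b c := hDR.mono hbD hcR
  have h2 := LinearIndependent.disjoint_span_image (v := fun x : ↥(b ∪ c) => f x) hind
    (s := Subtype.val ⁻¹' b) (t := Subtype.val ⁻¹' c) (hbc.preimage _)
  have h3 (s : Set ι) (hs : s ⊆ b ∪ c) :
      (fun x : ↥(b ∪ c) => f x) '' (Subtype.val ⁻¹' s) = f '' s := by
    ext y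
    constructor
    · rintro ⟨x, hx, rfl⟩
      exact ⟨x, hx, rfl⟩
    · rintro ⟨x, hx, rfl⟩
      exact ⟨⟨x, hs hx⟩, hx, rfl⟩
  rwa [h3 b Set.subset_union_left, h3 c Set.subset_union_right] at h2

end VecMatroid

/-- Two circuits which meet: any two elements of their union lie in a common circuit. -/
theorem exists_circuit_of_inter {ι : Type*} [Finite ι] {M : Matroid ι} {C₁ C₂ : Set ι}
    (h1 : M.IsCircuit C₁) (h2 : M.IsCircuit C₂) (h : (C₁ ∩ C₂).Nonempty) {e g : ι} (he : e ∈ C₁)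
    (hg : g ∈ C₂) : ∃ C, M.IsCircuit C ∧ C ⊆ C₁ ∪ C₂ ∧ e ∈ C ∧ g ∈ C := by
  induction hn : (C₁ ∪ C₂).ncard using Nat.strong_induction_on generalizing C₁ C₂ with
  | _ n ih =>
  by_cases he2 : e ∈ C₂
  · exact ⟨C₂, h2, Set.subset_union_right, he2, hg⟩
  by_cases hg1 : g ∈ C₁
  · exact ⟨C₁, h1, Set.subset_union_left, he, hg1⟩
  obtain ⟨f, hf1, hf2⟩ := h
  obtain ⟨C₃, hC₃s, hC₃, heC₃⟩ := h1.strong_elimination h2 hf1 hf2 he he2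
  obtain ⟨C₄, hC₄s, hC₄, hgC₄⟩ := h2.strong_elimination h1 hf2 hf1 hg hg1
  have hs3 : C₃ ⊆ C₁ ∪ C₂ := hC₃s.trans Set.sdiff_subset
  have hs4 : C₄ ⊆ C₁ ∪ C₂ := by
    rw [Set.union_comm]
    exact hC₄s.trans Set.sdiff_subset
  have hf3 : f ∉ C₃ := fun h => (hC₃s h).2 rfl
  have hf4 : f ∉ C₄ := fun h => (hC₄s h).2 rfl
  have h32 : (C₃ ∩ C₂).Nonempty := by
    by_contra hcon
    have : C₃ ⊆ C₁ := fun x hx => (hs3 hx).resolve_right fun h => hcon ⟨x, hx, h⟩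
    exact hf3 (hC₃.eq_of_subset_isCircuit h1 this ▸ hf1)
  have step {A B : Set ι} (hA : M.IsCircuit A) (hB : M.IsCircuit B) (hAB : (A ∩ B).Nonempty)
      (heA : e ∈ A) (hgB : g ∈ B) (hs : A ∪ B ⊂ C₁ ∪ C₂) :
      ∃ C, M.IsCircuit C ∧ C ⊆ C₁ ∪ C₂ ∧ e ∈ C ∧ g ∈ C := by
    obtain ⟨C, hC, hCs, h3⟩ := ih (A ∪ B).ncard (hn ▸ Set.ncard_lt_ncard hs) hA hB hAB heA hgB rfl
    exact ⟨C, hC, hCs.trans hs.subset, h3⟩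
  by_cases hu1 : C₃ ∪ C₂ = C₁ ∪ C₂
  · obtain ⟨w, hw4, hw2⟩ : ∃ w ∈ C₄, w ∉ C₂ := by
      by_contra! hcon
      exact hf4 (hC₄.eq_of_subset_isCircuit h2 hcon ▸ hf2)
    have hw3 : w ∈ C₃ := by
      have : w ∈ C₃ ∪ C₂ := hu1 ▸ Or.inl ((hs4 hw4).resolve_right hw2)
      exact this.resolve_right hw2
    refine step hC₃ hC₄ ⟨w, hw3, hw4⟩ heC₃ hgC₄ ⟨Set.union_subset hs3 hs4, fun h => ?_⟩
    rcases h (Or.inl hf1) with h | h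
    · exact hf3 h
    · exact hf4 h
  · exact step hC₃ h2 h32 heC₃ hg
      (ssubset_of_subset_of_ne (Set.union_subset hs3 Set.subset_union_right) hu1)

section Generic

variable [DecidableEq V] [Fintype V]

theorem rankAt_eq (p : V → Fin 2 → ℝ) (F : Set (Sym2 V)) :
    rankAt 2 p F = Module.finrank ℝ (Submodule.span ℝ (row p '' F)) := by
  have : {x : V × Fin 2 → ℝ | ∃ u v : V, s(u, v) ∈ F ∧ x = edgeVec p u v} = row p '' F := by
    ext x
    constructor
    · rintro ⟨a, b, h, rfl⟩
      exact ⟨s(a, b), h, rfl⟩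
    · rintro ⟨e, he, rfl⟩
      induction e with
      | _ a b => exact ⟨a, b, he, rfl⟩
  rw [rankAt, this]

theorem Generic.rankAt_le {p : V → Fin 2 → ℝ} (hp : Generic p) (q : V → Fin 2 → ℝ)
    (F : Set (Sym2 V)) : rankAt 2 q F ≤ rankAt 2 p F := by
  rw [rankAt_eq, rankAt_eq]
  obtain ⟨b, hbF, -, hb, hbi⟩ := exists_linearIndepOn_extension (linearIndepOn_empty ℝ (row q))
    (Set.empty_subset F)
  have h1 : Submodule.span ℝ (row q '' F) = Submodule.span ℝ (row q '' b) :=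
    le_antisymm (Submodule.span_le.2 hb) (Submodule.span_mono (Set.image_mono hbF))
  have hcard {r : V → Fin 2 → ℝ} (hr : LinearIndepOn ℝ (row r) b) :
      Module.finrank ℝ (Submodule.span ℝ (row r '' b)) = b.ncard := by
    have := Fintype.ofFinite b
    have h2 := finrank_span_eq_card (R := ℝ) (b := fun e : b => row r e) hr
    rw [← Set.image_eq_range] at h2
    rw [h2, Set.ncard_eq_toFinset_card', Set.toFinset_card]
  rw [h1, hcard hbi, ← hcard (hp.row_indep hbi)]
  exact Submodule.finrank_mono (Submodule.span_mono (Set.image_mono hbF))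

theorem Generic.rd_eq {p : V → Fin 2 → ℝ} (hp : Generic p) (F : Set (Sym2 V)) :
    rd 2 F = rankAt 2 p F := by
  refine IsGreatest.csSup_eq ⟨⟨p, rfl⟩, ?_⟩
  rintro _ ⟨q, rfl⟩
  exact hp.rankAt_le q F

theorem Generic.rdIndep_iff {p : V → Fin 2 → ℝ} (hp : Generic p) (F : Set (Sym2 V)) :
    RdIndep 2 F ↔ LinearIndepOn ℝ (row p) F := by
  have := Fintype.ofFinite F
  rw [RdIndep, hp.rd_eq, rankAt_eq, LinearIndepOn, linearIndependent_iff_card_eq_finrank_span,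
    ← Set.image_eq_range, Set.ncard_eq_toFinset_card', Set.toFinset_card, eq_comm]
  rfl

theorem Generic.rdCircuit_iff {p : V → Fin 2 → ℝ} (hp : Generic p) (C : Set (Sym2 V)) :
    RdCircuit 2 C ↔ (vecMatroid (row p)).IsCircuit C := by
  rw [Matroid.isCircuit_iff_forall_ssubset, RdCircuit]
  refine and_congr ?_ ?_
  · rw [hp.rdIndep_iff, Matroid.Dep, vecMatroid_indep]
    exact (and_iff_left (Set.subset_univ _)).symm
  · exact forall_congr' fun C' => imp_congr_right fun _ => hp.rdIndep_iff C'

end Generic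

section

variable [DecidableEq V] [Fintype V]

theorem mkQ_bot_indep {ι M : Type*} [AddCommGroup M] [Module ℝ M] {f : ι → M} {s : Set ι} :
    LinearIndepOn ℝ ((⊥ : Submodule ℝ M).mkQ ∘ f) s ↔ LinearIndepOn ℝ f s := by
  have h : LinearMap.ker (⊥ : Submodule ℝ M).mkQ = ⊥ := Submodule.ker_mkQ _
  exact LinearMap.linearIndependent_iff (v := fun i : s => f i) _ h

theorem mem_span_comp {ι M M' : Type*} [AddCommGroup M] [Module ℝ M] [AddCommGroup M']
    [Module ℝ M'] (L : M →ₗ[ℝ] M') {f : ι → M} {s : Set ι} {x : M}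
    (h : x ∈ Submodule.span ℝ (f '' s)) : L x ∈ Submodule.span ℝ (L ∘ f '' s) := by
  rw [Set.image_comp, ← Submodule.map_span]
  exact Submodule.mem_map_of_mem h

/-- A vertex of degree three whose neighbours are pairwise linked gives a dependent set. -/
theorem Generic.not_indep_union_triple {p : V → Fin 2 → ℝ} (hp : Generic p) {N : Set (Sym2 V)}
    {z a b c : V} (hab : a ≠ b) (hac : a ≠ c) (hbc : b ≠ c)
    (hN : ∀ e ∈ N, z ∉ e)
    (h1 : row p s(a, b) ∈ Submodule.span ℝ (row p '' N))
    (h2 : row p s(a, c) ∈ Submodule.span ℝ (row p '' N))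
    (h3 : row p s(b, c) ∈ Submodule.span ℝ (row p '' N)) :
    ¬ LinearIndepOn ℝ (row p) (N ∪ {s(z, a), s(z, b), s(z, c)}) := by
  intro h
  have hz (x : V) : s(z, x) ∉ N := fun h => hN _ h (by simp)
  rcases exists_pair_notMem_span ⊥ hab hac hbc (hp.area_ne hab hac hbc) (mkQ_bot_indep.2 h)
    (hz a) (hz b) (hz c) with h4 | h4 | h4
  · exact h4 (mem_span_comp _ h1)
  · exact h4 (mem_span_comp _ h2)
  · exact h4 (mem_span_comp _ h3)

/-- A circuit without loops has a vertex of degree three. -/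
theorem Generic.exists_degree_three {p : V → Fin 2 → ℝ} (hp : Generic p) {C : Finset (Sym2 V)}
    (hC : (vecMatroid (row p)).IsCircuit (C : Set (Sym2 V))) (hdiag : ∀ e ∈ C, ¬ e.IsDiag) :
    ∃ z, (C.filter fun e => z ∈ e).card = 3 := by
  classical
  by_contra! hcon
  set deg : V → ℕ := fun v => (C.filter fun e => v ∈ e).card with hdeg
  have hcov (z : V) : ∀ e ∈ C, e ∈ C.filter (fun e => z ∉ e) ∨ ∃ a, s(z, a) ∈ C ∧ e = s(z, a) := by
    intro e he
    by_cases hze : z ∈ e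
    · obtain ⟨a, rfl⟩ := hze
      exact Or.inr ⟨a, he, rfl⟩
    · exact Or.inl (Finset.mem_filter.2 ⟨he, hze⟩)
  have hzne {z a : V} (h : s(z, a) ∈ C) : z ≠ a := by
    rintro rfl
    exact hdiag _ h (by simp)
  have hind (z a : V) (ha : s(z, a) ∈ C) :
      LinearIndepOn ℝ (crow ∅ id p) ((C.filter fun e => z ∉ e : Finset (Sym2 V)) :
        Set (Sym2 V)) := by
    rw [crow_empty]
    refine hC.ssubset_indep ?_
    rw [Finset.coe_ssubset]
    exact ⟨Finset.filter_subset _ _, fun h => (Finset.mem_filter.1 (h ha)).2 (by simp)⟩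
  have hdep : ¬ LinearIndepOn ℝ (crow ∅ id p) (C : Set (Sym2 V)) := by
    rw [crow_empty]
    exact hC.not_indep
  have hNz (z : V) : ∀ e ∈ ((C.filter fun e => z ∉ e : Finset (Sym2 V)) : Set (Sym2 V)), z ∉ e :=
    fun e he => (Finset.mem_filter.1 he).2
  have h1 (z : V) : deg z ≠ 1 := by
    intro h
    rw [hdeg] at h
    simp only at h
    rw [← card_nbr, Finset.card_eq_one] at h
    obtain ⟨a, ha⟩ := h
    have hmem (x : V) : s(z, x) ∈ C ↔ x = a := by simpa using Finset.ext_iff.1 ha x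
    have haC := (hmem a).2 rfl
    refine hdep ((crow_indep_insert Grouping.empty (Set.notMem_empty z) (hNz z) (a := a) ?_
      (hind z a haC)).mono ?_)
    · intro h2
      have := hp.flat_x_ne ∅ (hzne haC)
      rw [flat_empty, h2, sub_self] at this
      exact this rfl
    · intro e he
      rcases hcov z e he with h2 | ⟨b, hb, rfl⟩
      · exact Or.inr h2
      · exact Or.inl (by rw [(hmem b).1 hb])
  have h2 (z : V) : deg z ≠ 2 := by
    intro h
    rw [hdeg] at h
    simp only at h
    rw [← card_nbr, Finset.card_eq_two] at h
    obtain ⟨a, b, hab, ha⟩ := h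
    have hmem (x : V) : s(z, x) ∈ C ↔ x = a ∨ x = b := by simpa using Finset.ext_iff.1 ha x
    have haC := (hmem a).2 (Or.inl rfl)
    have hbC := (hmem b).2 (Or.inr rfl)
    refine hdep ((crow_indep_union_pair Grouping.empty (Set.notMem_empty z) (hNz z) (hzne haC)
      (hzne hbC) (hp.area_ne (hzne haC) (hzne hbC) hab) (hind z a haC)).mono ?_)
    intro e he
    rcases hcov z e he with h2 | ⟨x, hx, rfl⟩
    · exact Or.inl h2
    · rcases (hmem x).1 hx with rfl | rfl <;> simp
  set Y := Finset.univ.filter fun v => 1 ≤ deg v with hY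
  have hsum : 4 * Y.card ≤ 2 * C.card := by
    rw [← sum_degree hdiag, mul_comm, ← smul_eq_mul]
    refine (Finset.card_nsmul_le_sum Y deg 4 fun v hv => ?_).trans
      (Finset.sum_le_sum_of_subset (Finset.subset_univ _))
    have h3 := (Finset.mem_filter.1 hv).2
    have h4 := h1 v
    have h5 := h2 v
    have h6 := hcon v
    have h7 : deg v ≠ 3 := h6
    omega
  obtain ⟨e, he⟩ := hC.nonempty
  have he : e ∈ C := he
  have hYmem : ∀ e ∈ C, ∀ v ∈ e, v ∈ Y := by
    intro e he v hv
    simp only [hY, Finset.mem_filter, Finset.mem_univ, true_and]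
    exact Finset.card_pos.2 ⟨e, by simp [he, hv]⟩
  have hYc : 2 ≤ Y.card := by
    induction e with
    | _ a b =>
      exact Finset.one_lt_card.2 ⟨a, hYmem _ he a (by simp), b, hYmem _ he b (by simp), hzne he⟩
  have hfin := hp.card_add_three_le (N := C.erase e) (Y := Y) (by
    rw [Finset.coe_erase]
    exact hC.sdiff_singleton_indep he) hYc (fun e' he' => hYmem e' (Finset.mem_erase.1 he').2)
  have := Finset.card_erase_add_one he
  omega

/-- Circuits of the generic rigidity matroid are rigid. -/
theorem Generic.circuit_rigid {p : V → Fin 2 → ℝ} (hp : Generic p) {C : Set (Sym2 V)}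
    (hC : (vecMatroid (row p)).IsCircuit C) {w w' : V} (hw : w ∈ vertexSpan C)
    (hw' : w' ∈ vertexSpan C) : row p s(w, w') ∈ Submodule.span ℝ (row p '' C) := by
  classical
  obtain ⟨C, rfl⟩ : ∃ C' : Finset (Sym2 V), C = C' := ⟨C.toFinite.toFinset, by simp⟩
  induction hn : C.card using Nat.strong_induction_on generalizing C w w' with
  | _ n ih =>
  by_cases hdiag : ∀ e ∈ C, ¬ e.IsDiag
  swap
  · push Not at hdiag
    obtain ⟨e, he, hd⟩ := hdiag
    have h1 : C = {e} := by
      have h2 : ¬ (vecMatroid (row p)).Indep {e} := by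
        rw [vecMatroid_indep]
        intro h3
        refine h3.ne_zero (Set.mem_singleton e) ?_
        induction e with
        | _ a b =>
          rw [Sym2.mk_isDiag_iff] at hd
          rw [hd, row_diag]
      have := hC.eq_of_not_indep_subset h2 (by simpa using he)
      exact_mod_cast this.symm
    subst h1
    induction e with
    | _ a b =>
      rw [Sym2.mk_isDiag_iff] at hd
      subst hd
      have h3 {x : V} (hx : x ∈ vertexSpan ((({s(a, a)} : Finset (Sym2 V))) : Set (Sym2 V))) :
          x = a := by
        obtain ⟨e, he, hxe⟩ := hx
        simp only [Finset.coe_singleton, Set.mem_singleton_iff] at he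
        subst he
        simpa using hxe
      rw [h3 hw, h3 hw', row_diag]
      exact Submodule.zero_mem _
  obtain ⟨z, hz⟩ := hp.exists_degree_three hC hdiag
  have hz0 := hz
  rw [← card_nbr, Finset.card_eq_three] at hz
  obtain ⟨a, b, c, hab, hac, hbc, ha⟩ := hz
  have hmem (x : V) : s(z, x) ∈ C ↔ x = a ∨ x = b ∨ x = c := by
    simpa using Finset.ext_iff.1 ha x
  have hzne {x : V} (h : x = a ∨ x = b ∨ x = c) : z ≠ x := by
    rintro rfl
    exact hdiag _ ((hmem z).2 h) (by simp)
  set N := C.filter fun e => z ∉ e with hNdef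
  have hNC : N ⊆ C := Finset.filter_subset _ _
  have hNz : ∀ e ∈ (N : Set (Sym2 V)), z ∉ e := fun e he => (Finset.mem_filter.1 he).2
  have hcard : N.card + 3 = C.card := by
    rw [← Finset.card_filter_add_card_filter_not (s := C) (fun e => z ∈ e), add_comm]
    congr 1
    rw [← hz0]
  have hNi : LinearIndepOn ℝ (row p) (N : Set (Sym2 V)) := by
    refine hC.ssubset_indep ?_
    rw [Finset.coe_ssubset]
    refine Finset.ssubset_iff_subset_ne.2 ⟨hNC, ?_⟩
    rintro h
    rw [h] at hcard
    omega
  have hcov : (C : Set (Sym2 V)) ⊆ (N : Set (Sym2 V)) ∪ {s(z, a), s(z, b), s(z, c)} := by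
    intro e he
    by_cases hze : z ∈ e
    · obtain ⟨x, rfl⟩ := hze
      rcases (hmem x).1 he with rfl | rfl | rfl <;> simp
    · exact Or.inl (Finset.mem_filter.2 ⟨he, hze⟩)
  have hpair {x y t : V} (hx : x = a ∨ x = b ∨ x = c) (hy : y = a ∨ y = b ∨ y = c)
      (ht : t = a ∨ t = b ∨ t = c) (hxy : x ≠ y) (hxt : x ≠ t) (hyt : y ≠ t)
      (hs : ({s(z, a), s(z, b), s(z, c)} : Set (Sym2 V)) ⊆ {s(z, x), s(z, y), s(z, t)}) :
      ∃ N' : Set (Sym2 V), N' ⊆ N ∧ row p s(x, y) ∈ Submodule.span ℝ (row p '' N') ∧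
        ∀ w ∈ vertexSpan N', row p s(w, x) ∈ Submodule.span ℝ (row p '' N) ∧
          row p s(w, y) ∈ Submodule.span ℝ (row p '' N) := by
    by_cases hxyN : s(x, y) ∈ N
    · have h1 : row p s(x, y) ∈ Submodule.span ℝ (row p '' N) :=
        Submodule.subset_span ⟨_, hxyN, rfl⟩
      refine ⟨{s(x, y)}, by simpa using hxyN, Submodule.subset_span ⟨_, rfl, rfl⟩, ?_⟩
      rintro w ⟨e, rfl, hwe⟩
      rcases Sym2.mem_iff.1 hwe with rfl | rfl
      · rw [row_diag]
        exact ⟨Submodule.zero_mem _, h1⟩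
      · rw [row_diag, Sym2.eq_swap]
        exact ⟨h1, Submodule.zero_mem _⟩
    · have h1 : row p s(x, y) ∈ Submodule.span ℝ (row p '' N) := by
        by_contra h2
        have h3 := hp.crow_indep_union_triple Grouping.empty (Set.notMem_empty z) hNz (hzne hx)
          (hzne hy) (hzne ht) hxy hxt hyt hxyN (by
            rw [flat_empty, crow_empty]
            exact hNi.insert h2)
        rw [flat_empty, crow_empty] at h3
        exact hC.not_indep (h3.mono (hcov.trans (Set.union_subset_union_right _ hs)))
      obtain ⟨C', hC's, hC', hxyC'⟩ := Matroid.exists_isCircuit_of_mem_closure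
        ((mem_closure_vecMatroid (row p) N s(x, y)).2 h1) hxyN
      have hle : Submodule.span ℝ (row p '' C') ≤ Submodule.span ℝ (row p '' N) := by
        rw [Submodule.span_le]
        rintro _ ⟨e, he, rfl⟩
        rcases hC's he with rfl | he
        · exact h1
        · exact Submodule.subset_span ⟨e, he, rfl⟩
      have hN's : C' \ {s(x, y)} ⊆ N := fun e he => (hC's he.1).resolve_left he.2
      refine ⟨C' \ {s(x, y)}, hN's, (mem_closure_vecMatroid _ _ _).1
        (hC'.mem_closure_sdiff_singleton_of_mem hxyC'), ?_⟩
      rintro w ⟨e, he, hwe⟩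
      obtain ⟨C', rfl⟩ : ∃ C'' : Finset (Sym2 V), C' = C'' := ⟨C'.toFinite.toFinset, by simp⟩
      have hc : C'.card < n := by
        have h2 : C' ⊆ insert s(x, y) N := by exact_mod_cast hC's
        have h3 := (Finset.card_le_card h2).trans (Finset.card_insert_le _ _)
        omega
      have hwC : w ∈ vertexSpan (C' : Set (Sym2 V)) := ⟨e, he.1, hwe⟩
      exact ⟨hle (ih _ hc C' hC' hwC ⟨_, hxyC', by simp⟩ rfl),
        hle (ih _ hc C' hC' hwC ⟨_, hxyC', by simp⟩ rfl)⟩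
  obtain ⟨N₁, hN₁, hab', hv₁⟩ := hpair (x := a) (y := b) (t := c) (by simp) (by simp) (by simp)
    hab hac hbc subset_rfl
  obtain ⟨N₂, hN₂, hac', hv₂⟩ := hpair (x := a) (y := c) (t := b) (by simp) (by simp) (by simp)
    hac hab hbc.symm (by rintro e (rfl | rfl | rfl) <;> simp)
  obtain ⟨N₃, hN₃, hbc', hv₃⟩ := hpair (x := b) (y := c) (t := a) (by simp) (by simp) (by simp)
    hbc hab.symm hac.symm (by rintro e (rfl | rfl | rfl) <;> simp)
  set W := Submodule.span ℝ (row p '' (C : Set (Sym2 V))) with hW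
  have hNW : Submodule.span ℝ (row p '' (N : Set (Sym2 V))) ≤ W :=
    Submodule.span_mono (Set.image_mono (by exact_mod_cast hNC))
  have hall : N₁ ∪ N₂ ∪ N₃ = N := by
    refine subset_antisymm (Set.union_subset (Set.union_subset hN₁ hN₂) hN₃) ?_
    have hmono {s t : Set (Sym2 V)} (h : s ⊆ t) :
        Submodule.span ℝ (row p '' s) ≤ Submodule.span ℝ (row p '' t) :=
      Submodule.span_mono (Set.image_mono h)
    have hsubN : N₁ ∪ N₂ ∪ N₃ ⊆ N := Set.union_subset (Set.union_subset hN₁ hN₂) hN₃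
    have h1 := hp.not_indep_union_triple (N := N₁ ∪ N₂ ∪ N₃) hab hac hbc
      (fun e he => hNz e (hsubN he)) (hmono (by intro x; simp +contextual) hab')
      (hmono (by intro x; simp +contextual) hac') (hmono (by intro x; simp +contextual) hbc')
    have h2 := hC.eq_of_not_indep_subset h1 (by
      refine Set.union_subset (hsubN.trans (by exact_mod_cast hNC)) ?_
      rintro e (rfl | rfl | rfl)
      · exact (hmem a).2 (by simp)
      · exact (hmem b).2 (by simp)
      · exact (hmem c).2 (by simp))
    intro e he
    have h3 : e ∈ (C : Set (Sym2 V)) := hNC he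
    rw [← h2] at h3
    rcases h3 with h3 | h3
    · exact h3
    · exfalso
      refine hNz e he ?_
      rcases h3 with rfl | rfl | rfl <;> simp
  have hmonoN {s : Set (Sym2 V)} (h : s ⊆ N) {r} (hr : r ∈ Submodule.span ℝ (row p '' s)) :
      r ∈ W := hNW (Submodule.span_mono (Set.image_mono h) hr)
  have eab : row p s(a, b) ∈ W := hmonoN hN₁ hab'
  have eac : row p s(a, c) ∈ W := hmonoN hN₂ hac'
  have ebc : row p s(b, c) ∈ W := hmonoN hN₃ hbc'
  have hswap {x y : V} (h : row p s(x, y) ∈ W) : row p s(y, x) ∈ W := by rwa [Sym2.eq_swap]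
  have hzz (x : V) : row p s(x, x) ∈ W := by
    rw [row_diag]
    exact W.zero_mem
  have hkey {x : V} (hx : x ∈ vertexSpan (C : Set (Sym2 V))) :
      row p s(x, a) ∈ W ∧ row p s(x, b) ∈ W := by
    obtain ⟨e, he, hxe⟩ := hx
    rcases hcov he with he | he
    · have he' : e ∈ N₁ ∪ N₂ ∪ N₃ := hall ▸ he
      rcases he' with (he | he) | he
      · obtain ⟨h1, h2⟩ := hv₁ x ⟨e, he, hxe⟩
        exact ⟨hNW h1, hNW h2⟩
      · obtain ⟨h1, h2⟩ := hv₂ x ⟨e, he, hxe⟩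
        exact ⟨hNW h1, hp.row_mem W hac eac x b (hNW h1) (hNW h2) (hswap eab) ebc⟩
      · obtain ⟨h1, h2⟩ := hv₃ x ⟨e, he, hxe⟩
        exact ⟨hp.row_mem W hbc ebc x a (hNW h1) (hNW h2) eab eac, hNW h1⟩
    · have hza : row p s(z, a) ∈ W := Submodule.subset_span ⟨_, (hmem a).2 (by simp), rfl⟩
      have hzb : row p s(z, b) ∈ W := Submodule.subset_span ⟨_, (hmem b).2 (by simp), rfl⟩
      have hx4 : x = z ∨ x = a ∨ x = b ∨ x = c := by
        rcases he with rfl | rfl | rfl <;> rcases Sym2.mem_iff.1 hxe with rfl | rfl <;> simp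
      rcases hx4 with rfl | rfl | rfl | rfl
      · exact ⟨hza, hzb⟩
      · exact ⟨hzz _, eab⟩
      · exact ⟨hswap eab, hzz _⟩
      · exact ⟨hswap eac, hswap ebc⟩
  obtain ⟨h1, h2⟩ := hkey hw
  obtain ⟨h3, h4⟩ := hkey hw'
  exact hp.row_mem W hab eab w w' h1 h2 h3 h4

/-- The `ℛ₂`-component of an edge. -/
def comp (G : SimpleGraph V) (e : Sym2 V) : Set (Sym2 V) :=
  {f | f ∈ G.edgeSet ∧ (e = f ∨ ∃ C, RdCircuitOf 2 G C ∧ e ∈ C ∧ f ∈ C)}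

variable {G : SimpleGraph V} {p : V → Fin 2 → ℝ}

theorem comp_subset (e : Sym2 V) : comp G e ⊆ G.edgeSet := fun _ h => h.1

theorem mem_comp_self {e : Sym2 V} (he : e ∈ G.edgeSet) : e ∈ comp G e := ⟨he, Or.inl rfl⟩

theorem mem_comp_symm {e f : Sym2 V} (he : e ∈ G.edgeSet) (h : f ∈ comp G e) : e ∈ comp G f := by
  obtain ⟨-, rfl | ⟨C, hC, h1, h2⟩⟩ := h
  · exact mem_comp_self he
  · exact ⟨he, Or.inr ⟨C, hC, h2, h1⟩⟩

theorem Generic.mem_comp_trans (hp : Generic p) {e f k : Sym2 V} (h1 : f ∈ comp G e)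
    (h2 : k ∈ comp G f) : k ∈ comp G e := by
  obtain ⟨hf, rfl | ⟨C, hC, heC, hfC⟩⟩ := h1
  · exact h2
  obtain ⟨hk, rfl | ⟨C', hC', hfC', hkC'⟩⟩ := h2
  · exact ⟨hk, Or.inr ⟨C, hC, heC, hfC⟩⟩
  obtain ⟨C'', hC'', hs, he, hk'⟩ := exists_circuit_of_inter ((hp.rdCircuit_iff _).1 hC.2)
    ((hp.rdCircuit_iff _).1 hC'.2) ⟨f, hfC, hfC'⟩ heC hkC'
  exact ⟨hk, Or.inr ⟨C'', ⟨hs.trans (Set.union_subset hC.1 hC'.1), (hp.rdCircuit_iff _).2 hC''⟩,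
    he, hk'⟩⟩

theorem Generic.comp_eq (hp : Generic p) {e f : Sym2 V} (he : e ∈ G.edgeSet)
    (h : f ∈ comp G e) : comp G f = comp G e :=
  subset_antisymm (fun _ hk => hp.mem_comp_trans h hk)
    fun _ hk => hp.mem_comp_trans (mem_comp_symm he h) hk

theorem Generic.circuit_subset_comp (hp : Generic p) {e : Sym2 V} {C : Set (Sym2 V)}
    (hCE : C ⊆ G.edgeSet) (hC : (vecMatroid (row p)).IsCircuit C) (h : (C ∩ comp G e).Nonempty) :
    C ⊆ comp G e := by
  obtain ⟨f, hfC, hf⟩ := h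
  exact fun k hk => hp.mem_comp_trans hf
    ⟨hCE hk, Or.inr ⟨C, ⟨hCE, (hp.rdCircuit_iff _).2 hC⟩, hfC, hk⟩⟩

/-- Components of the generic rigidity matroid are rigid. -/
theorem Generic.comp_rigid (hp : Generic p) {e : Sym2 V} {w w' : V}
    (hw : w ∈ vertexSpan (comp G e)) (hw' : w' ∈ vertexSpan (comp G e)) :
    row p s(w, w') ∈ Submodule.span ℝ (row p '' comp G e) := by
  obtain ⟨f, hf, hwf⟩ := hw
  obtain ⟨k, hk, hwk⟩ := hw'
  have he : e ∈ G.edgeSet := by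
    obtain ⟨h1, rfl | ⟨C, hC, h2, -⟩⟩ := hf
    · exact h1
    · exact hC.1 h2
  obtain ⟨hkE, rfl | ⟨C, hC, hfC, hkC⟩⟩ := hp.mem_comp_trans (mem_comp_symm he hf) hk
  · by_cases hww : w = w'
    · rw [hww, row_diag]
      exact Submodule.zero_mem _
    · rw [← (Sym2.mem_and_mem_iff hww).1 ⟨hwf, hwk⟩]
      exact Submodule.subset_span ⟨f, hf, rfl⟩
  · have hC' := (hp.rdCircuit_iff _).1 hC.2
    exact Submodule.span_mono (Set.image_mono (hp.circuit_subset_comp hC.1 hC' ⟨f, hfC, hf⟩))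
      (hp.circuit_rigid hC' ⟨f, hfC, hwf⟩ ⟨k, hkC, hwk⟩)

theorem Generic.disjoint_span_of_union_comp (hp : Generic p) {D R : Set (Sym2 V)}
    (hDR : Disjoint D R) (hE : D ∪ R ⊆ G.edgeSet) (hD : ∀ e ∈ D, comp G e ⊆ D) :
    Disjoint (Submodule.span ℝ (row p '' D)) (Submodule.span ℝ (row p '' R)) := by
  refine disjoint_span_of_circuits (row p) hDR ?_
  rintro C hCs hC ⟨e, heC, heD⟩
  exact (hp.circuit_subset_comp (hCs.trans hE) hC
    ⟨e, heC, mem_comp_self (hE (Or.inl heD))⟩).trans (hD e heD)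

/-- Distinct components share at most one vertex. -/
theorem Generic.comp_eq_of_two_vertices (hp : Generic p) {e f : Sym2 V} (he : e ∈ G.edgeSet)
    (hf : f ∈ G.edgeSet) {x y : V} (hxy : x ≠ y)
    (hxe : x ∈ vertexSpan (comp G e)) (hye : y ∈ vertexSpan (comp G e))
    (hxf : x ∈ vertexSpan (comp G f)) (hyf : y ∈ vertexSpan (comp G f)) :
    comp G e = comp G f := by
  by_contra hne
  have hdisj : Disjoint (comp G e) (comp G f) := by
    rw [Set.disjoint_left]
    intro k hk hk'
    exact hne ((hp.comp_eq he hk).symm.trans (hp.comp_eq hf hk'))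
  have h1 := hp.disjoint_span_of_union_comp hdisj (Set.union_subset (comp_subset _) (comp_subset _))
    (fun k hk => (hp.comp_eq he hk).le)
  exact hp.row_ne_zero hxy (Submodule.disjoint_def.1 h1 _ (hp.comp_rigid hxe hye)
    (hp.comp_rigid hxf hyf))

end

section Lengths

open Topology

variable [DecidableEq V] [Fintype V]

/-- Pairing of a row with a velocity field. -/
def dot (y : V → Fin 2 → ℝ) : (V × Fin 2 → ℝ) →ₗ[ℝ] ℝ where
  toFun r := ∑ w, r w * y w.1 w.2
  map_add' r r' := by simp [add_mul, Finset.sum_add_distrib]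
  map_smul' c r := by simp [Finset.mul_sum, mul_assoc]

theorem dot_row (q y : V → Fin 2 → ℝ) (a b : V) :
    dot y (row q s(a, b)) = ∑ i, (q a i - q b i) * (y a i - y b i) := by
  simp only [dot, LinearMap.coe_mk, AddHom.coe_mk, row_apply]
  rw [Fintype.sum_prod_type, Finset.sum_comm]
  refine Finset.sum_congr rfl fun i _ => ?_
  simp only [mul_sub, sub_mul, mul_ite, mul_one, mul_zero, ite_mul, zero_mul,
    Finset.sum_sub_distrib, Finset.sum_ite_eq', Finset.mem_univ, if_true]

/-- The squared length of a pair. -/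
def sqlen (x : V → Fin 2 → ℝ) (e : Sym2 V) : ℝ := dot x (row x e)

theorem sqlen_mk (x : V → Fin 2 → ℝ) (a b : V) :
    sqlen x s(a, b) = (x a 0 - x b 0) ^ 2 + (x a 1 - x b 1) ^ 2 := by
  rw [sqlen, dot_row, Fin.sum_univ_two]
  ring

theorem eDist_eq_iff (x y : V → Fin 2 → ℝ) (a b : V) :
    eDist (x a) (x b) = eDist (y a) (y b) ↔ sqlen x s(a, b) = sqlen y s(a, b) := by
  rw [eDist, eDist, Real.sqrt_inj (by positivity) (by positivity), sqlen_mk, sqlen_mk,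
    Fin.sum_univ_two, Fin.sum_univ_two]

theorem sqlen_sub (x y : V → Fin 2 → ℝ) (e : Sym2 V) :
    sqlen x e - sqlen y e = 2 * dot (x - y) (row ((1 / 2 : ℝ) • (x + y)) e) := by
  induction e with
  | _ a b =>
    rw [sqlen_mk, sqlen_mk, dot_row, Fin.sum_univ_two]
    simp only [Pi.smul_apply, Pi.add_apply, Pi.sub_apply, smul_eq_mul]
    ring

theorem Generic.sqlen_eq_of_span {p : V → Fin 2 → ℝ} (hp : Generic p) {x y : V → Fin 2 → ℝ}
    {B : Set (Sym2 V)} (hB : LinearIndepOn ℝ (row ((1 / 2 : ℝ) • (x + y))) B)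
    (h : ∀ e ∈ B, sqlen x e = sqlen y e) {e : Sym2 V}
    (he : row p e ∈ Submodule.span ℝ (row p '' B)) : sqlen x e = sqlen y e := by
  have h1 := hp.row_mem_span hB he
  have h2 : Submodule.span ℝ (row ((1 / 2 : ℝ) • (x + y)) '' B) ≤ LinearMap.ker (dot (x - y)) := by
    rw [Submodule.span_le]
    rintro _ ⟨f, hf, rfl⟩
    have := sqlen_sub x y f
    rw [h f hf, sub_self] at this
    rw [SetLike.mem_coe, LinearMap.mem_ker]
    linarith
  have h3 := sqlen_sub x y e
  rw [LinearMap.mem_ker.1 (h2 h1)] at h3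
  linarith

theorem continuous_row : Continuous fun x : V → Fin 2 → ℝ => row x := by
  refine continuous_pi fun e => continuous_pi fun w => ?_
  induction e with
  | _ a b =>
    simp only [row_apply]
    fun_prop

theorem continuous_sqlen (e : Sym2 V) : Continuous fun x : V → Fin 2 → ℝ => sqlen x e := by
  induction e with
  | _ a b =>
    simp only [sqlen_mk]
    fun_prop

theorem eventually_row_indep {q : V → Fin 2 → ℝ} {Q : Set (Sym2 V)}
    (h : LinearIndepOn ℝ (row q) Q) : ∀ᶠ x in 𝓝 q, LinearIndepOn ℝ (row x) Q := by
  have : IsOpen {f : Q → (V × Fin 2 → ℝ) | LinearIndependent ℝ f} :=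
    isOpen_setOfPred_linearIndependent
  have hc : Continuous fun (x : V → Fin 2 → ℝ) (e : Q) => row x e :=
    continuous_pi fun e => (continuous_apply (e : Sym2 V)).comp continuous_row
  exact (this.preimage hc).mem_nhds h

/-- The derivative of the squared lengths. -/
def sqlenDeriv (q : V → Fin 2 → ℝ) (e : Sym2 V) : (V → Fin 2 → ℝ) →L[ℝ] ℝ :=
  LinearMap.toContinuousLinearMap
    { toFun := fun y => 2 * dot y (row q e)
      map_add' := fun y z => by
        simp only [dot, LinearMap.coe_mk, AddHom.coe_mk, Pi.add_apply, mul_add,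
          Finset.sum_add_distrib]
      map_smul' := fun c y => by
        simp only [dot, LinearMap.coe_mk, AddHom.coe_mk, Pi.smul_apply, smul_eq_mul,
          RingHom.id_apply, Finset.mul_sum]
        exact Finset.sum_congr rfl fun _ _ => by ring }

theorem sqlenDeriv_apply (q y : V → Fin 2 → ℝ) (e : Sym2 V) :
    sqlenDeriv q e y = 2 * dot y (row q e) := rfl

theorem hasStrictFDerivAt_sqlen (q : V → Fin 2 → ℝ) (e : Sym2 V) :
    HasStrictFDerivAt (fun x => sqlen x e) (sqlenDeriv q e) q := by
  induction e with
  | _ a b =>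
    have hc : ∀ (c : V) (i : Fin 2), HasStrictFDerivAt (fun x : V → Fin 2 → ℝ => x c i)
        ((ContinuousLinearMap.proj i).comp
          (ContinuousLinearMap.proj (R := ℝ) (φ := fun _ : V => Fin 2 → ℝ) c)) q := fun c i =>
      ((ContinuousLinearMap.proj (R := ℝ) (φ := fun _ : Fin 2 => ℝ) i).comp
          (ContinuousLinearMap.proj (R := ℝ) (φ := fun _ : V => Fin 2 → ℝ) c)).hasStrictFDerivAt
    have h := (((hc a 0).sub (hc b 0)).pow 2).add (((hc a 1).sub (hc b 1)).pow 2)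
    simp only [sqlen_mk]
    refine h.congr_fderiv ?_
    refine ContinuousLinearMap.ext fun y => ?_
    rw [sqlenDeriv_apply, dot_row, Fin.sum_univ_two]
    simp
    ring

theorem map_sqlen_nhds {q : V → Fin 2 → ℝ} {Q : Set (Sym2 V)}
    (h : LinearIndepOn ℝ (row q) Q) :
    Filter.map (fun x (e : Q) => sqlen x e) (𝓝 q) = 𝓝 (fun e : Q => sqlen q e) := by
  classical
  have hd : HasStrictFDerivAt (fun x (e : Q) => sqlen x e)
      (ContinuousLinearMap.pi fun e : Q => sqlenDeriv q e) q :=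
    hasStrictFDerivAt_pi.2 fun e => hasStrictFDerivAt_sqlen q e
  refine hd.map_nhds_eq_of_surj ?_
  by_contra hne
  obtain ⟨f, hf, hle⟩ := Submodule.exists_le_ker_of_lt_top _ (lt_top_iff_ne_top.2 hne)
  refine hf ?_
  have hz : ∑ e : Q, f (Pi.single e 1) • row q e = 0 := by
    ext w
    have h1 : f (fun e : Q => sqlenDeriv q e (fun a i => if w = (a, i) then 1 else 0)) = 0 :=
      hle ⟨_, rfl⟩
    rw [← Finset.univ_sum_single (fun e : Q => sqlenDeriv q e _), map_sum] at h1
    have h2 : ∀ e : Q, f (Pi.single e (sqlenDeriv q e (fun a i => if w = (a, i) then 1 else 0)))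
        = 2 * (f (Pi.single e 1) * row q e w) := fun e => by
      rw [← mul_one (sqlenDeriv q e _), ← smul_eq_mul, Pi.single_smul, map_smul,
        sqlenDeriv_apply, smul_eq_mul]
      simp [dot]
      ring
    simp only [h2, ← Finset.mul_sum] at h1
    simpa using h1
  have h0 := Fintype.linearIndependent_iff.1 h _ hz
  refine LinearMap.pi_ext' fun e => LinearMap.ext_ring ?_
  simpa using h0 e

end Lengths

section Lift

open Topology

variable [DecidableEq V] [Fintype V]

/-- Forgetting the column of `u`. -/
def dropVertex (u : V) : (V × Fin 2 → ℝ) →ₗ[ℝ] (V × Fin 2 → ℝ) where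
  toFun r w := if w.1 = u then 0 else r w
  map_add' r r' := by
    ext w
    simp only [Pi.add_apply]
    split_ifs <;> simp
  map_smul' c r := by
    ext w
    simp

/-- Moving the second coordinates into the first ones, with weights `c`. -/
def shear (c : V → ℝ) : (V × Fin 2 → ℝ) →ₗ[ℝ] (V × Fin 2 → ℝ) where
  toFun r w := if w.2 = 0 then c w.1 * r (w.1, 1) else 0
  map_add' r r' := by
    ext w
    simp only [Pi.add_apply]
    split_ifs <;> simp [mul_add]
  map_smul' c r := by
    ext w
    simp only [Pi.smul_apply, smul_eq_mul, RingHom.id_apply]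
    split_ifs
    · ring
    · simp

theorem dropVertex_row {q : V → Fin 2 → ℝ} {u : V} {e : Sym2 V} (he : u ∉ e) :
    dropVertex u (row q e) = row q e := by
  ext w
  obtain ⟨a, i⟩ := w
  simp only [dropVertex, LinearMap.coe_mk, AddHom.coe_mk]
  split_ifs with h
  · subst h
    rw [row_apply_of_notMem q he]
  · rfl

/-- Lifting `u` high above the flattened vertices keeps the pairs independent modulo the fan
independent. -/
theorem exists_lift_indep {q : V → Fin 2 → ℝ} {S : Set V} {g : V → V} (hg : Grouping S g)
    {u : V} (hu : u ∉ S) (hy : ∀ t ∈ S, q t 1 = 0) (hx : ∀ a b, a ≠ b → q a 0 ≠ q b 0)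
    {N : Set (Sym2 V)} (hNu : ∀ e ∈ N, u ∉ e) (hN : LinearIndepOn ℝ (crow S g q) N) :
    ∃ h : ℝ, 0 < h ∧
      LinearIndepOn ℝ (row (Function.update q u ![q u 0, h])) (fan S g u ∪ N) := by
  classical
  set c : V → ℝ := fun t => if t ∈ S then q t 0 - q u 0 else 0 with hc
  set L : ℝ → (V × Fin 2 → ℝ) →ₗ[ℝ] (V × Fin 2 → ℝ) := fun ε =>
    contr S g ∘ₗ (dropVertex u + ε • shear c) with hL
  have hopen : IsOpen {f : N → (V × Fin 2 → ℝ) | LinearIndependent ℝ f} :=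
    isOpen_setOfPred_linearIndependent
  have hcont : Continuous fun (ε : ℝ) (e : N) => L ε (row q e) := by
    refine continuous_pi fun e => ?_
    have : (fun ε : ℝ => L ε (row q e)) = fun ε => contr S g (dropVertex u (row q e)) +
        ε • contr S g (shear c (row q e)) := by
      ext ε
      simp [hL]
    rw [this]
    fun_prop
  have h0 : LinearIndependent ℝ (fun e : N => L 0 (row q e)) := by
    have : (fun e : N => L 0 (row q e)) = fun e : N => crow S g q e := by
      ext1 e
      simp [hL, crow, dropVertex_row (hNu e e.2)]
    rw [this]
    exact hN
  have hev : ∀ᶠ ε in 𝓝 (0 : ℝ), LinearIndependent ℝ (fun e : N => L ε (row q e)) :=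
    (hopen.preimage hcont).mem_nhds h0
  obtain ⟨ε, hε, hεi⟩ : ∃ ε : ℝ, 0 < ε ∧ LinearIndependent ℝ (fun e : N => L ε (row q e)) := by
    obtain ⟨δ, hδ, hball⟩ := Metric.eventually_nhds_iff.1 hev
    refine ⟨δ / 2, by positivity, hball ?_⟩
    rw [Real.dist_eq, sub_zero, abs_of_pos (by positivity)]
    linarith
  obtain ⟨qh, hqh⟩ : ∃ x, x = Function.update q u ![q u 0, ε⁻¹] := ⟨_, rfl⟩
  have hne : ∀ {a}, a ≠ u → qh a = q a := fun {a} ha => by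
    rw [hqh, Function.update_of_ne ha]
  have hqu0 : qh u 0 = q u 0 := by simp [hqh]
  have hqu1 : qh u 1 = ε⁻¹ := by simp [hqh]
  have hSu : ∀ {t}, t ∈ S → t ≠ u := fun {t} ht h => hu (h ▸ ht)
  refine ⟨ε⁻¹, by positivity, ?_⟩
  rw [← hqh]
  refine linearIndepOn_union_of_map (L ε) ?_ ?_ ?_
  · refine fan_indep hg.idem hu (fun t ht h => ?_) fun t ht htg => ?_
    · have := congrFun h 0
      rw [hqu0, hne (hSu ht)] at this
      exact hx _ _ (hSu ht) this
    · simp only [area, hqu0, hqu1, hne (hSu ht), hne (hSu (hg.maps t ht)), hy t ht,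
        hy _ (hg.maps t ht)]
      have h1 := hx _ _ htg.symm
      have h2 : ε⁻¹ ≠ 0 := by positivity
      have : (q t 0 - q (g t) 0) * (ε⁻¹ - 0) - (0 - 0) * (q u 0 - q (g t) 0) =
        (q t 0 - q (g t) 0) * ε⁻¹ := by ring
      rw [this]
      exact mul_ne_zero (sub_ne_zero.2 h1) h2
  · rintro e (⟨t, ht, rfl⟩ | ⟨t, ht, htg, rfl⟩)
    · have hz : ∀ w : V × Fin 2, ¬ (w.1 = t ∧ w.2 = 1) →
          (dropVertex u + ε • shear c) (row qh s(u, t)) w = 0 := by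
        rintro ⟨w, i⟩ hw
        simp only [dropVertex, shear, LinearMap.add_apply, LinearMap.smul_apply, LinearMap.coe_mk,
          AddHom.coe_mk, Pi.add_apply, Pi.smul_apply, smul_eq_mul, row_apply]
        by_cases h1 : w = u
        · subst h1
          simp [hc, hu]
        · by_cases h2 : w = t
          · subst h2
            have h3 : i = 0 := by
              fin_cases i
              · rfl
              · exact absurd ⟨rfl, rfl⟩ hw
            subst h3
            simp only [h1, if_false, if_true, hqu0, hqu1, hne h1, hc, ht, hy _ ht]
            field_simp
            ring
          · simp [h1, h2]
      ext ⟨w, i⟩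
      simp only [hL, LinearMap.comp_apply]
      fin_cases i
      · change contr S g _ (w, 0) = 0
        rw [contr_zero]
        refine Finset.sum_eq_zero fun a _ => ?_
        rw [hz _ (by simp), mul_zero]
      · change contr S g _ (w, 1) = 0
        by_cases hw : w ∈ S
        · exact contr_one_of_mem g _ hw
        · rw [contr_one_of_notMem g _ hw]
          exact hz _ fun h => hw ((show w = t from h.1) ▸ ht)
    · have ht1 := hSu ht
      have ht2 := hSu (hg.maps t ht)
      have hue : u ∉ s(t, g t) := by
        rw [Sym2.mem_iff]
        rintro (h | h)
        · exact ht1 h.symm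
        · exact ht2 h.symm
      have hsh : shear c (row qh s(t, g t)) = 0 := by
        ext w
        simp [shear, row_apply, hne ht1, hne ht2, hy t ht, hy _ (hg.maps t ht)]
      simp only [hL, LinearMap.comp_apply, LinearMap.add_apply, LinearMap.smul_apply, hsh,
        smul_zero, add_zero, dropVertex_row hue]
      ext ⟨w, i⟩
      fin_cases i
      · change contr S g _ (w, 0) = 0
        rw [contr_row_zero, hg.idem]
        simp
      · change contr S g _ (w, 1) = 0
        by_cases hw : w ∈ S
        · exact contr_one_of_mem g _ hw
        · rw [contr_one_of_notMem g _ hw]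
          simp [row_apply, hne ht1, hne ht2, hy t ht, hy _ (hg.maps t ht)]
  · change LinearIndependent ℝ (fun e : N => L ε (row qh e))
    have : (fun e : N => L ε (row qh e)) = fun e : N => L ε (row q e) := by
      ext1 e
      rw [row_congr fun z hz => hne fun h => hNu e e.2 (h ▸ hz)]
    rw [this]
    exact hεi

end Lift

section Reflect

/-- Reflecting the points of `T` in the first axis. -/
def reflect (T : Set V) (x : V → Fin 2 → ℝ) : V → Fin 2 → ℝ :=
  open Classical in fun a i => if a ∈ T ∧ i = 1 then -x a i else x a i

theorem reflect_zero (T : Set V) (x : V → Fin 2 → ℝ) (a : V) : reflect T x a 0 = x a 0 := by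
  simp [reflect]

theorem reflect_one_of_mem {T : Set V} (x : V → Fin 2 → ℝ) {a : V} (ha : a ∈ T) :
    reflect T x a 1 = -x a 1 := by
  simp [reflect, ha]

theorem reflect_of_notMem {T : Set V} (x : V → Fin 2 → ℝ) {a : V} (ha : a ∉ T) :
    reflect T x a = x a := by
  ext i
  simp [reflect, ha]

theorem continuous_reflect (T : Set V) : Continuous (reflect T) := by
  classical
  refine continuous_pi fun a => continuous_pi fun i => ?_
  simp only [reflect]
  split_ifs <;> fun_prop

variable [DecidableEq V] [Fintype V]

theorem sqlen_reflect_of_mem {T : Set V} (x : V → Fin 2 → ℝ) {a b : V} (ha : a ∈ T) (hb : b ∈ T) :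
    sqlen (reflect T x) s(a, b) = sqlen x s(a, b) := by
  rw [sqlen_mk, sqlen_mk, reflect_zero, reflect_zero, reflect_one_of_mem x ha,
    reflect_one_of_mem x hb]
  ring

theorem sqlen_congr {x y : V → Fin 2 → ℝ} {e : Sym2 V} (h : ∀ a ∈ e, x a = y a) :
    sqlen x e = sqlen y e := by
  induction e with
  | _ a b =>
    rw [sqlen_mk, sqlen_mk, h a (Sym2.mem_mk_left a b), h b (Sym2.mem_mk_right a b)]

end Reflect

section Main

open Topology

variable [DecidableEq V] [Fintype V]

theorem tendsto_midpoint {X : Type*} {l : Filter X} {f g : X → V → Fin 2 → ℝ}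
    {q : V → Fin 2 → ℝ} (hf : Filter.Tendsto f l (𝓝 q)) (hg : Filter.Tendsto g l (𝓝 q)) :
    Filter.Tendsto (fun z => (1 / 2 : ℝ) • (f z + g z)) l (𝓝 q) := by
  have := (hf.add hg).const_smul (1 / 2 : ℝ)
  convert this using 2
  ext a i
  simp only [Pi.smul_apply, Pi.add_apply, smul_eq_mul]
  ring

/-- Reflecting the groups attached at `u` near a placement with the groups contracted: if the row
space of the group pairs at `u` meets that of the other edges and of `Y` only in the span of `Y`,
then `{u,v}` is not globally linked. -/
theorem not_globallyLinked (G : SimpleGraph V) {u v : V} (huv : v ≠ u) {p : V → Fin 2 → ℝ}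
    (hp : Generic p) {S : Set V} {g : V → V} (hg : Grouping S g) (hu : u ∉ S) (hv : v ∉ S)
    {R Y : Set (Sym2 V)} (hE : G.edgeSet ⊆ groupPairs S g u ∪ R) (hRu : ∀ e ∈ R, u ∉ e)
    (hY : Y ⊆ {e | ∃ t ∈ S, g t ≠ t ∧ e = s(t, g t)})
    (hspan : ∀ x ∈ Submodule.span ℝ (row p '' groupPairs S g u),
      x ∈ Submodule.span ℝ (row p '' (R ∪ Y)) → x ∈ Submodule.span ℝ (row p '' Y)) :
    ¬ GloballyLinked 2 G u v := by
  classical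
  intro hgl
  have hSu : ∀ {t}, t ∈ S → t ≠ u := fun {t} ht h => hu (h ▸ ht)
  have hYfan : Y ⊆ fan S g u := fun e he => Or.inr (hY he)
  have hYu : ∀ e ∈ Y, u ∉ e := by
    intro e he
    obtain ⟨t, ht, -, rfl⟩ := hY he
    rw [Sym2.mem_iff]
    rintro (h | h)
    · exact hSu ht h.symm
    · exact hSu (hg.maps t ht) h.symm
  have hYi : LinearIndepOn ℝ (row p) Y :=
    (hp.fan_indep hg.idem hg.maps hu).mono hYfan
  obtain ⟨B, hYB, hBR, hBspan, hBi⟩ :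
      ∃ B, Y ⊆ B ∧ B ⊆ R ∪ Y ∧ row p '' (R ∪ Y) ⊆ Submodule.span ℝ (row p '' B) ∧
        LinearIndepOn ℝ (row p) B := by
    obtain ⟨B, h1, h2, h3, h4⟩ := exists_linearIndepOn_extension hYi
      (Set.subset_union_right : Y ⊆ R ∪ Y)
    exact ⟨B, h2, h1, h3, h4⟩
  have hBle := Submodule.span_mono (R := ℝ) (Set.image_mono (f := row p) hBR)
  set N : Set (Sym2 V) := B \ Y with hNdef
  have hNR : N ⊆ R := fun e he => (hBR he.1).resolve_right he.2
  have hNu : ∀ e ∈ N, u ∉ e := fun e he => hRu e (hNR he)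
  have hNmod : LinearIndepOn ℝ
      ((Submodule.span ℝ (row p '' groupPairs S g u)).mkQ ∘ row p) N := by
    have hNi : LinearIndependent ℝ (fun e : N => row p e) := hBi.mono Set.sdiff_subset
    refine LinearIndependent.map (f := Submodule.mkQ _) hNi ?_
    rw [Submodule.ker_mkQ, Submodule.disjoint_def]
    intro x hxN hxD
    have hr : Set.range (fun e : N => row p e) = row p '' N := by
      ext x
      simp
    rw [hr] at hxN
    have hxY := hspan x hxD
      (Submodule.span_mono (Set.image_mono (hNR.trans Set.subset_union_left)) hxN)
    have hdis : Disjoint (Submodule.span ℝ (row p '' N)) (Submodule.span ℝ (row p '' Y)) := by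
      have h1 := LinearIndependent.disjoint_span_image (v := fun b : B => row p b) hBi
        (s := {b | (b : Sym2 V) ∉ Y}) (t := {b | (b : Sym2 V) ∈ Y})
        (Set.disjoint_left.2 fun _ h1 h2 => h1 h2)
      refine h1.mono (Submodule.span_mono ?_) (Submodule.span_mono ?_)
      · rintro _ ⟨e, he, rfl⟩
        exact ⟨⟨e, he.1⟩, he.2, rfl⟩
      · rintro _ ⟨e, he, rfl⟩
        exact ⟨⟨e, hYB he⟩, he, rfl⟩
    exact Submodule.disjoint_def.1 hdis x hxN hxY
  have hNc : LinearIndepOn ℝ (crow S g (flat S p)) N := by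
    have := hp.crow_indep_of_indep_mod hg hu (N := N.toFinset) (by simpa using hNu)
      (by simpa using hNmod)
    simpa using this
  obtain ⟨h, hh, hQ⟩ := exists_lift_indep hg hu (fun t ht => flat_of_mem p ht)
    (fun a b hab => sub_ne_zero.1 (hp.flat_x_ne S hab)) hNu hNc
  set Q := fan S g u ∪ N
  set q := Function.update (flat S p) u ![flat S p u 0, h] with hq
  have hqu1 : q u 1 = h := by simp [hq]
  have hqS : ∀ t ∈ S, q t 1 = 0 := fun t ht => by
    rw [hq, Function.update_of_ne (hSu ht), flat_of_mem p ht]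
  have hqv : q v 1 = p v 1 := by
    rw [hq, Function.update_of_ne huv, flat_of_notMem p hv]
  set T : Set V := insert u S
  have huT : u ∈ T := Set.mem_insert u S
  have hST : ∀ {t}, t ∈ S → t ∈ T := fun ht => Set.mem_insert_of_mem u ht
  set p₀ := reflect {u} q with hp₀
  have hp₀T : reflect T p₀ = q := by
    ext a i
    simp only [hp₀, reflect, Set.mem_singleton_iff]
    by_cases h1 : a = u
    · subst h1
      by_cases h2 : i = 1 <;> simp [h2, huT]
    · by_cases h2 : i = 1
      · subst h2
        by_cases h3 : a ∈ T
        · have h4 : a ∈ S := (Set.mem_insert_iff.1 h3).resolve_left h1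
          simp [h1, hqS a h4]
        · simp [h1, h3]
      · simp [h1, h2]
  have hp₀u : reflect {u} p₀ = q := by
    ext a i
    simp only [hp₀, reflect, Set.mem_singleton_iff]
    split_ifs <;> simp
  have hlen_fan : ∀ (x : V → Fin 2 → ℝ), ∀ e ∈ groupPairs S g u,
      sqlen (reflect T x) e = sqlen x e := by
    rintro x e (⟨t, ht, rfl⟩ | ⟨t, ht, t', ht', -, rfl⟩)
    · exact sqlen_reflect_of_mem x huT (hST ht)
    · exact sqlen_reflect_of_mem x (hST ht) (hST ht')
  have hlen_off : ∀ (x : V → Fin 2 → ℝ), ∀ e, u ∉ e → sqlen (reflect {u} x) e = sqlen x e :=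
    fun x e he => sqlen_congr fun a ha => reflect_of_notMem x fun h' => he (by
      rw [Set.mem_singleton_iff] at h'
      exact h' ▸ ha)
  have hfanG := fan_subset_groupPairs hg u
  -- the common lengths of `q` and `p₀`
  have hval : (fun e : Q => sqlen q e) = fun e : Q => sqlen p₀ e := by
    ext ⟨e, he⟩
    rcases he with he | he
    · rw [← hlen_fan p₀ e (hfanG he), hp₀T]
    · rw [← hlen_off p₀ e (hNu e he), hp₀u]
  have hBQ : B ⊆ Q := fun e he => by
    by_cases heY : e ∈ Y
    · exact Or.inl (hYfan heY)
    · exact Or.inr ⟨he, heY⟩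
  -- properties holding near `(q, p₀)`
  have hfst : Filter.Tendsto (fun z : (V → Fin 2 → ℝ) × (V → Fin 2 → ℝ) => z.1)
      (𝓝 q ×ˢ 𝓝 p₀) (𝓝 q) := Filter.tendsto_fst
  have hsnd : Filter.Tendsto (fun z : (V → Fin 2 → ℝ) × (V → Fin 2 → ℝ) => z.2)
      (𝓝 q ×ˢ 𝓝 p₀) (𝓝 p₀) := Filter.tendsto_snd
  have hmid : ∀ (W : Set V), reflect W p₀ = q → ∀ᶠ z in 𝓝 q ×ˢ 𝓝 p₀,
      LinearIndepOn ℝ (row ((1 / 2 : ℝ) • (z.1 + reflect W z.2))) Q := by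
    intro W hW
    have h2 : Filter.Tendsto (fun z : (V → Fin 2 → ℝ) × (V → Fin 2 → ℝ) => reflect W z.2)
        (𝓝 q ×ˢ 𝓝 p₀) (𝓝 q) := by
      have := ((continuous_reflect W).tendsto p₀).comp hsnd
      rwa [hW] at this
    exact (tendsto_midpoint hfst h2).eventually (eventually_row_indep hQ)
  have hne : ∀ᶠ z in 𝓝 q ×ˢ 𝓝 p₀, sqlen z.1 s(u, v) ≠ sqlen z.2 s(u, v) := by
    have h1 := ((continuous_sqlen s(u, v)).tendsto q).comp hfst
    have h2 := ((continuous_sqlen s(u, v)).tendsto p₀).comp hsnd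
    have h3 : sqlen q s(u, v) ≠ sqlen p₀ s(u, v) := by
      rw [sqlen_mk, sqlen_mk, hp₀, reflect_zero, reflect_zero,
        reflect_one_of_mem q (Set.mem_singleton u), reflect_of_notMem q (by simpa using huv),
        hqu1, hqv]
      intro h'
      have h4 : h * p v 1 = 0 := by linarith
      rcases mul_eq_zero.1 h4 with h5 | h5
      · exact hh.ne' h5
      · exact hp.y_ne v h5
    have h4 := (h1.sub h2).eventually_ne (sub_ne_zero.2 h3)
    exact h4.mono fun z hz => sub_ne_zero.1 hz
  obtain ⟨Pq, hPq, Pp, hPp, hP⟩ := Filter.eventually_prod_iff.1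
    ((hmid T hp₀T).and ((hmid {u} hp₀u).and hne))
  have himage : ∀ᶠ y in 𝓝 p₀, (fun e : Q => sqlen y e) ∈
      (fun x (e : Q) => sqlen x e) '' {x | Pq x} := by
    have h1 : (fun x (e : Q) => sqlen x e) '' {x | Pq x} ∈ 𝓝 (fun e : Q => sqlen p₀ e) := by
      rw [← hval, ← map_sqlen_nhds hQ]
      exact Filter.image_mem_map hPq
    have hc : Continuous fun (x : V → Fin 2 → ℝ) (e : Q) => sqlen x e :=
      continuous_pi fun e => continuous_sqlen _
    exact hc.continuousAt.eventually_mem h1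
  obtain ⟨p', hp'g, hp'P, q', hq'P, hlen⟩ : ∃ p', Generic p' ∧ Pp p' ∧ ∃ q', Pq q' ∧
      (fun e : Q => sqlen q' e) = fun e : Q => sqlen p' e := by
    obtain ⟨y, ⟨hy1, hy2⟩, hy3⟩ := mem_closure_iff_nhds.1
      ((dense_generic (V := V)).closure_eq ▸ Set.mem_univ p₀) _ (hPp.and himage)
    obtain ⟨x, hx1, hx2⟩ := hy2
    exact ⟨y, hy3, hy1, x, hx1, hx2⟩
  obtain ⟨hm1, hm2, hne'⟩ := hP hq'P hp'P
  simp only at hm1 hm2 hne'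
  have hlen' : ∀ e ∈ Q, sqlen q' e = sqlen p' e := fun e he => congrFun hlen ⟨e, he⟩
  have heq : ∀ e ∈ groupPairs S g u ∪ R, sqlen q' e = sqlen p' e := by
    rintro e (he | he)
    · rw [← hlen_fan p' e he]
      refine hp.sqlen_eq_of_span (hm1.mono (Set.subset_union_left (s := fan S g u)))
        (fun f hf => ?_) (hp.groupPairs_mem_span hg hu he)
      rw [hlen_fan p' f (hfanG hf), hlen' f (Or.inl hf)]
    · rw [← hlen_off p' e (hRu e he)]
      refine hp.sqlen_eq_of_span (hm2.mono hBQ) (fun f hf => ?_)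
        (hBspan ⟨e, Or.inl he, rfl⟩)
      have hfu : u ∉ f := (hBR hf).elim (hRu f) (hYu f)
      rw [hlen_off p' f hfu, hlen' f (hBQ hf)]
  refine hne' ((eDist_eq_iff _ _ _ _).1 (hgl p' hp'g q' fun a b hab => ?_))
  rw [eDist_eq_iff]
  exact (heq _ (hE hab)).symm

end Main

section Menger

/-- There is a walk from `a` to `b` inside `W`. -/
def Conn (H : SimpleGraph V) (W : Set V) (a b : V) : Prop :=
  ∃ w : H.Walk a b, ∀ z ∈ w.support, z ∈ W

theorem Conn.refl {H : SimpleGraph V} {W : Set V} {a : V} (ha : a ∈ W) : Conn H W a a :=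
  ⟨.nil, by simpa using ha⟩

theorem Conn.symm {H : SimpleGraph V} {W : Set V} {a b : V} : Conn H W a b → Conn H W b a :=
  fun ⟨w, hw⟩ => ⟨w.reverse, by simpa using hw⟩

theorem Conn.trans {H : SimpleGraph V} {W : Set V} {a b c : V} :
    Conn H W a b → Conn H W b c → Conn H W a c := by
  rintro ⟨w, hw⟩ ⟨w', hw'⟩
  refine ⟨w.append w', fun z hz => ?_⟩
  rw [SimpleGraph.Walk.mem_support_append_iff] at hz
  exact hz.elim (hw z) (hw' z)

theorem Conn.mono {H H' : SimpleGraph V} {W W' : Set V} {a b : V} (hH : H ≤ H') (hW : W ⊆ W') :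
    Conn H W a b → Conn H' W' a b :=
  fun ⟨w, hw⟩ => ⟨w.mapLe hH, fun z hz => hW (hw z (by simpa using hz))⟩

theorem Conn.cons {H : SimpleGraph V} {W : Set V} {a b c : V} (h : H.Adj a b) (ha : a ∈ W) :
    Conn H W b c → Conn H W a c :=
  fun ⟨w, hw⟩ => ⟨.cons h w, by simpa using ⟨ha, hw⟩⟩

theorem Conn.left_mem {H : SimpleGraph V} {W : Set V} {a b : V} : Conn H W a b → a ∈ W :=
  fun ⟨w, hw⟩ => hw a w.start_mem_support

theorem Conn.right_mem {H : SimpleGraph V} {W : Set V} {a b : V} : Conn H W a b → b ∈ W :=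
  fun ⟨w, hw⟩ => hw b w.end_mem_support

/-- Induction from the start of a walk. -/
theorem Conn.head_induction {H : SimpleGraph V} {W : Set V} {b : V} {P : V → Prop}
    (refl : b ∈ W → P b) (step : ∀ a c, H.Adj a c → a ∈ W → Conn H W c b → P c → P a) {a : V}
    (h : Conn H W a b) : P a := by
  obtain ⟨w, hw⟩ := h
  induction w with
  | nil => exact refl (hw _ (by simp))
  | cons hadj w ih =>
    have h1 : ∀ z ∈ w.support, z ∈ W := fun z hz => hw z (by simp [hz])
    exact step _ _ hadj (hw _ (by simp)) ⟨w, h1⟩ (ih refl step h1)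

/-- The first vertex of a walk in a set `X`. -/
theorem Conn.exists_first {H : SimpleGraph V} {W X : Set V} {a b : V} (h : Conn H W a b)
    (hb : b ∈ X) : ∃ s ∈ X, ∃ W' ⊆ W, Conn H W' a s ∧ (∀ z ∈ W', z ∈ X → z = s) ∧
      ∀ z ∈ W', z ∉ X → Conn H (W \ X) a z := by
  refine h.head_induction (P := fun a => ∃ s ∈ X, ∃ W' ⊆ W, Conn H W' a s ∧
      (∀ z ∈ W', z ∈ X → z = s) ∧ ∀ z ∈ W', z ∉ X → Conn H (W \ X) a z) (fun hbW => ?_)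
    (fun a c hac ha hcb ih => ?_)
  · refine ⟨b, hb, {b}, by simpa using hbW, Conn.refl rfl, by simp, ?_⟩
    rintro z rfl hz
    exact absurd hb hz
  · by_cases haX : a ∈ X
    · refine ⟨a, haX, {a}, by simpa using ha, Conn.refl rfl, by simp, ?_⟩
      rintro z rfl hz
      exact absurd haX hz
    · obtain ⟨s, hs, W', hW', hc, h1, h2⟩ := ih
      refine ⟨s, hs, insert a W', Set.insert_subset ha hW',
        Conn.cons hac (Set.mem_insert _ _) (hc.mono le_rfl (Set.subset_insert _ _)), ?_, ?_⟩
      · rintro z (rfl | hz) hzX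
        · exact absurd hzX haX
        · exact h1 z hz hzX
      · rintro z (rfl | hz) hzX
        · exact Conn.refl ⟨ha, haX⟩
        · exact Conn.cons hac ⟨ha, haX⟩ (h2 z hz hzX)

/-- Walks of `H` in terms of walks avoiding the edge `xy`. -/
theorem Conn.deleteEdge {H H' : SimpleGraph V} {x y : V}
    (hH' : ∀ a c, H.Adj a c → H'.Adj a c ∨ (a = x ∧ c = y) ∨ (a = y ∧ c = x)) {W : Set V}
    {a b : V} (h : Conn H W a b) : Conn H' W a b ∨ (Conn H' W a x ∧ Conn H' W y b) ∨
      (Conn H' W a y ∧ Conn H' W x b) := by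
  refine h.head_induction (P := fun a => Conn H' W a b ∨ (Conn H' W a x ∧ Conn H' W y b) ∨
      (Conn H' W a y ∧ Conn H' W x b)) (fun hb => Or.inl (Conn.refl hb))
    (fun a c hac ha _ ih => ?_)
  rcases hH' a c hac with h' | ⟨rfl, rfl⟩ | ⟨rfl, rfl⟩
  · rcases ih with h1 | ⟨h1, h2⟩ | ⟨h1, h2⟩
    · exact Or.inl (h1.cons h' ha)
    · exact Or.inr (Or.inl ⟨h1.cons h' ha, h2⟩)
    · exact Or.inr (Or.inr ⟨h1.cons h' ha, h2⟩)
  · rcases ih with h1 | ⟨h1, h2⟩ | ⟨h1, h2⟩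
    · exact Or.inr (Or.inl ⟨Conn.refl ha, h1⟩)
    · exact Or.inr (Or.inl ⟨Conn.refl ha, h2⟩)
    · exact Or.inl h2
  · rcases ih with h1 | ⟨h1, h2⟩ | ⟨h1, h2⟩
    · exact Or.inr (Or.inr ⟨Conn.refl ha, h1⟩)
    · exact Or.inl h2
    · exact Or.inr (Or.inr ⟨Conn.refl ha, h2⟩)

/-- `S` separates `A` from `B`. -/
def Sep (H : SimpleGraph V) (A B S : Set V) : Prop := ∀ a ∈ A, ∀ b ∈ B, ¬ Conn H Sᶜ a b

theorem Sep.symm {H : SimpleGraph V} {A B S : Set V} (h : Sep H A B S) : Sep H B A S :=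
  fun b hb a ha hc => h a ha b hb hc.symm

/-- There are `k` disjoint walks from `A` to `B`. -/
def Linkage (H : SimpleGraph V) (A B : Set V) (k : ℕ) : Prop :=
  ∃ (a b : Fin k → V) (W : Fin k → Set V), (∀ i, a i ∈ A) ∧ (∀ i, b i ∈ B) ∧
    (∀ i, Conn H (W i) (a i) (b i)) ∧ ∀ i j, i ≠ j → ∀ z, z ∈ W i → z ∉ W j

theorem Linkage.of_index {H : SimpleGraph V} {A B : Set V} {X : Finset V} {a b : V → V}
    {W : V → Set V} (ha : ∀ s ∈ X, a s ∈ A) (hb : ∀ s ∈ X, b s ∈ B)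
    (hc : ∀ s ∈ X, Conn H (W s) (a s) (b s))
    (hd : ∀ s ∈ X, ∀ t ∈ X, s ≠ t → ∀ z, z ∈ W s → z ∉ W t) : Linkage H A B X.card := by
  refine ⟨fun i => a (X.equivFin.symm i), fun i => b (X.equivFin.symm i),
    fun i => W (X.equivFin.symm i), fun i => ha _ (X.equivFin.symm i).2,
    fun i => hb _ (X.equivFin.symm i).2, fun i => hc _ (X.equivFin.symm i).2,
    fun i j hij => hd _ (X.equivFin.symm i).2 _ (X.equivFin.symm j).2 fun h => hij ?_⟩
  exact X.equivFin.symm.injective (Subtype.ext h)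

theorem Linkage.mono {H H' : SimpleGraph V} (hH : H ≤ H') {A B : Set V} {k : ℕ} :
    Linkage H A B k → Linkage H' A B k := by
  rintro ⟨a, b, W, h1, h2, h3, h4⟩
  exact ⟨a, b, W, h1, h2, fun i => (h3 i).mono hH subset_rfl, h4⟩

theorem Linkage.mono_card {H : SimpleGraph V} {A B : Set V} {k l : ℕ} (hkl : k ≤ l) :
    Linkage H A B l → Linkage H A B k := by
  rintro ⟨a, b, W, h1, h2, h3, h4⟩
  refine ⟨fun i => a (Fin.castLE hkl i), fun i => b (Fin.castLE hkl i),
    fun i => W (Fin.castLE hkl i), fun i => h1 _, fun i => h2 _, fun i => h3 _,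
    fun i j hij => h4 _ _ fun h => hij (Fin.castLE_injective hkl h)⟩

/-- A linkage onto a set of the same size, indexed by its end-vertices and shrunk. -/
theorem Linkage.exists_index {H : SimpleGraph V} {A : Set V} {X : Finset V}
    (h : Linkage H A X X.card) : ∃ (a : V → V) (W : V → Set V), ∀ s ∈ X, a s ∈ A ∧
      Conn H (W s) (a s) s ∧ (∀ z ∈ W s, z ∈ X → z = s) ∧
      (∀ z ∈ W s, z ∉ X → Conn H (X : Set V)ᶜ (a s) z) ∧
      ∀ t ∈ X, s ≠ t → ∀ z, z ∈ W s → z ∉ W t := by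
  classical
  rcases X.eq_empty_or_nonempty with rfl | hX
  · exact ⟨id, fun _ => ∅, by simp⟩
  have : Nonempty (Fin X.card) := ⟨⟨0, hX.card_pos⟩⟩
  obtain ⟨a, b, W, h1, h2, h3, h4⟩ := h
  have hinj : Function.Injective fun i => (⟨b i, h2 i⟩ : X) := by
    intro i j hij
    by_contra hne
    have h5 : b i = b j := congrArg Subtype.val hij
    exact h4 i j hne (b i) (h3 i).right_mem (h5 ▸ (h3 j).right_mem)
  have hbij := (Fintype.bijective_iff_injective_and_card _).2 ⟨hinj, by simp⟩
  have hb : ∀ s ∈ X, ∃ i, b i = s := fun s hs => by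
    obtain ⟨i, hi⟩ := hbij.2 ⟨s, hs⟩
    exact ⟨i, congrArg Subtype.val hi⟩
  have key : ∀ i, ∃ W' ⊆ W i, Conn H W' (a i) (b i) ∧ (∀ z ∈ W', z ∈ X → z = b i) ∧
      ∀ z ∈ W', z ∉ X → Conn H (X : Set V)ᶜ (a i) z := by
    intro i
    obtain ⟨s, hs, W', hW', hc, h5, h6⟩ := (h3 i).exists_first (X := X) (h2 i)
    obtain ⟨j, rfl⟩ := hb s hs
    have hij : i = j := by
      by_contra hne
      exact h4 i j hne (b j) (hW' hc.right_mem) (h3 j).right_mem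
    subst hij
    exact ⟨W', hW', hc, h5, fun z hz hzX =>
      (h6 z hz hzX).mono le_rfl (fun _ hw => hw.2)⟩
  choose W' hW' hc h5 h6 using key
  choose! i hi using hb
  refine ⟨a ∘ i, W' ∘ i, fun s hs => ⟨h1 _, ?_, ?_, h6 _, ?_⟩⟩
  · have := hc (i s)
    rwa [hi s hs] at this
  · intro z hz hzX
    rw [h5 _ z hz hzX, hi s hs]
  · intro t ht hst z hz hz'
    refine h4 (i s) (i t) (fun h => hst ?_) z (hW' _ hz) (hW' _ hz')
    rw [← hi s hs, ← hi t ht, h]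

theorem Sep.of_deleteEdge {H H' : SimpleGraph V} {x y : V}
    (hH' : ∀ a c, H.Adj a c → H'.Adj a c ∨ (a = x ∧ c = y) ∨ (a = y ∧ c = x)) {A B S : Set V}
    (hS : Sep H' A B S) (hx : x ∉ S) (hxS : Sep H A B (insert x S)) {b₀ : V} (hb₀ : b₀ ∈ B)
    (hyb : Conn H' Sᶜ y b₀) {T : Set V} (hT : Sep H' A (insert x S) T) : Sep H A B T := by
  intro a ha b hb hc
  have hmeet : ∃ c ∈ insert x S, Conn H Tᶜ a c := by
    by_contra hno
    push Not at hno
    obtain ⟨w, hw⟩ := hc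
    refine hxS a ha b hb ⟨w, fun z hz hzX => ?_⟩
    classical
    refine hno z hzX ⟨w.takeUntil z hz, fun y hy => hw y ?_⟩
    exact w.support_takeUntil_subset_support hz hy
  obtain ⟨c, hcX, hc⟩ := hmeet
  obtain ⟨s, hs, W', hW', hc', h5, -⟩ := hc.exists_first hcX
  rcases hc'.deleteEdge hH' with h | ⟨h, -⟩ | ⟨h, h'⟩
  · exact hT a ha s hs (h.mono le_rfl hW')
  · exact hT a ha x (Set.mem_insert _ _) (h.mono le_rfl hW')
  · have hsx : x = s := h5 x h'.left_mem (Set.mem_insert _ _)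
    have hWS : W' ⊆ Sᶜ := fun z hz hzS => by
      have := h5 z hz (Set.mem_insert_of_mem _ hzS)
      exact hx (hsx ▸ this ▸ hzS)
    exact hS a ha b₀ hb₀ ((h.mono le_rfl hWS).trans hyb)

theorem Linkage.of_deleteEdge [DecidableEq V] {H H' : SimpleGraph V} (hle : H' ≤ H) {x y : V}
    (hxy : H.Adj x y)
    (hH' : ∀ a c, H.Adj a c → H'.Adj a c ∨ (a = x ∧ c = y) ∨ (a = y ∧ c = x)) {A B : Set V}
    {S : Finset V} (hS : Sep H' A B S) (hx : x ∉ S) (hy : y ∉ S)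
    (ih : ∀ A B : Set V, (∀ T : Finset V, Sep H' A B T → S.card + 1 ≤ T.card) →
      Linkage H' A B (S.card + 1))
    (hmin : ∀ T : Finset V, Sep H A B T → S.card + 1 ≤ T.card)
    (hxS : Sep H A B (insert x S : Finset V)) (hyS : Sep H A B (insert y S : Finset V))
    {a₀ b₀ : V} (ha₀ : a₀ ∈ A) (hb₀ : b₀ ∈ B) (hxa : Conn H' (S : Set V)ᶜ a₀ x)
    (hyb : Conn H' (S : Set V)ᶜ y b₀) : Linkage H A B (S.card + 1) := by
  have hcx : (insert x S).card = S.card + 1 := Finset.card_insert_of_notMem hx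
  have hcy : (insert y S).card = S.card + 1 := Finset.card_insert_of_notMem hy
  have hH'' : ∀ a c, H.Adj a c → H'.Adj a c ∨ (a = y ∧ c = x) ∨ (a = x ∧ c = y) := by
    intro a c h
    rcases hH' a c h with h | h | h
    · exact Or.inl h
    · exact Or.inr (Or.inr h)
    · exact Or.inr (Or.inl h)
  have l1 : Linkage H' A (insert x S : Finset V) (insert x S).card := by
    rw [hcx]
    refine ih _ _ fun T hT => hmin T ?_
    rw [Finset.coe_insert] at hT hxS
    exact Sep.of_deleteEdge hH' hS (by simpa using hx) hxS hb₀ hyb hT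
  have l2 : Linkage H' B (insert y S : Finset V) (insert y S).card := by
    rw [hcy]
    refine ih _ _ fun T hT => hmin T ?_
    rw [Finset.coe_insert] at hT hyS
    exact (Sep.of_deleteEdge hH'' hS.symm (by simpa using hy) hyS.symm ha₀ hxa.symm hT).symm
  obtain ⟨a, W, h1⟩ := l1.exists_index
  obtain ⟨b, U, h2⟩ := l2.exists_index
  set σ : V → V := fun s => if s = x then y else s with hσ
  have hσY : ∀ s ∈ insert x S, σ s ∈ insert y S := by
    intro s hs
    simp only [hσ]
    split_ifs with h
    · simp
    · exact Finset.mem_insert_of_mem ((Finset.mem_insert.1 hs).resolve_left h)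
  have hσi : ∀ s ∈ insert x S, ∀ t ∈ insert x S, s ≠ t → σ s ≠ σ t := by
    intro s hs t ht hst h
    simp only [hσ] at h
    split_ifs at h with h3 h4 h4
    · exact hst (h3.trans h4.symm)
    · exact hy (h ▸ (Finset.mem_insert.1 ht).resolve_left h4)
    · exact hy (h ▸ (Finset.mem_insert.1 hs).resolve_left h3)
    · exact hst h
  have hWA : ∀ s ∈ insert x S, ∀ z ∈ W s, z ∉ S → Conn H' (S : Set V)ᶜ (a s) z := by
    intro s hs z hz hzS
    obtain ⟨-, h3, h4, h5, -⟩ := h1 s hs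
    by_cases hzx : z = x
    · subst hzx
      have hzs := h4 z hz (Finset.mem_insert_self _ _)
      subst hzs
      refine h3.mono le_rfl fun w hw hwS => hzS ?_
      rw [← h4 w hw (Finset.mem_insert_of_mem hwS)]
      exact hwS
    · refine (h5 z hz (by simp [hzx, hzS])).mono le_rfl ?_
      rw [Finset.coe_insert]
      exact Set.compl_subset_compl.2 (Set.subset_insert _ _)
  have hUB : ∀ s ∈ insert y S, ∀ z ∈ U s, z ∉ S → Conn H' (S : Set V)ᶜ (b s) z := by
    intro s hs z hz hzS
    obtain ⟨-, h3, h4, h5, -⟩ := h2 s hs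
    by_cases hzx : z = y
    · subst hzx
      have hzs := h4 z hz (Finset.mem_insert_self _ _)
      subst hzs
      refine h3.mono le_rfl fun w hw hwS => hzS ?_
      rw [← h4 w hw (Finset.mem_insert_of_mem hwS)]
      exact hwS
    · refine (h5 z hz (by simp [hzx, hzS])).mono le_rfl ?_
      rw [Finset.coe_insert]
      exact Set.compl_subset_compl.2 (Set.subset_insert _ _)
  have hWU : ∀ s ∈ insert x S, ∀ t ∈ insert x S, s ≠ t → ∀ z, z ∈ W s → z ∉ U (σ t) := by
    intro s hs t ht hst z hz hz'
    by_cases hzS : z ∈ S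
    · have e1 := (h1 s hs).2.2.1 z hz (Finset.mem_insert_of_mem hzS)
      have e2 := (h2 _ (hσY t ht)).2.2.1 z hz' (Finset.mem_insert_of_mem hzS)
      simp only [hσ] at e2
      split_ifs at e2 with h3
      · exact hy (e2 ▸ hzS)
      · exact hst (e1.symm.trans e2)
    · exact hS _ (h1 s hs).1 _ (h2 _ (hσY t ht)).1
        ((hWA s hs z hz hzS).trans (hUB _ (hσY t ht) z hz' hzS).symm)
  rw [← hcx]
  refine Linkage.of_index (a := a) (b := fun s => b (σ s)) (W := fun s => W s ∪ U (σ s))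
    (fun s hs => (h1 s hs).1) (fun s hs => (h2 _ (hσY s hs)).1) (fun s hs => ?_) ?_
  · have c1 : Conn H (W s ∪ U (σ s)) (a s) s := (h1 s hs).2.1.mono hle Set.subset_union_left
    have c2 : Conn H (W s ∪ U (σ s)) (σ s) (b (σ s)) :=
      ((h2 _ (hσY s hs)).2.1.mono hle Set.subset_union_right).symm
    by_cases hsx : s = x
    · have hσs : σ s = y := by simp [hσ, hsx]
      have : H.Adj s (σ s) := by
        rw [hσs, hsx]
        exact hxy
      exact c1.trans (c2.cons this c1.right_mem)
    · have hσs : σ s = s := by simp [hσ, hsx]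
      rw [hσs] at c2 c1 ⊢
      exact c1.trans c2
  · rintro s hs t ht hst z (hz | hz) (hw | hw)
    · exact (h1 s hs).2.2.2.2 t ht hst z hz hw
    · exact hWU s hs t ht hst z hz hw
    · exact hWU t ht s hs hst.symm z hw hz
    · exact (h2 _ (hσY s hs)).2.2.2.2 _ (hσY t ht) (hσi s hs t ht hst) z hz hw

/-- Menger's theorem. -/
theorem linkage_of_forall_sep [Fintype V] (H : SimpleGraph V) (A B : Set V) (k : ℕ)
    (hk : ∀ S : Finset V, Sep H A B S → k ≤ S.card) : Linkage H A B k := by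
  classical
  induction hn : H.edgeSet.ncard using Nat.strong_induction_on generalizing H A B k with
  | _ n ih =>
  by_cases hne : H = ⊥
  · subst hne
    have hsep : Sep ⊥ A B ((A ∩ B).toFinset : Finset V) := by
      rintro a ha b hb ⟨w, hw⟩
      cases w with
      | nil => exact hw a (by simp) (by simpa using ⟨ha, hb⟩)
      | cons h _ => exact h
    refine Linkage.mono_card (hk _ hsep) (Linkage.of_index (a := id) (b := id)
      (W := fun s => {s}) ?_ ?_ (fun s _ => Conn.refl rfl) ?_)
    · intro s hs
      exact (by simpa using hs : s ∈ A ∧ s ∈ B).1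
    · intro s hs
      exact (by simpa using hs : s ∈ A ∧ s ∈ B).2
    · rintro s - t - hst z rfl hz
      exact hst hz
  · obtain ⟨x, y, hxy⟩ := SimpleGraph.ne_bot_iff_exists_adj.1 hne
    set H' := H.deleteEdges {s(x, y)} with hH'def
    have hle : H' ≤ H := SimpleGraph.deleteEdges_le _
    have hH' : ∀ a c, H.Adj a c → H'.Adj a c ∨ (a = x ∧ c = y) ∨ (a = y ∧ c = x) := by
      intro a c hac
      rw [hH'def, SimpleGraph.deleteEdges_adj, Set.mem_singleton_iff, Sym2.eq_iff]
      tauto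
    have hlt : H'.edgeSet.ncard < n := by
      rw [← hn]
      refine Set.ncard_lt_ncard (SimpleGraph.edgeSet_ssubset_edgeSet.2
        (lt_of_le_of_ne hle fun h => ?_))
      have : H'.Adj x y := h ▸ hxy
      rw [hH'def, SimpleGraph.deleteEdges_adj] at this
      exact this.2 rfl
    by_cases hall : ∀ S : Finset V, Sep H' A B S → k ≤ S.card
    · exact (ih _ hlt H' A B k hall rfl).mono hle
    · push Not at hall
      obtain ⟨S, hS, hSk⟩ := hall
      have hins : ∀ z, (z = x ∨ z = y) → Sep H A B (insert z S : Finset V) := by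
        intro z hz a ha b hb hc
        have hmem : z ∉ ((insert z S : Finset V) : Set V)ᶜ := fun h => h (by simp)
        have hsub : ((insert z S : Finset V) : Set V)ᶜ ⊆ (S : Set V)ᶜ := by
          rw [Finset.coe_insert]
          exact Set.compl_subset_compl.2 (Set.subset_insert _ _)
        rcases hc.deleteEdge hH' with h | ⟨h, h'⟩ | ⟨h, h'⟩
        · exact hS a ha b hb (h.mono le_rfl hsub)
        · rcases hz with rfl | rfl
          · exact hmem h.right_mem
          · exact hmem h'.left_mem
        · rcases hz with rfl | rfl
          · exact hmem h'.left_mem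
          · exact hmem h.right_mem
      have hcard : ∀ z, (z = x ∨ z = y) → z ∉ S ∧ k = S.card + 1 := by
        intro z hz
        have h1 := hk _ (hins z hz)
        have hzS : z ∉ S := fun hzS => by
          rw [Finset.insert_eq_of_mem hzS] at h1
          omega
        rw [Finset.card_insert_of_notMem hzS] at h1
        exact ⟨hzS, by omega⟩
      obtain ⟨hx, hkS⟩ := hcard x (Or.inl rfl)
      obtain ⟨hy, -⟩ := hcard y (Or.inr rfl)
      subst hkS
      have hnot : ¬ Sep H A B S := fun h => by
        have := hk S h
        omega
      simp only [Sep, not_forall, not_not] at hnot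
      obtain ⟨a₀, ha₀, b₀, hb₀, hc⟩ := hnot
      have ih' : ∀ A B : Set V, (∀ T : Finset V, Sep H' A B T → S.card + 1 ≤ T.card) →
          Linkage H' A B (S.card + 1) := fun A B h => ih _ hlt H' A B _ h rfl
      rcases hc.deleteEdge hH' with h | ⟨h, h'⟩ | ⟨h, h'⟩
      · exact absurd h (hS a₀ ha₀ b₀ hb₀)
      · exact Linkage.of_deleteEdge hle hxy hH' hS hx hy ih' hk (hins x (Or.inl rfl))
          (hins y (Or.inr rfl)) ha₀ hb₀ h h'
      · refine Linkage.of_deleteEdge hle hxy.symm (fun a c hac => ?_) hS hy hx ih' hk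
          (hins y (Or.inr rfl)) (hins x (Or.inl rfl)) ha₀ hb₀ h h'
        rcases hH' a c hac with h | h | h
        · exact Or.inl h
        · exact Or.inr (Or.inr h)
        · exact Or.inr (Or.inl h)

/-- Menger's theorem for a pair of non-adjacent vertices. -/
theorem internallyDisjointPaths_or_cut [Fintype V] (H : SimpleGraph V) {u v : V} (huv : u ≠ v)
    (hadj : ¬ H.Adj u v) (k : ℕ) : InternallyDisjointPaths H u v k ∨
      ∃ S : Finset V, S.card < k ∧ u ∉ S ∧ v ∉ S ∧ ¬ Conn H (S : Set V)ᶜ u v := by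
  classical
  by_cases hall : ∀ S : Finset V, Sep H {a | H.Adj u a} {b | H.Adj b v} S → k ≤ S.card
  · left
    obtain ⟨a, b, W, ha, hb, hc, hd⟩ := linkage_of_forall_sep H _ _ k hall
    have hconn : ∀ i, Conn H (W i ∪ {u, v}) u v := by
      intro i
      have h1 : Conn H (W i ∪ {u, v}) u (b i) :=
        ((hc i).mono le_rfl Set.subset_union_left).cons (ha i) (by simp)
      have h2 : Conn H (W i ∪ {u, v}) (b i) v :=
        (Conn.refl (by simp)).cons (hb i) h1.right_mem
      exact h1.trans h2
    choose w hw using hconn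
    refine ⟨fun i => (w i).toPath, fun i => (w i).toPath.2, fun i j hij z hz hz' => ?_⟩
    have h1 := hw i z ((w i).support_toPath_subset_support hz)
    have h2 := hw j z ((w j).support_toPath_subset_support hz')
    rcases h1 with h1 | h1
    · rcases h2 with h2 | h2
      · exact absurd h2 (hd i j hij z h1)
      · simpa using h2
    · simpa using h1
  · right
    push Not at hall
    obtain ⟨S, hS, hSk⟩ := hall
    refine ⟨S \ {u, v}, (Finset.card_le_card Finset.sdiff_subset).trans_lt hSk, by simp, by simp,
      ?_⟩
    rintro ⟨w, hw⟩
    have hP := w.toPath.2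
    have hPs : ∀ z ∈ (w.toPath : H.Walk u v).support, z ∉ S \ {u, v} := fun z hz =>
      hw z (w.support_toPath_subset_support hz)
    generalize (w.toPath : H.Walk u v) = P at hP hPs
    cases P with
    | nil => exact huv rfl
    | @cons _ a _ h p =>
      rw [SimpleGraph.Walk.cons_isPath_iff] at hP
      have hq := hP.1.reverse
      have hqs : ∀ z ∈ p.reverse.support, z ∉ S \ {u, v} ∧ z ≠ u := fun z hz => by
        rw [SimpleGraph.Walk.support_reverse, List.mem_reverse] at hz
        exact ⟨hPs z (by simp [hz]), fun h' => hP.2 (h' ▸ hz)⟩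
      generalize p.reverse = q at hq hqs
      cases q with
      | nil => exact hadj h
      | @cons _ b _ h' q =>
        rw [SimpleGraph.Walk.cons_isPath_iff] at hq
        refine hS a h b h'.symm (Conn.symm ⟨q, fun z hz hzS => ?_⟩)
        obtain ⟨h1, h2⟩ := hqs z (by simp [hz])
        have h3 : z ≠ v := fun h'' => hq.2 (h'' ▸ hz)
        exact h1 (by simpa [h2, h3] using hzS)

end Menger

section Support

/-- A circuit meeting both parts of a union makes their spans intersect nontrivially. -/
theorem not_disjoint_span_of_isCircuit {ι M : Type*} [Finite ι] [AddCommGroup M] [Module ℝ M]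
    {f : ι → M} {C A B : Set ι} (hC : (vecMatroid f).IsCircuit C) (hCs : C ⊆ A ∪ B)
    (hA : (C ∩ A).Nonempty) (hB : ¬ C ⊆ A)
    (hAB : Disjoint (Submodule.span ℝ (f '' A)) (Submodule.span ℝ (f '' B))) : False := by
  obtain ⟨a, haC, haA⟩ := hA
  have h1 : a ∈ (vecMatroid f).closure (C \ {a}) := hC.mem_closure_sdiff_singleton_of_mem haC
  rw [mem_closure_vecMatroid] at h1
  have hsub : f '' (C \ {a}) ⊆ f '' ((C ∩ A) \ {a}) ∪ f '' B := by
    rintro _ ⟨e, he, rfl⟩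
    rcases hCs he.1 with h | h
    · exact Or.inl ⟨e, ⟨⟨he.1, h⟩, he.2⟩, rfl⟩
    · exact Or.inr ⟨e, h, rfl⟩
  have h2 := Submodule.span_mono (R := ℝ) hsub h1
  rw [Submodule.span_union, Submodule.mem_sup] at h2
  obtain ⟨α, hα, β, hβ, hαβ⟩ := h2
  have hle : Submodule.span ℝ (f '' ((C ∩ A) \ {a})) ≤ Submodule.span ℝ (f '' A) :=
    Submodule.span_mono (Set.image_mono fun e he => he.1.2)
  have hβA : β ∈ Submodule.span ℝ (f '' A) := by
    rw [← sub_eq_iff_eq_add'.2 hαβ.symm]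
    exact Submodule.sub_mem _ (Submodule.subset_span ⟨a, haA, rfl⟩) (hle hα)
  have hβ0 := Submodule.disjoint_def.1 hAB β hβA hβ
  rw [hβ0, add_zero] at hαβ
  have h3 : a ∈ (vecMatroid f).closure ((C ∩ A) \ {a}) := by
    rw [mem_closure_vecMatroid, ← hαβ]
    exact hα
  have h4 : C ∩ A ⊂ C := ⟨Set.inter_subset_left, fun h => hB fun e he => (h he).2⟩
  exact ((hC.ssubset_indep h4).notMem_closure_sdiff_of_mem ⟨haC, haA⟩) h3

variable [DecidableEq V]

theorem apply_eq_zero_of_mem_span {p : V → Fin 2 → ℝ} {A : Set (Sym2 V)} {r : V × Fin 2 → ℝ}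
    (hr : r ∈ Submodule.span ℝ (row p '' A)) {z : V} (hz : z ∉ vertexSpan A) (i : Fin 2) :
    r (z, i) = 0 := by
  have : Submodule.span ℝ (row p '' A) ≤
      LinearMap.ker (LinearMap.proj (R := ℝ) (φ := fun _ : V × Fin 2 => ℝ) (z, i)) := by
    rw [Submodule.span_le]
    rintro _ ⟨e, he, rfl⟩
    exact row_apply_of_notMem p (fun h => hz ⟨e, he, h⟩) i
  exact this hr

variable [Fintype V]

theorem dot_eq_zero_of_mem_span {p y : V → Fin 2 → ℝ}
    (hy : ∀ a b, ∑ i, (p a i - p b i) * (y a i - y b i) = 0) {X : Set (Sym2 V)}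
    {r : V × Fin 2 → ℝ} (hr : r ∈ Submodule.span ℝ (row p '' X)) : dot y r = 0 := by
  have : Submodule.span ℝ (row p '' X) ≤ LinearMap.ker (dot y) := by
    rw [Submodule.span_le]
    rintro _ ⟨e, -, rfl⟩
    rw [SetLike.mem_coe, LinearMap.mem_ker]
    induction e with
    | _ a b => rw [dot_row, hy]
  exact this hr

/-- A combination of rows supported on two vertices is a multiple of their row. -/
theorem Generic.mem_span_row_of_support {p : V → Fin 2 → ℝ} (hp : Generic p) {X : Set (Sym2 V)}
    {r : V × Fin 2 → ℝ} (hr : r ∈ Submodule.span ℝ (row p '' X)) {x y : V}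
    (hs : ∀ z i, z ≠ x → z ≠ y → r (z, i) = 0) : r ∈ Submodule.span ℝ {row p s(x, y)} := by
  have hdot : ∀ m : V → Fin 2 → ℝ, dot m r = ∑ z, ∑ i, r (z, i) * m z i := fun m => by
    simp only [dot, LinearMap.coe_mk, AddHom.coe_mk, Fintype.sum_prod_type]
  have htr : ∀ i : Fin 2, ∑ z, r (z, i) = 0 := by
    intro i
    have := dot_eq_zero_of_mem_span (y := fun _ j => if j = i then 1 else 0) (by simp) hr
    rw [hdot] at this
    simpa using this
  have hrot : ∑ z, (r (z, 0) * p z 1 - r (z, 1) * p z 0) = 0 := by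
    have := dot_eq_zero_of_mem_span (y := fun a j => if j = 0 then p a 1 else -p a 0) (by
      intro a b
      simp only [Fin.sum_univ_two, if_true, one_ne_zero, if_false]
      ring) hr
    rw [hdot] at this
    simpa [Fin.sum_univ_two, sub_eq_add_neg] using this
  by_cases hxy : x = y
  · subst hxy
    have h0 : r = 0 := by
      ext ⟨z, i⟩
      by_cases hz : z = x
      · subst hz
        have := htr i
        rwa [Finset.sum_eq_single z (fun b _ hb => hs b i hb hb) (by simp)] at this
      · exact hs z i hz hz
    rw [h0]
    exact Submodule.zero_mem _
  · have hpair : ∀ F : V → ℝ, (∀ z, z ≠ x → z ≠ y → F z = 0) → ∑ z, F z = F x + F y := by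
      intro F hF
      rw [← Finset.sum_pair hxy]
      refine (Finset.sum_subset (Finset.subset_univ _) fun z _ hz => ?_).symm
      rw [Finset.mem_insert, Finset.mem_singleton, not_or] at hz
      exact hF z hz.1 hz.2
    have e1 : ∀ i, r (x, i) + r (y, i) = 0 := fun i => by
      rw [← hpair (fun z => r (z, i)) (fun z h1 h2 => hs z i h1 h2)]
      exact htr i
    have e2 : (r (x, 0) * p x 1 - r (x, 1) * p x 0) + (r (y, 0) * p y 1 - r (y, 1) * p y 0) = 0 := by
      rw [← hpair (fun z => r (z, 0) * p z 1 - r (z, 1) * p z 0)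
        (fun z h1 h2 => by rw [hs z 0 h1 h2, hs z 1 h1 h2]; ring)]
      exact hrot
    have hne : p x 0 - p y 0 ≠ 0 := by
      have := hp.flat_x_ne ∅ hxy
      rwa [flat_empty] at this
    have e3 : r (x, 0) * (p x 1 - p y 1) = r (x, 1) * (p x 0 - p y 0) := by
      linear_combination e2 - p y 1 * e1 0 + p y 0 * e1 1
    refine Submodule.mem_span_singleton.2 ⟨r (x, 0) / (p x 0 - p y 0), ?_⟩
    ext ⟨z, i⟩
    rw [Pi.smul_apply, smul_eq_mul, row_apply]
    by_cases hzx : z = x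
    · subst hzx
      simp only [if_true, if_neg hxy, sub_zero, mul_one]
      fin_cases i
      · exact div_mul_cancel₀ _ hne
      · change r (z, 0) / (p z 0 - p y 0) * (p z 1 - p y 1) = r (z, 1)
        rw [div_mul_eq_mul_div, e3, mul_div_cancel_right₀ _ hne]
    by_cases hzy : z = y
    · subst hzy
      simp only [if_true, if_neg hzx]
      fin_cases i
      · change r (x, 0) / (p x 0 - p z 0) * ((p x 0 - p z 0) * (0 - 1)) = r (z, 0)
        rw [← mul_assoc, div_mul_cancel₀ _ hne]
        linear_combination -(e1 0)
      · change r (x, 0) / (p x 0 - p z 0) * ((p x 1 - p z 1) * (0 - 1)) = r (z, 1)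
        rw [← mul_assoc, div_mul_eq_mul_div, e3, mul_div_cancel_right₀ _ hne]
        linear_combination -(e1 1)
    · simp only [if_neg hzx, if_neg hzy, sub_zero, mul_zero]
      exact (hs z i hzx hzy).symm

/-- A row spanned by the rows of an edge set has its endpoints covered by that set. -/
theorem Generic.left_mem_vertexSpan {p : V → Fin 2 → ℝ} (hp : Generic p) {A : Set (Sym2 V)}
    {x y : V} (hxy : x ≠ y) (hA : row p s(x, y) ∈ Submodule.span ℝ (row p '' A)) :
    x ∈ vertexSpan A := by
  by_contra hx
  have h1 := apply_eq_zero_of_mem_span hA hx 0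
  have h2 := hp.flat_x_ne ∅ hxy
  rw [flat_empty] at h2
  rw [row_apply] at h1
  simp only [if_true, if_neg hxy, sub_zero, mul_one] at h1
  exact h2 h1

/-- If an edge set is cut along two vertices `x`, `y` into two parts whose row spaces meet
nontrivially, then the row of `xy` spans the intersection, and each pair of vertices of a part
that is rigid in the union is rigid in that part. -/
theorem Generic.rigid_of_cut {p : V → Fin 2 → ℝ} (hp : Generic p) {A B : Set (Sym2 V)} {x y : V}
    (hcut : ∀ z ∈ vertexSpan A, z ∈ vertexSpan B → z = x ∨ z = y)
    (hrig : ∀ z ∈ vertexSpan A, ∀ z' ∈ vertexSpan A,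
      row p s(z, z') ∈ Submodule.span ℝ (row p '' (A ∪ B)))
    (hnd : ¬ Disjoint (Submodule.span ℝ (row p '' A)) (Submodule.span ℝ (row p '' B))) :
    x ≠ y ∧ x ∈ vertexSpan A ∧ y ∈ vertexSpan A ∧
      row p s(x, y) ∈ Submodule.span ℝ (row p '' A) ∧
      row p s(x, y) ∈ Submodule.span ℝ (row p '' B) ∧
      (∀ r ∈ Submodule.span ℝ (row p '' A), r ∈ Submodule.span ℝ (row p '' B) →
        r ∈ Submodule.span ℝ {row p s(x, y)}) ∧
      ∀ z ∈ vertexSpan A, ∀ z' ∈ vertexSpan A,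
        row p s(z, z') ∈ Submodule.span ℝ (row p '' A) := by
  have hinter : ∀ r ∈ Submodule.span ℝ (row p '' A), r ∈ Submodule.span ℝ (row p '' B) →
        r ∈ Submodule.span ℝ {row p s(x, y)} := by
    intro r hA hB
    refine hp.mem_span_row_of_support hA fun z i hzx hzy => ?_
    by_cases hz : z ∈ vertexSpan A
    · exact apply_eq_zero_of_mem_span hB (fun hz' => (hcut z hz hz').elim hzx hzy) i
    · exact apply_eq_zero_of_mem_span hA hz i
  rw [Submodule.disjoint_def] at hnd
  push Not at hnd
  obtain ⟨r, hrA, hrB, hr0⟩ := hnd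
  obtain ⟨c, hc⟩ := Submodule.mem_span_singleton.1 (hinter r hrA hrB)
  have hc0 : c ≠ 0 := by
    rintro rfl
    rw [zero_smul] at hc
    exact hr0 hc.symm
  have hrow : row p s(x, y) = c⁻¹ • r := by
    rw [← hc, smul_smul, inv_mul_cancel₀ hc0, one_smul]
  have hxy : x ≠ y := by
    rintro rfl
    rw [row_diag, smul_zero] at hc
    exact hr0 hc.symm
  have hA : row p s(x, y) ∈ Submodule.span ℝ (row p '' A) :=
    hrow ▸ Submodule.smul_mem _ _ hrA
  have hB : row p s(x, y) ∈ Submodule.span ℝ (row p '' B) :=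
    hrow ▸ Submodule.smul_mem _ _ hrB
  refine ⟨hxy, hp.left_mem_vertexSpan hxy hA,
    hp.left_mem_vertexSpan hxy.symm (Sym2.eq_swap (a := x) ▸ hA), hA, hB, hinter, ?_⟩
  · intro z hz z' hz'
    have h1 := hrig z hz z' hz'
    rw [Set.image_union, Submodule.span_union, Submodule.mem_sup] at h1
    obtain ⟨α, hα, β, hβ, hαβ⟩ := h1
    have h2 : β ∈ Submodule.span ℝ {row p s(x, y)} := by
      refine hp.mem_span_row_of_support hβ fun w i hwx hwy => ?_
      by_cases hw : w ∈ vertexSpan A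
      · exact apply_eq_zero_of_mem_span hβ (fun hw' => (hcut w hw hw').elim hwx hwy) i
      · have h3 : β = row p s(z, z') - α := (sub_eq_iff_eq_add'.2 hαβ.symm).symm
        have h4 : w ∉ s(z, z') := by
          rw [Sym2.mem_iff]
          rintro (rfl | rfl)
          · exact hw hz
          · exact hw hz'
        rw [h3, Pi.sub_apply, apply_eq_zero_of_mem_span hα hw i, row_apply_of_notMem p h4,
          sub_zero]
    rw [← hαβ]
    refine Submodule.add_mem _ hα ?_
    exact (Submodule.span_le.2 (Set.singleton_subset_iff.2 hA)) h2

end Support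

/-- A labelling of `S` gives a grouping with the same classes, in which a given vertex `x`
represents its class. -/
theorem exists_grouping {α : Type*} (S : Set V) (ℓ : V → α) (x : V) :
    ∃ g : V → V, Grouping S g ∧ (∀ a ∈ S, ∀ b ∈ S, g a = g b ↔ ℓ a = ℓ b) ∧
      (x ∈ S → ∀ t ∈ S, ℓ t = ℓ x → g t = x) := by
  classical
  let rep : α → V := fun l =>
    if x ∈ S ∧ ℓ x = l then x else if h : ∃ t ∈ S, ℓ t = l then h.choose else x
  have hrep : ∀ t ∈ S, rep (ℓ t) ∈ S ∧ ℓ (rep (ℓ t)) = ℓ t := by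
    intro t ht
    by_cases h : x ∈ S ∧ ℓ x = ℓ t
    · simp only [rep, if_pos h]
      exact h
    · have h' : ∃ s ∈ S, ℓ s = ℓ t := ⟨t, ht, rfl⟩
      simp only [rep, if_neg h, dif_pos h']
      exact h'.choose_spec
  refine ⟨fun t => if t ∈ S then rep (ℓ t) else t, ⟨fun a => ?_, fun a ha => if_neg ha,
    fun a ha => ?_⟩, fun a ha b hb => ?_, fun hx t ht h => ?_⟩
  · by_cases ha : a ∈ S
    · simp only [if_pos ha, if_pos (hrep a ha).1, (hrep a ha).2]
    · simp only [if_neg ha]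
  · simp only [if_pos ha]
    exact (hrep a ha).1
  · simp only [if_pos ha, if_pos hb]
    exact ⟨fun h => by rw [← (hrep a ha).2, h, (hrep b hb).2], fun h => by rw [h]⟩
  · simp only [if_pos ht, h]
    exact if_pos ⟨hx, rfl⟩

section Assembly

variable [DecidableEq V] [Fintype V] {G : SimpleGraph V} {p : V → Fin 2 → ℝ}

/-- The sets `comp G e \ B`, for the components at `u`, are rigid and avoid `v`. If the span of
their union meets the span of the rest only in the span of `Y`, then `{u,v}` is not globally
linked. -/
theorem not_globallyLinked_of_components {u v : V} (huv : v ≠ u) (hp : Generic p)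
    {B D Y : Set (Sym2 V)} {x : V}
    (hD : D = {e | e ∈ G.edgeSet ∧ u ∈ vertexSpan (comp G e)} \ B)
    (hBu : ∀ e ∈ B, u ∉ e) (hDv : ∀ e ∈ D, v ∉ e)
    (hu : ∀ e ∈ D, u ∈ vertexSpan (comp G e \ B))
    (hrig : ∀ e ∈ D, ∀ z ∈ vertexSpan (comp G e \ B), ∀ z' ∈ vertexSpan (comp G e \ B),
      row p s(z, z') ∈ Submodule.span ℝ (row p '' (comp G e \ B)))
    (hY : ∀ k ∈ Y, ∃ y, k = s(y, x) ∧ y ≠ x ∧ y ≠ u ∧ x ≠ u ∧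
      ∃ e ∈ D, y ∈ vertexSpan (comp G e \ B) ∧ x ∈ vertexSpan (comp G e \ B))
    (hspan : ∀ r ∈ Submodule.span ℝ (row p '' D),
      r ∈ Submodule.span ℝ (row p '' ((G.edgeSet \ D) ∪ Y)) → r ∈ Submodule.span ℝ (row p '' Y)) :
    ¬ GloballyLinked 2 G u v := by
  have hDE : ∀ e ∈ D, e ∈ G.edgeSet := fun e he => by
    rw [hD] at he
    exact he.1.1
  have hDu : ∀ e ∈ D, u ∈ vertexSpan (comp G e) := fun e he => by
    rw [hD] at he
    exact he.1.2
  have hDB : ∀ e ∈ D, e ∉ B := fun e he => by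
    rw [hD] at he
    exact he.2
  have hKD : ∀ e ∈ D, comp G e \ B ⊆ D := by
    intro e he f hf
    have := hp.comp_eq (hDE e he) hf.1
    rw [hD]
    exact ⟨⟨comp_subset _ hf.1, this ▸ hDu e he⟩, hf.2⟩
  have hself : ∀ e ∈ D, e ∈ comp G e \ B := fun e he => ⟨mem_comp_self (hDE e he), hDB e he⟩
  set S : Set V := {t | t ≠ u ∧ t ∈ vertexSpan D} with hS
  have : Nonempty (Sym2 V) := ⟨s(u, u)⟩
  choose! E hED htE using fun t (ht : t ∈ S) => ht.2
  obtain ⟨g, hg, hgl, hgx⟩ := exists_grouping S (fun t => comp G (E t)) x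
  have hl : ∀ e ∈ D, ∀ t ∈ vertexSpan (comp G e \ B), t ≠ u → t ∈ S ∧ comp G (E t) = comp G e := by
    intro e he t ht htu
    obtain ⟨f, hf, htf⟩ := ht
    have htS : t ∈ S := ⟨htu, f, hKD e he hf, htf⟩
    refine ⟨htS, hp.comp_eq_of_two_vertices (hDE _ (hED t htS)) (hDE e he) htu
      ⟨E t, mem_comp_self (hDE _ (hED t htS)), htE t htS⟩ (hDu _ (hED t htS)) ⟨f, hf.1, htf⟩
      (hDu e he)⟩
  have hgp : Submodule.span ℝ (row p '' groupPairs S g u) ≤ Submodule.span ℝ (row p '' D) := by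
    rw [Submodule.span_le]
    rintro _ ⟨_, ⟨t, ht, rfl⟩ | ⟨t, ht, t', ht', h, rfl⟩, rfl⟩
    · exact Submodule.span_mono (Set.image_mono (hKD _ (hED t ht)))
        (hrig _ (hED t ht) _ (hu _ (hED t ht)) _ ⟨_, hself _ (hED t ht), htE t ht⟩)
    · have h' : comp G (E t) = comp G (E t') := (hgl t ht t' ht').1 h
      refine Submodule.span_mono (Set.image_mono (hKD _ (hED t ht)))
        (hrig _ (hED t ht) _ ⟨_, hself _ (hED t ht), htE t ht⟩ _ ?_)
      rw [h']
      exact ⟨_, hself _ (hED t' ht'), htE t' ht'⟩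
  have hDg : D ⊆ groupPairs S g u := by
    intro e he
    have hse := hself e he
    have hE := hDE e he
    induction e with
    | _ a b =>
      have hab : a ≠ b := by
        rw [SimpleGraph.mem_edgeSet] at hE
        exact hE.ne
      by_cases hau : a = u
      · subst hau
        exact Or.inl ⟨b, ⟨hab.symm, _, he, Sym2.mem_mk_right _ _⟩, rfl⟩
      by_cases hbu : b = u
      · subst hbu
        exact Or.inl ⟨a, ⟨hab, _, he, Sym2.mem_mk_left _ _⟩, Sym2.eq_swap⟩
      obtain ⟨ha, ha'⟩ := hl _ he a ⟨_, hse, Sym2.mem_mk_left _ _⟩ hau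
      obtain ⟨hb, hb'⟩ := hl _ he b ⟨_, hse, Sym2.mem_mk_right _ _⟩ hbu
      exact Or.inr ⟨a, ha, b, hb, (hgl a ha b hb).2 (ha'.trans hb'.symm), rfl⟩
  refine not_globallyLinked (R := G.edgeSet \ D) (Y := Y) G huv hp hg (fun h => h.1 rfl)
    (fun ⟨_, e, he, hv⟩ => hDv e he hv) ?_ ?_ ?_ (fun r h1 h2 => hspan r (hgp h1) h2)
  · intro e he
    by_cases h : e ∈ D
    · exact Or.inl (hDg h)
    · exact Or.inr ⟨he, h⟩
  · rintro e ⟨he, hn⟩ hue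
    refine hn ?_
    rw [hD]
    exact ⟨⟨he, e, mem_comp_self he, hue⟩, fun h => hBu e h hue⟩
  · intro k hk
    obtain ⟨y, rfl, hyx, hyu, hxu, e, he, hye, hxe⟩ := hY k hk
    obtain ⟨hyS, hy⟩ := hl e he y hye hyu
    obtain ⟨hxS, hx⟩ := hl e he x hxe hxu
    have : g y = x := hgx hxS y hyS (hy.trans hx.symm)
    exact ⟨y, hyS, by rw [this]; exact hyx.symm, by rw [this]⟩

theorem not_globallyLinked_of_no_common_component {u v : V} (huv : u ≠ v) (hp : Generic p)
    (h : ∀ e ∈ G.edgeSet, u ∈ vertexSpan (comp G e) → v ∉ vertexSpan (comp G e)) :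
    ¬ GloballyLinked 2 G u v := by
  refine not_globallyLinked_of_components (B := ∅) (Y := ∅) (x := u) huv.symm hp
    (D := {e | e ∈ G.edgeSet ∧ u ∈ vertexSpan (comp G e)}) (by simp) (by simp)
    (fun e he hv => h e he.1 he.2 ⟨e, mem_comp_self he.1, hv⟩) (fun e he => by simpa using he.2)
    (fun e he z hz z' hz' => ?_) (by simp) ?_
  · rw [Set.sdiff_empty] at *
    exact hp.comp_rigid hz hz'
  · intro r h1 h2
    rw [Set.union_empty] at h2
    have := hp.disjoint_span_of_union_comp (G := G)
      (D := {e | e ∈ G.edgeSet ∧ u ∈ vertexSpan (comp G e)})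
      (R := G.edgeSet \ {e | e ∈ G.edgeSet ∧ u ∈ vertexSpan (comp G e)}) disjoint_sdiff_self_right
      (Set.union_subset (fun _ h => h.1) Set.sdiff_subset)
      (fun e he f hf => ⟨hf.1, hp.comp_eq he.1 hf ▸ he.2⟩)
    rw [Submodule.disjoint_def.1 this r h1 h2]
    exact Submodule.zero_mem _

/-- Inside a component, a separator of at most two vertices between `u` and `v` prevents
`{u,v}` from being globally linked. -/
theorem not_globallyLinked_of_cut {u v : V} (huv : u ≠ v) (hp : Generic p) {e₀ : Sym2 V}
    (he₀ : e₀ ∈ G.edgeSet) (hu : u ∈ vertexSpan (comp G e₀)) (hv : v ∈ vertexSpan (comp G e₀))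
    {S : Set V} {x y : V} (hS : ∀ z ∈ S, z = x ∨ z = y) (huS : u ∉ S) (hvS : v ∉ S)
    (hcut : ¬ Conn (SimpleGraph.fromEdgeSet (comp G e₀)) Sᶜ u v) :
    ¬ GloballyLinked 2 G u v := by
  set H := comp G e₀ with hH
  have hHE : H ⊆ G.edgeSet := comp_subset e₀
  set W : Set V := {z | Conn (SimpleGraph.fromEdgeSet H) Sᶜ u z} with hW
  have huW : u ∈ W := Conn.refl huS
  set A : Set (Sym2 V) := {e | e ∈ H ∧ ∃ z ∈ e, z ∈ W} with hA
  set B : Set (Sym2 V) := H \ A with hB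
  have hAB : A ∪ B = H := Set.union_sdiff_cancel fun _ h => h.1
  have hAW : ∀ z ∈ vertexSpan A, z ∉ S → z ∈ W := by
    rintro z ⟨e, ⟨heH, w, hwe, hw⟩, hze⟩ hzS
    by_cases hzw : w = z
    · exact hzw ▸ hw
    · have : e = s(w, z) := (Sym2.mem_and_mem_iff hzw).1 ⟨hwe, hze⟩
      subst this
      have hadj : (SimpleGraph.fromEdgeSet H).Adj z w :=
        ((SimpleGraph.fromEdgeSet_adj _).2 ⟨heH, hzw⟩).symm
      exact (Conn.cons hadj hzS hw.symm).symm
  have hBW : ∀ z ∈ vertexSpan B, z ∉ W := by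
    rintro z ⟨e, ⟨heH, hnA⟩, hze⟩ hzW
    exact hnA ⟨heH, z, hze, hzW⟩
  have hvA : v ∉ vertexSpan A := fun h => hcut (hAW v h hvS)
  have huB : u ∉ vertexSpan B := fun h => hBW u h huW
  obtain ⟨a, haH, hua⟩ := hu
  obtain ⟨b, hbH, hvb⟩ := hv
  have haA : a ∈ A := ⟨haH, u, hua, huW⟩
  have hbA : b ∉ A := fun h => hvA ⟨b, h, hvb⟩
  have hnd : ¬ Disjoint (Submodule.span ℝ (row p '' A)) (Submodule.span ℝ (row p '' B)) := by
    intro hdis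
    have hb' : b ∈ comp G a := by rw [hp.comp_eq he₀ haH]; exact hbH
    obtain ⟨-, rfl | ⟨C, hC, haC, hbC⟩⟩ := hb'
    · exact hbA haA
    · have hC' := (hp.rdCircuit_iff _).1 hC.2
      exact not_disjoint_span_of_isCircuit hC'
        (hAB ▸ hp.circuit_subset_comp hC.1 hC' ⟨a, haC, haH⟩) ⟨a, haC, haA⟩
        (fun h => hbA (h hbC)) hdis
  obtain ⟨hxy, hxA, hyA, hsA, hsB, hinter, hrigA⟩ := hp.rigid_of_cut (A := A) (B := B) (x := x) (y := y)
    (fun z hzA hzB => hS z (by_contra fun hz => hBW z hzB (hAW z hzA hz)))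
    (fun z hz z' hz' => by
      rw [hAB]
      have hm : ∀ z ∈ vertexSpan A, z ∈ vertexSpan H := fun z ⟨e, he, hz⟩ => ⟨e, he.1, hz⟩
      exact hp.comp_rigid (hm z hz) (hm z' hz')) hnd
  have hxB : x ∈ vertexSpan B := hp.left_mem_vertexSpan hxy hsB
  have hyB : y ∈ vertexSpan B :=
    hp.left_mem_vertexSpan hxy.symm (Sym2.eq_swap (a := x) ▸ hsB)
  set D' : Set (Sym2 V) := {e | e ∈ G.edgeSet ∧ u ∈ vertexSpan (comp G e)} with hD'
  have hHD' : H ⊆ D' := fun f hf => ⟨hHE hf, by rw [hp.comp_eq he₀ hf]; exact ⟨a, haH, hua⟩⟩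
  have hcases : ∀ e ∈ D' \ B, (e ∈ A ∧ comp G e \ B = A) ∨
      (e ∉ H ∧ comp G e ∩ H = ∅ ∧ comp G e \ B = comp G e) := by
    intro e he
    by_cases heH : e ∈ H
    · left
      refine ⟨by_contra fun h => he.2 ⟨heH, h⟩, ?_⟩
      rw [hp.comp_eq he₀ heH, ← hH, hB, Set.sdiff_sdiff_right_self]
      exact Set.inter_eq_right.2 fun _ h => h.1
    · right
      have : comp G e ∩ H = ∅ := by
        rw [Set.eq_empty_iff_forall_notMem]
        rintro f ⟨hf, hfH⟩
        refine heH ?_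
        rw [hH, ← hp.comp_eq he₀ hfH]
        exact mem_comp_symm he.1.1 hf
      refine ⟨heH, this, ?_⟩
      rw [sdiff_eq_left, Set.disjoint_left]
      exact fun f hf hfB => (Set.eq_empty_iff_forall_notMem.1 this) f ⟨hf, hfB.1⟩
  have hd1 := hp.disjoint_span_of_union_comp (G := G) (D := D') (R := G.edgeSet \ D')
    disjoint_sdiff_self_right (Set.union_subset (fun _ h => h.1) Set.sdiff_subset)
    (fun e he f hf => ⟨hf.1, hp.comp_eq he.1 hf ▸ he.2⟩)
  have hd2 := hp.disjoint_span_of_union_comp (G := G) (D := H) (R := D' \ H)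
    disjoint_sdiff_self_right (Set.union_subset hHE fun _ h => h.1.1)
    (fun e he => (hp.comp_eq he₀ he).le)
  refine not_globallyLinked_of_components (B := B) (Y := {s(y, x)}) (x := x) huv.symm hp
    (D := D' \ B) rfl (fun e he hue => huB ⟨e, he, hue⟩) ?_ ?_ ?_ ?_ ?_
  · intro e he hve
    obtain ⟨heA, -⟩ | ⟨heH, -, -⟩ := hcases e he
    · exact hvA ⟨e, heA, hve⟩
    · refine heH ?_
      have : comp G e = comp G e₀ := hp.comp_eq_of_two_vertices he.1.1 he₀ huv he.1.2
        ⟨e, mem_comp_self he.1.1, hve⟩ ⟨a, haH, hua⟩ ⟨b, hbH, hvb⟩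
      rw [hH, ← this]
      exact mem_comp_self he.1.1
  · intro e he
    obtain ⟨-, h⟩ | ⟨-, -, h⟩ := hcases e he
    · rw [h]
      exact ⟨a, haA, hua⟩
    · rw [h]
      exact he.1.2
  · intro e he z hz z' hz'
    obtain ⟨-, h⟩ | ⟨-, -, h⟩ := hcases e he
    · rw [h] at hz hz' ⊢
      exact hrigA z hz z' hz'
    · rw [h] at hz hz' ⊢
      exact hp.comp_rigid hz hz'
  · rintro k rfl
    have haD : a ∈ D' \ B := ⟨hHD' haH, fun h => h.2 haA⟩
    have hK : comp G a \ B = A := by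
      obtain ⟨-, h⟩ | ⟨h, -⟩ := hcases a haD
      · exact h
      · exact absurd haH h
    refine ⟨y, rfl, hxy.symm, fun h => huB (h ▸ hyB),
      fun h => huB (h ▸ hxB), a, haD, ?_⟩
    rw [hK]
    exact ⟨hyA, hxA⟩
  · intro r h1 h2
    have e1 : D' \ B ⊆ A ∪ (D' \ H) := by
      rintro e ⟨he, hnB⟩
      by_cases heH : e ∈ H
      · exact Or.inl (by_contra fun h => hnB ⟨heH, h⟩)
      · exact Or.inr ⟨he, heH⟩
    have e2 : (G.edgeSet \ (D' \ B)) ∪ {s(y, x)} ⊆ (B ∪ {s(y, x)}) ∪ (G.edgeSet \ D') := by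
      rintro e (⟨he, hn⟩ | he)
      · by_cases heD : e ∈ D'
        · exact Or.inl (Or.inl (by_contra fun h => hn ⟨heD, h⟩))
        · exact Or.inr ⟨he, heD⟩
      · exact Or.inl (Or.inr he)
    have hsB' : Submodule.span ℝ (row p '' (B ∪ {s(y, x)})) ≤ Submodule.span ℝ (row p '' B) := by
      rw [Submodule.span_le]
      rintro _ ⟨e, he | rfl, rfl⟩
      · exact Submodule.subset_span ⟨e, he, rfl⟩
      · rw [Sym2.eq_swap]
        exact hsB
    have mono : ∀ {X Z : Set (Sym2 V)}, X ⊆ Z →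
        Submodule.span ℝ (row p '' X) ≤ Submodule.span ℝ (row p '' Z) :=
      fun h => Submodule.span_mono (Set.image_mono h)
    have hBH : B ⊆ H := Set.sdiff_subset
    have hAH : A ⊆ H := fun _ h => h.1
    have h1' := mono e1 h1
    have h2' := mono e2 h2
    rw [Set.image_union, Submodule.span_union, Submodule.mem_sup] at h1' h2'
    obtain ⟨α, hα, δ, hδ, hr1⟩ := h1'
    obtain ⟨β, hβ, ρ, hρ, hr2⟩ := h2'
    have hβ' := hsB' hβ
    have hρ0 : ρ = 0 := by
      refine Submodule.disjoint_def.1 hd1 ρ ?_ hρ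
      have : ρ = r - β := by rw [← hr2]; abel
      rw [this]
      exact Submodule.sub_mem _ (mono Set.sdiff_subset h1) (mono (hBH.trans hHD') hβ')
    subst hρ0
    rw [add_zero] at hr2
    subst hr2
    have hδ0 : δ = 0 := by
      refine Submodule.disjoint_def.1 hd2 δ ?_ hδ
      have : δ = β - α := by rw [← hr1]; abel
      rw [this]
      exact Submodule.sub_mem _ (mono hBH hβ') (mono hAH hα)
    subst hδ0
    rw [add_zero] at hr1
    subst hr1
    rw [Set.image_singleton, Sym2.eq_swap]
    exact hinter α hα hβ'

end Assembly

end Helpers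

/-- If a non-adjacent pair `{u,v}` is globally linked in `G` in `ℝ²`, then some
`ℛ₂`-component `H` of `G` contains `u` and `v` with `κ_H(u,v) ≥ 3`. -/
theorem globally_linked_implies_component {V : Type*} [Fintype V] [DecidableEq V]
    (G : SimpleGraph V) (u v : V) (huv : u ≠ v) (hadj : ¬ G.Adj u v)
    (hgl : GloballyLinked 2 G u v) :
    ∃ F : Set (Sym2 V), IsRdComponent 2 G F ∧
      u ∈ vertexSpan F ∧ v ∈ vertexSpan F ∧
      InternallyDisjointPaths (SimpleGraph.fromEdgeSet F) u v 3 := by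
  by_contra hno
  obtain ⟨p, hp⟩ := (dense_generic (V := V)).nonempty
  by_cases h : ∃ e ∈ G.edgeSet, u ∈ vertexSpan (comp G e) ∧ v ∈ vertexSpan (comp G e)
  · obtain ⟨e, he, hu, hv⟩ := h
    have hadj' : ¬ (SimpleGraph.fromEdgeSet (comp G e)).Adj u v := fun h =>
      hadj (comp_subset e ((SimpleGraph.fromEdgeSet_adj _).1 h).1)
    obtain hP | ⟨S, hcard, huS, hvS, hcut⟩ := internallyDisjointPaths_or_cut _ huv hadj' 3
    · exact hno ⟨comp G e, ⟨e, he, rfl⟩, hu, hv, hP⟩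
    · obtain ⟨x, y, hxy⟩ : ∃ x y, ∀ z ∈ S, z = x ∨ z = y := by
        interval_cases hS : S.card
        · rw [Finset.card_eq_zero.1 hS]
          exact ⟨u, u, by simp⟩
        · obtain ⟨x, rfl⟩ := Finset.card_eq_one.1 hS
          exact ⟨x, x, by simp⟩
        · obtain ⟨x, y, -, rfl⟩ := Finset.card_eq_two.1 hS
          exact ⟨x, y, by simp⟩
      exact not_globallyLinked_of_cut huv hp he hu hv (S := S) hxy huS hvS hcut hgl
  · push Not at h
    exact not_globallyLinked_of_no_common_component huv hp h hgl

end Rigidity
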